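/- arXiv:2304.00120 — 2 statements merged into one kernel-verified Lean document; each statement's English description precedes it below -/
import Mathlib

section
/- Let K ⊂ ℝⁿ be an o-symmetric convex body with dim K = n. Then πⁿ/n! ≤ vol(K) · vol(K*) ≤ ω_n², where ω_n is the volume of the n-dimensional Euclidean unit ball. -/
open MeasureTheory Pointwise

/-- The polar body `K* = {y : ⟨x, y⟩ ≤ 1 for all x ∈ K}` with respect to the
standard inner product on `ℝⁿ`. -/
def polarBody {n : ℕ} (K : Set (Fin n → ℝ)) : Set (Fin n → ℝ) :=
  {y | ∀ x ∈ K, (∑ i, x i * y i) ≤ 1}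

section Holomorphic

open Filter Topology Metric

/-- An integral depending holomorphically on a parameter, with locally uniform integrable bounds,
is holomorphic. -/
theorem differentiableOn_integral_of_locally_dominated {α : Type*} [MeasurableSpace α]
    {μ : Measure α} {F : ℂ → α → ℂ} {U : Set ℂ} (hU : IsOpen U)
    (hm : ∀ z ∈ U, AEStronglyMeasurable (F z) μ)
    (hd : ∀ a, DifferentiableOn ℂ (fun z => F z a) U)
    (hb : ∀ z ∈ U, ∃ ε > 0, ∃ b : α → ℝ, Integrable b μ ∧ ∀ a, ∀ z' ∈ ball z ε, ‖F z' a‖ ≤ b a) :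
    DifferentiableOn ℂ (fun z => ∫ a, F z a ∂μ) U := by
  intro z hz
  obtain ⟨ε₁, hε₁, b, hbi, hbb⟩ := hb z hz
  obtain ⟨ε₂, hε₂, hsub⟩ := Metric.isOpen_iff.1 hU z hz
  set r := min ε₁ ε₂ / 3 with hr
  have hr0 : 0 < r := by positivity
  have hr1 : 3 * r ≤ ε₁ := by rw [hr]; linarith [min_le_left ε₁ ε₂]
  have hr2 : 3 * r ≤ ε₂ := by rw [hr]; linarith [min_le_right ε₁ ε₂]
  have hder : ∀ a, ∀ w ∈ ball z r, HasDerivAt (fun z => F z a) (deriv (fun z => F z a) w) w := by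
    intro a w hw
    have hwU : w ∈ U := hsub (ball_subset_ball (by linarith) hw)
    exact ((hd a).differentiableAt (hU.mem_nhds hwU)).hasDerivAt
  refine (hasDerivAt_integral_of_dominated_loc_of_deriv_le (bound := fun a => b a / r)
    (F' := fun w a => deriv (fun z => F z a) w) (ball_mem_nhds z hr0) ?_ ?_ ?_ ?_ ?_
    ?_).2.differentiableAt.differentiableWithinAt
  · filter_upwards [hU.mem_nhds hz] with w hw using hm w hw
  · exact hbi.mono' (hm z hz) (ae_of_all _ fun a => hbb a z (mem_ball_self hε₁))
  · have hseq : Tendsto (fun k : ℕ => (z + (r / (k + 1) : ℝ) : ℂ)) atTop (𝓝[≠] z) := by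
      refine tendsto_nhdsWithin_iff.2 ⟨?_, Eventually.of_forall fun k => ?_⟩
      · have h1 : Tendsto (fun k : ℕ => r / ((k : ℝ) + 1)) atTop (𝓝 0) := by
          simpa using (tendsto_const_nhds (x := r)).mul
            (tendsto_one_div_add_atTop_nhds_zero_nat (𝕜 := ℝ)) |>.congr fun k => by ring
        have h2 := (Complex.continuous_ofReal.tendsto 0).comp h1
        simpa using (tendsto_const_nhds (x := z)).add h2
      · have : (r / ((k : ℝ) + 1)) ≠ 0 := by positivity
        simp only [Set.mem_compl_iff, Set.mem_singleton_iff, add_eq_left]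
        exact_mod_cast this
    refine aestronglyMeasurable_of_tendsto_ae atTop
      (f := fun (k : ℕ) a => slope (fun z => F z a) z (z + (r / (k + 1) : ℝ))) ?_ ?_
    · intro k
      have hk : z + ((r / (k + 1) : ℝ) : ℂ) ∈ U := by
        apply hsub
        rw [mem_ball, dist_eq_norm, add_sub_cancel_left, Complex.norm_real, Real.norm_eq_abs,
          abs_of_pos (by positivity)]
        have : r / ((k : ℝ) + 1) ≤ r := div_le_self hr0.le (by linarith [k.cast_nonneg (α := ℝ)])
        linarith
      simp only [slope_def_field]
      simp only [div_eq_mul_inv]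
      exact AEStronglyMeasurable.mul_const ((hm _ hk).sub (hm _ hz)) _
    · exact ae_of_all _ fun a =>
        (hasDerivAt_iff_tendsto_slope.1 (hder a z (mem_ball_self hr0))).comp hseq
  · refine ae_of_all _ fun a w hw => ?_
    have hsubw : closedBall w r ⊆ ball z (3 * r) := fun v hv => by
      rw [mem_closedBall] at hv; rw [mem_ball] at hw ⊢
      linarith [dist_triangle v w z]
    refine Complex.norm_deriv_le_of_forall_mem_sphere_norm_le hr0 ?_ ?_
    · refine DifferentiableOn.diffContOnCl ?_
      rw [closure_ball _ hr0.ne']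
      exact (hd a).mono (hsubw.trans ((ball_subset_ball hr2).trans hsub))
    · exact fun v hv => hbb a v (ball_subset_ball hr1 (hsubw (sphere_subset_closedBall hv)))
  · exact hbi.div_const r
  · exact ae_of_all _ hder

end Holomorphic

section Gaussian

variable {κ : Type*} [Fintype κ]

theorem integrable_exp_neg_mul_sum_sq {c : ℝ} (hc : 0 < c) :
    Integrable fun w : κ → ℝ => Real.exp (-c * ∑ j, w j ^ 2) := by
  have := Integrable.fintype_prod (μ := fun _ : κ => (volume : Measure ℝ))
    (f := fun _ x => Real.exp (-c * x ^ 2)) (fun _ => integrable_exp_neg_mul_sq hc)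
  rw [volume_pi]
  refine this.congr (ae_of_all _ fun w => ?_)
  simp only
  rw [← Real.exp_sum, Finset.mul_sum]

theorem integral_cexp_neg_sum_sq :
    ∫ w : κ → ℝ, Complex.exp (-∑ j, (w j : ℂ) ^ 2) = ((√Real.pi ^ Fintype.card κ : ℝ) : ℂ) := by
  have h : ∀ w : κ → ℝ, Complex.exp (-∑ j, (w j : ℂ) ^ 2)
      = ∏ j, ((Real.exp (-1 * (w j) ^ 2) : ℝ) : ℂ) := by
    intro w
    push_cast
    rw [← Complex.exp_sum, ← Finset.sum_neg_distrib]
    congr 2; ext j; ring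
  simp_rw [h]
  rw [integral_fintype_prod_volume_eq_pow (fun x : ℝ => ((Real.exp (-1 * x ^ 2) : ℝ) : ℂ)),
    integral_complex_ofReal, integral_gaussian]
  simp

/-- If `|b| ≤ L |a|` then `Re ∑ (aⱼ + τ bⱼ)²` is bounded below by a multiple of `|a|²` as long as
`L (|Re τ| + |Im τ|) < 1`. -/
theorem re_sum_sq_lower_bound {a b : κ → ℝ} {L ρ : ℝ} (hL : 0 ≤ L)
    (hab : ∑ j, b j ^ 2 ≤ L ^ 2 * ∑ j, a j ^ 2) {τ : ℂ}
    (hτ : L * (|τ.re| + |τ.im|) ≤ ρ) (hρ : ρ ≤ 1) :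
    (1 - ρ) ^ 2 * ∑ j, a j ^ 2 ≤ (∑ j, ((a j : ℂ) + τ * b j) ^ 2).re := by
  set A := ∑ j, a j ^ 2 with hA
  set B := ∑ j, b j ^ 2 with hB
  set P := ∑ j, a j * b j with hP
  have hre : (∑ j, ((a j : ℂ) + τ * b j) ^ 2).re
      = A + 2 * τ.re * P + τ.re ^ 2 * B - τ.im ^ 2 * B := by
    rw [Complex.re_sum, hA, hB, hP, Finset.mul_sum, Finset.mul_sum, Finset.mul_sum,
      ← Finset.sum_add_distrib, ← Finset.sum_add_distrib, ← Finset.sum_sub_distrib]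
    refine Finset.sum_congr rfl fun j _ => ?_
    simp [sq]
    ring
  have hA0 : 0 ≤ A := Finset.sum_nonneg fun j _ => sq_nonneg _
  have hB0 : 0 ≤ B := Finset.sum_nonneg fun j _ => sq_nonneg _
  have hcs : P ^ 2 ≤ A * B := Finset.sum_mul_sq_le_sq_mul_sq _ _ _
  obtain ⟨s, hs0, hs⟩ : ∃ s, 0 ≤ s ∧ s ^ 2 = A := ⟨√A, Real.sqrt_nonneg _, Real.sq_sqrt hA0⟩
  obtain ⟨t, ht0, ht⟩ : ∃ t, 0 ≤ t ∧ t ^ 2 = B := ⟨√B, Real.sqrt_nonneg _, Real.sq_sqrt hB0⟩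
  rw [hre, ← hs, ← ht]
  have hts : t ≤ L * s := by
    apply le_of_sq_le_sq _ (by positivity)
    rw [mul_pow, hs, ht]; exact hab
  have hPst : |P| ≤ s * t := by
    apply abs_le_of_sq_le_sq _ (by positivity)
    rw [mul_pow, hs, ht]; exact hcs
  have h1 : -(|τ.re| * (s * t)) ≤ τ.re * P := by
    have := neg_abs_le (τ.re * P)
    rw [abs_mul] at this
    have := mul_le_mul_of_nonneg_left hPst (abs_nonneg τ.re)
    linarith
  have hx := abs_nonneg τ.re
  have hy := abs_nonneg τ.im
  rw [← sq_abs τ.re, ← sq_abs τ.im]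
  have e1 : |τ.re| * t ≤ |τ.re| * (L * s) := mul_le_mul_of_nonneg_left hts hx
  have e2 : |τ.im| * t ≤ |τ.im| * (L * s) := mul_le_mul_of_nonneg_left hts hy
  have e3 : (L * (|τ.re| + |τ.im|)) * s ≤ ρ * s := mul_le_mul_of_nonneg_right hτ hs0
  have f1 : (1 - ρ) * s ≤ s - |τ.re| * t - |τ.im| * t := by linarith
  have f2 : (1 - ρ) * s ≤ s - |τ.re| * t + |τ.im| * t := by
    have : 0 ≤ |τ.im| * t := by positivity
    linarith
  have f3 : 0 ≤ (1 - ρ) * s := mul_nonneg (by linarith) hs0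
  have := mul_le_mul f1 f2 f3 (f3.trans f1)
  nlinarith

theorem norm_det_le_of_norm_entry_le [DecidableEq κ] {A : Matrix κ κ ℂ} {R : ℝ}
    (h : ∀ i j, ‖A i j‖ ≤ R) :
    ‖A.det‖ ≤ (Fintype.card κ).factorial * R ^ Fintype.card κ := by
  have := Matrix.det_le (abv := NormedField.toAbsoluteValue ℂ) (A := A) (x := R) h
  rwa [nsmul_eq_mul] at this

theorem exists_det_one_add_pos [DecidableEq κ] :
    ∃ δ > 0, ∀ X : Matrix κ κ ℝ, (∀ i j, |X i j| < δ) → 0 < (1 + X).det := by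
  have hc : Continuous fun X : κ → κ → ℝ => (1 + (Matrix.of X)).det := by
    apply Continuous.matrix_det
    exact continuous_const.add continuous_id
  have h0 : 0 < (1 + Matrix.of (0 : κ → κ → ℝ)).det := by
    have : Matrix.of (0 : κ → κ → ℝ) = 0 := rfl
    simp [this]
  obtain ⟨δ, hδ, h⟩ := Metric.mem_nhds_iff.1 (hc.continuousAt.eventually (lt_mem_nhds h0))
  refine ⟨δ, hδ, fun X hX => h (a := fun i j => X i j) ?_⟩
  rw [mem_ball_zero_iff, pi_norm_lt_iff hδ]
  intro i
  rw [pi_norm_lt_iff hδ]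
  exact fun j => hX i j

end Gaussian

section Contour

open Filter Topology Metric Set

variable {κ : Type*} [Fintype κ] [DecidableEq κ]

/-- The Jacobian matrix of a map at a point. -/
noncomputable def jacobianMatrix (Θ : (κ → ℝ) → (κ → ℝ)) (w : κ → ℝ) : Matrix κ κ ℝ :=
  LinearMap.toMatrix' (fderiv ℝ Θ w : (κ → ℝ) →ₗ[ℝ] (κ → ℝ))

/-- The Gaussian integrand pulled back along `w ↦ w + τ Θ(w)`. -/
noncomputable def contourIntegrand (Θ : (κ → ℝ) → (κ → ℝ)) (τ : ℂ) (w : κ → ℝ) : ℂ :=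
  Complex.exp (-∑ j, ((w j : ℂ) + τ * Θ w j) ^ 2) *
    (1 + τ • (jacobianMatrix Θ w).map ((↑) : ℝ → ℂ)).det

theorem measurable_jacobianMatrix_apply (Θ : (κ → ℝ) → (κ → ℝ)) (i j : κ) :
    Measurable fun w => jacobianMatrix Θ w i j := by
  simp only [jacobianMatrix, LinearMap.toMatrix'_apply]
  exact (measurable_pi_apply i).comp (measurable_fderiv_apply_const ℝ Θ _)

theorem measurable_contourIntegrand {Θ : (κ → ℝ) → (κ → ℝ)} (hΘ : Continuous Θ) (τ : ℂ) :
    Measurable (contourIntegrand Θ τ) := by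
  unfold contourIntegrand
  refine Measurable.mul ?_ ?_
  · refine Continuous.measurable ?_
    fun_prop
  · have hc : Continuous fun X : κ → κ → ℂ => (1 + τ • Matrix.of X).det := by
      apply Continuous.matrix_det
      exact continuous_const.add (continuous_id.const_smul τ)
    exact hc.measurable.comp (measurable_pi_lambda _ fun i => measurable_pi_lambda _ fun j =>
      Complex.measurable_ofReal.comp (measurable_jacobianMatrix_apply Θ i j))

theorem abs_jacobianMatrix_le {Θ : (κ → ℝ) → (κ → ℝ)} {C : NNReal} (hΘ : LipschitzWith C Θ)
    (w : κ → ℝ) (i j : κ) : |jacobianMatrix Θ w i j| ≤ C := by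
  simp only [jacobianMatrix, LinearMap.toMatrix'_apply]
  calc |(fderiv ℝ Θ w) (Pi.single j 1) i| ≤ ‖(fderiv ℝ Θ w) (Pi.single j 1)‖ :=
        norm_le_pi_norm ((fderiv ℝ Θ w) (Pi.single j 1)) i
    _ ≤ ‖fderiv ℝ Θ w‖ * ‖(Pi.single j 1 : κ → ℝ)‖ := ContinuousLinearMap.le_opNorm _ _
    _ ≤ C * 1 := by
        gcongr
        · exact norm_fderiv_le_of_lipschitz ℝ hΘ
        · rw [Pi.norm_single]; simp
    _ = C := mul_one _

theorem differentiable_contourIntegrand (Θ : (κ → ℝ) → (κ → ℝ)) (w : κ → ℝ) :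
    Differentiable ℂ fun τ => contourIntegrand Θ τ w := by
  unfold contourIntegrand
  refine Differentiable.mul (by fun_prop) ?_
  simp only [Matrix.det_apply, Matrix.add_apply, Matrix.smul_apply]
  fun_prop

theorem norm_contourIntegrand_le {Θ : (κ → ℝ) → (κ → ℝ)} {C : NNReal} (hΘ : LipschitzWith C Θ)
    {L ρ : ℝ} (hL : 0 ≤ L) (hρ : ρ ≤ 1) (hΘL : ∀ w, ∑ j, Θ w j ^ 2 ≤ L ^ 2 * ∑ j, w j ^ 2)
    {τ : ℂ} (hτ : L * (|τ.re| + |τ.im|) ≤ ρ) {R : ℝ} (hR : ‖τ‖ ≤ R) (w : κ → ℝ) :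
    ‖contourIntegrand Θ τ w‖ ≤ Real.exp (-(1 - ρ) ^ 2 * ∑ j, w j ^ 2) *
      ((Fintype.card κ).factorial * (1 + R * C) ^ Fintype.card κ) := by
  have hC : (0 : ℝ) ≤ C := C.2
  unfold contourIntegrand
  rw [norm_mul]
  refine mul_le_mul ?_ ?_ (norm_nonneg _) (Real.exp_pos _).le
  · rw [Complex.norm_exp, Real.exp_le_exp, Complex.neg_re]
    have := re_sum_sq_lower_bound hL (hΘL w) hτ hρ
    linarith
  · refine norm_det_le_of_norm_entry_le fun i j => ?_
    simp only [Matrix.add_apply, Matrix.smul_apply, Matrix.map_apply]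
    refine (norm_add_le _ _).trans (add_le_add ?_ ?_)
    · rw [Matrix.one_apply]
      split_ifs <;> simp
    · rw [norm_smul, Complex.norm_real, Real.norm_eq_abs]
      have := abs_jacobianMatrix_le hΘ w i j
      have := norm_nonneg τ
      gcongr
      linarith

theorem integral_contourIntegrand_of_small {Θ : (κ → ℝ) → (κ → ℝ)} {C : NNReal}
    (hΘ : LipschitzWith C Θ) :
    ∃ ε > 0, ∀ t : ℝ, |t| < ε →
      ∫ w, contourIntegrand Θ t w = ((√Real.pi ^ Fintype.card κ : ℝ) : ℂ) := by
  obtain ⟨δ, hδ, hdet⟩ := exists_det_one_add_pos (κ := κ)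
  have hC : (0 : ℝ) ≤ C := C.2
  refine ⟨min δ 1 / (C + 1), by positivity, fun t ht => ?_⟩
  rw [lt_div_iff₀ (by positivity)] at ht
  have ht1 : |t| * C < δ := by nlinarith [min_le_left δ 1, abs_nonneg t]
  have ht2 : |t| * C < 1 := by nlinarith [min_le_right δ 1, abs_nonneg t]
  set Ψ : (κ → ℝ) → (κ → ℝ) := fun w => w + t • Θ w with hΨ
  have hΨlip : LipschitzWith (1 + ‖t‖₊ * C) Ψ :=
    LipschitzWith.id.add ((lipschitzWith_smul t).comp hΘ)
  set s := {w | DifferentiableAt ℝ Θ w} with hs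
  have hsm : MeasurableSet s := measurableSet_of_differentiableAt ℝ Θ
  have hsae : ∀ᵐ w, w ∈ s := hΘ.ae_differentiableAt
  have happ : ApproximatesLinearOn Ψ
      ((ContinuousLinearEquiv.refl ℝ (κ → ℝ) : (κ → ℝ) ≃L[ℝ] (κ → ℝ)) :
        (κ → ℝ) →L[ℝ] (κ → ℝ)) univ (‖t‖₊ * C) := by
    intro x _ y _
    have h1 : Ψ x - Ψ y - (x - y) = t • (Θ x - Θ y) := by
      simp only [hΨ, smul_sub]; abel
    simp only [ContinuousLinearEquiv.coe_coe, ContinuousLinearEquiv.coe_refl', id]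
    rw [h1, norm_smul, NNReal.coe_mul, coe_nnnorm, mul_assoc]
    gcongr
    simpa [dist_eq_norm] using hΘ.dist_le_mul x y
  have hN : Subsingleton (κ → ℝ) ∨ (‖t‖₊ * C : NNReal) <
      ‖(((ContinuousLinearEquiv.refl ℝ (κ → ℝ)).symm : (κ → ℝ) ≃L[ℝ] (κ → ℝ)) :
        (κ → ℝ) →L[ℝ] (κ → ℝ))‖₊⁻¹ := by
    rcases subsingleton_or_nontrivial (κ → ℝ) with h | h
    · exact Or.inl h
    · right
      have : ‖(((ContinuousLinearEquiv.refl ℝ (κ → ℝ)).symm : (κ → ℝ) ≃L[ℝ] (κ → ℝ)) :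
        (κ → ℝ) →L[ℝ] (κ → ℝ))‖₊ = 1 := by
        rw [← NNReal.coe_inj]
        exact ContinuousLinearMap.norm_id
      rw [this, inv_one, ← NNReal.coe_lt_coe]
      simpa using ht2
  have hsurj : Function.Surjective Ψ := (happ.toHomeomorph Ψ hN).surjective
  have hinj : Function.Injective Ψ := (happ.toHomeomorph Ψ hN).injective
  have hnull : volume (Ψ '' sᶜ) = 0 := by
    have h0 : volume sᶜ = 0 := hsae
    have := hΨlip.hausdorffMeasure_image_le (d := (Fintype.card κ : ℝ)) (by positivity) sᶜ
    rw [hausdorffMeasure_pi_real, h0, mul_zero] at this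
    exact le_antisymm this bot_le
  have himage : Ψ '' s =ᵐ[volume] univ := by
    rw [ae_eq_univ]
    refine measure_mono_null ?_ hnull
    rintro y hy
    obtain ⟨x, rfl⟩ := hsurj y
    exact ⟨x, fun hx => hy ⟨x, hx, rfl⟩, rfl⟩
  have hderiv : ∀ w ∈ s, HasFDerivWithinAt Ψ
      (ContinuousLinearMap.id ℝ (κ → ℝ) + t • fderiv ℝ Θ w) s w := fun w hw =>
    ((hasFDerivAt_id w).add (DifferentiableAt.hasFDerivAt hw |>.const_smul t)).hasFDerivWithinAt
  have hdetw : ∀ w, (ContinuousLinearMap.id ℝ (κ → ℝ) + t • fderiv ℝ Θ w).det =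
      (1 + t • jacobianMatrix Θ w).det := by
    intro w
    rw [ContinuousLinearMap.det, ← LinearMap.det_toMatrix']
    congr 1
    simp [jacobianMatrix, LinearMap.toMatrix'_id]
  have hpos : ∀ w, 0 < (1 + t • jacobianMatrix Θ w).det := fun w => by
    refine hdet _ fun i j => ?_
    rw [Matrix.smul_apply, smul_eq_mul, abs_mul]
    exact (mul_le_mul_of_nonneg_left (abs_jacobianMatrix_le hΘ w i j) (abs_nonneg t)).trans_lt ht1
  calc ∫ w, contourIntegrand Θ t w
      = ∫ w in s, contourIntegrand Θ t w := by
        rw [Measure.restrict_eq_self_of_ae_mem hsae]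
    _ = ∫ w in s, |(ContinuousLinearMap.id ℝ (κ → ℝ) + t • fderiv ℝ Θ w).det| •
          Complex.exp (-∑ j, (Ψ w j : ℂ) ^ 2) := by
        congr 1 with w
        rw [hdetw, abs_of_pos (hpos w), contourIntegrand, mul_comm, Complex.real_smul]
        congr 1
        · have : (1 + (t : ℂ) • (jacobianMatrix Θ w).map ((↑) : ℝ → ℂ))
              = (Complex.ofRealHom).mapMatrix (1 + t • jacobianMatrix Θ w) := by
            ext i j
            by_cases h : i = j <;> simp [h]
          rw [this, ← RingHom.map_det]
          rfl
        · simp [hΨ]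
    _ = ∫ y in Ψ '' s, Complex.exp (-∑ j, (y j : ℂ) ^ 2) :=
        (integral_image_eq_integral_abs_det_fderiv_smul volume hsm hderiv hinj.injOn
          (fun y => Complex.exp (-∑ j, (y j : ℂ) ^ 2))).symm
    _ = ∫ y : κ → ℝ, Complex.exp (-∑ j, (y j : ℂ) ^ 2) := by
        rw [setIntegral_congr_set himage, setIntegral_univ]
    _ = _ := integral_cexp_neg_sum_sq

/-- The Gaussian integral over the totally real graph `{w + i Θ(w)}` of a contraction `Θ` is the
same as over `ℝᴺ`. -/
theorem integral_contourIntegrand_I {Θ : (κ → ℝ) → (κ → ℝ)} {C : NNReal}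
    (hΘ : LipschitzWith C Θ) {L : ℝ} (hL0 : 0 ≤ L) (hL1 : L < 1)
    (hΘL : ∀ w, ∑ j, Θ w j ^ 2 ≤ L ^ 2 * ∑ j, w j ^ 2) :
    ∫ w, contourIntegrand Θ Complex.I w = ((√Real.pi ^ Fintype.card κ : ℝ) : ℂ) := by
  set U : Set ℂ := {τ | L * (|τ.re| + |τ.im|) < 1} with hU
  have hUo : IsOpen U := isOpen_lt (by fun_prop) continuous_const
  have hUc : Convex ℝ U := by
    intro x hx y hy a b ha hb hab
    simp only [hU, mem_ofPred_eq] at hx hy ⊢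
    have e1 : |(a • x + b • y).re| ≤ a * |x.re| + b * |y.re| := by
      simp only [Complex.add_re, Complex.smul_re, smul_eq_mul]
      refine (abs_add_le _ _).trans (le_of_eq ?_)
      rw [abs_mul, abs_mul, abs_of_nonneg ha, abs_of_nonneg hb]
    have e2 : |(a • x + b • y).im| ≤ a * |x.im| + b * |y.im| := by
      simp only [Complex.add_im, Complex.smul_im, smul_eq_mul]
      refine (abs_add_le _ _).trans (le_of_eq ?_)
      rw [abs_mul, abs_mul, abs_of_nonneg ha, abs_of_nonneg hb]
    have e3 : L * (|(a • x + b • y).re| + |(a • x + b • y).im|) ≤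
        a * (L * (|x.re| + |x.im|)) + b * (L * (|y.re| + |y.im|)) := by
      nlinarith
    rcases ha.eq_or_lt with h | h
    · have : b = 1 := by linarith
      rw [← h, this] at e3 ⊢; linarith
    · nlinarith
  have h0U : (0 : ℂ) ∈ U := by simp [hU]
  have hIU : Complex.I ∈ U := by simpa [hU] using hL1
  have hdiff : DifferentiableOn ℂ (fun τ => ∫ w, contourIntegrand Θ τ w) U := by
    refine differentiableOn_integral_of_locally_dominated hUo
      (fun τ _ => (measurable_contourIntegrand hΘ.continuous τ).aestronglyMeasurable)
      (fun w => (differentiable_contourIntegrand Θ w).differentiableOn) fun τ hτ => ?_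
    have hτ' : L * (|τ.re| + |τ.im|) < 1 := hτ
    set σ := L * (|τ.re| + |τ.im|) with hσ
    set ρ := (1 + σ) / 2 with hρ
    refine ⟨(1 - σ) / 4, by linarith, fun w => Real.exp (-(1 - ρ) ^ 2 * ∑ j, w j ^ 2) *
      ((Fintype.card κ).factorial * (1 + (‖τ‖ + (1 - σ) / 4) * C) ^ Fintype.card κ), ?_, ?_⟩
    · have : 0 < (1 - ρ) ^ 2 := by
        have : 0 < 1 - ρ := by rw [hρ]; linarith
        positivity
      have := (integrable_exp_neg_mul_sum_sq (κ := κ) this)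
      simp only [neg_mul] at this ⊢
      exact this.mul_const _
    · intro w τ' hh
      rw [mem_ball, dist_eq_norm] at hh
      refine norm_contourIntegrand_le hΘ hL0 (by rw [hρ]; linarith) hΘL ?_ ?_ w
      · have e1 := (Complex.abs_re_le_norm (τ' - τ))
        have e2 := (Complex.abs_im_le_norm (τ' - τ))
        rw [Complex.sub_re] at e1
        rw [Complex.sub_im] at e2
        have e3 := abs_sub_abs_le_abs_sub τ'.re τ.re
        have e4 := abs_sub_abs_le_abs_sub τ'.im τ.im
        have e5 : |τ'.re| + |τ'.im| ≤ |τ.re| + |τ.im| + (1 - σ) / 2 := by linarith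
        have e6 := mul_le_mul_of_nonneg_left e5 hL0
        rw [hρ]
        nlinarith
      · have := norm_sub_norm_le τ' τ
        linarith
  obtain ⟨ε, hε, hsmall⟩ := integral_contourIntegrand_of_small hΘ
  have hfreq : ∃ᶠ τ in 𝓝[≠] (0 : ℂ), ∫ w, contourIntegrand Θ τ w =
      ((√Real.pi ^ Fintype.card κ : ℝ) : ℂ) := by
    have hseq : Tendsto (fun k : ℕ => ((1 / ((k : ℝ) + 1) : ℝ) : ℂ)) atTop (𝓝[≠] 0) := by
      refine tendsto_nhdsWithin_iff.2 ⟨?_, Eventually.of_forall fun k => ?_⟩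
      · have h2 := (Complex.continuous_ofReal.tendsto 0).comp
          (tendsto_one_div_add_atTop_nhds_zero_nat (𝕜 := ℝ))
        rwa [Complex.ofReal_zero] at h2
      · have : (1 / ((k : ℝ) + 1)) ≠ 0 := by positivity
        simp only [mem_compl_iff, mem_singleton_iff]
        exact_mod_cast this
    refine hseq.frequently (Eventually.frequently ?_)
    filter_upwards [(tendsto_one_div_add_atTop_nhds_zero_nat (𝕜 := ℝ)).eventually
      (gt_mem_nhds hε)] with k hk
    apply hsmall
    rwa [abs_of_pos (by positivity)]
  exact (hdiff.analyticOnNhd hUo).eqOn_of_preconnected_of_frequently_eq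
    (analyticOnNhd_const) hUc.isPreconnected h0U hfreq hIU

end Contour

section Proximal

open Filter Topology Metric Set

variable {ι : Type*} [Fintype ι]

theorem norm_sq_le_sum_sq (x : ι → ℝ) : ‖x‖ ^ 2 ≤ ∑ i, x i ^ 2 := by
  have h : ‖x‖ ≤ √(∑ i, x i ^ 2) := by
    refine (pi_norm_le_iff_of_nonneg (Real.sqrt_nonneg _)).2 fun i => ?_
    apply Real.le_sqrt_of_sq_le
    rw [Real.norm_eq_abs, sq_abs]
    exact Finset.single_le_sum (f := fun i => x i ^ 2) (fun i _ => sq_nonneg _) (Finset.mem_univ i)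
  calc ‖x‖ ^ 2 ≤ √(∑ i, x i ^ 2) ^ 2 := by gcongr
    _ = _ := Real.sq_sqrt (Finset.sum_nonneg fun i _ => sq_nonneg _)

/-- Every vector `a` decomposes as `x + y` with `y` in the subdifferential of `G² / 2` at `x`. -/
theorem exists_subgradient_decomposition {G : (ι → ℝ) → ℝ} (hGc : Continuous G)
    (hG0 : ∀ x, 0 ≤ G x) (hGs : ∀ r x, G (r • x) = |r| * G x)
    (hGa : ∀ x y, G (x + y) ≤ G x + G y) (a : ι → ℝ) :
    ∃ x, ∀ z, G x ^ 2 / 2 + ∑ i, (a i - x i) * (z i - x i) ≤ G z ^ 2 / 2 := by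
  set J : (ι → ℝ) → ℝ := fun x => G x ^ 2 / 2 + ∑ i, (x i - a i) ^ 2 / 2 with hJ
  have hJc : Continuous J := by fun_prop
  have hJt : Tendsto J (cocompact _) atTop := by
    have h1 : Tendsto (fun x : ι → ℝ => (‖x‖ - ‖a‖) ^ 2 / 2) (cocompact _) atTop := by
      refine Tendsto.atTop_div_const (by norm_num) ?_
      refine (tendsto_pow_atTop (by norm_num)).comp ?_
      exact tendsto_atTop_add_const_right _ _ (tendsto_norm_cocompact_atTop)
    refine tendsto_atTop_mono (fun x => ?_) h1
    have h2 := norm_sq_le_sum_sq (x - a)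
    have h3 : (‖x‖ - ‖a‖) ^ 2 ≤ ‖x - a‖ ^ 2 := sq_le_sq.2 (by
      rw [abs_of_nonneg (norm_nonneg (x - a))]; exact abs_norm_sub_norm_le x a)
    simp only [hJ]
    rw [← Finset.sum_div]
    simp only [Pi.sub_apply] at h2
    nlinarith [sq_nonneg (G x)]
  obtain ⟨x, hx⟩ := hJc.exists_forall_le hJt
  refine ⟨x, fun z => ?_⟩
  set S := ∑ i, (a i - x i) * (z i - x i) with hS
  set D := ∑ i, (z i - x i) ^ 2 with hD
  have hD0 : 0 ≤ D := Finset.sum_nonneg fun i _ => sq_nonneg _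
  have key : ∀ t : ℝ, 0 < t → t ≤ 1 → G x ^ 2 / 2 + S ≤ G z ^ 2 / 2 + t * (D / 2) := by
    intro t ht ht1
    have h1 := hx ((1 - t) • x + t • z)
    have h2 : G ((1 - t) • x + t • z) ^ 2 ≤ (1 - t) * G x ^ 2 + t * G z ^ 2 := by
      have h3 : G ((1 - t) • x + t • z) ≤ (1 - t) * G x + t * G z := by
        refine (hGa _ _).trans (le_of_eq ?_)
        rw [hGs, hGs, abs_of_nonneg (by linarith), abs_of_pos ht]
      have h4 := mul_self_le_mul_self (hG0 _) h3
      nlinarith [mul_nonneg (mul_nonneg ht.le (sub_nonneg.2 ht1)) (sq_nonneg (G x - G z))]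
    have h5 : ∑ i, (((1 - t) • x + t • z) i - a i) ^ 2 / 2 =
        ∑ i, (x i - a i) ^ 2 / 2 - t * S + t ^ 2 * (D / 2) := by
      rw [hS, hD, Finset.sum_div, Finset.mul_sum, Finset.mul_sum, ← Finset.sum_sub_distrib,
        ← Finset.sum_add_distrib]
      refine Finset.sum_congr rfl fun i _ => ?_
      simp only [Pi.add_apply, Pi.smul_apply, smul_eq_mul]
      ring
    simp only [hJ] at h1
    rw [h5] at h1
    have h6 : t * (G x ^ 2 / 2 + S) ≤ t * (G z ^ 2 / 2 + t * (D / 2)) := by nlinarith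
    exact le_of_mul_le_mul_left h6 ht
  refine le_of_forall_pos_le_add fun ε hε => ?_
  refine (key (min 1 (ε / (D + 1))) (by positivity) (min_le_left _ _)).trans ?_
  have h7 : min 1 (ε / (D + 1)) * (D / 2) ≤ ε / (D + 1) * (D / 2) := by
    gcongr; exact min_le_right _ _
  have h8 : ε / (D + 1) * (D / 2) ≤ ε := by
    rw [div_mul_div_comm, div_le_iff₀ (by positivity)]
    nlinarith
  linarith

/-- The reflected resolvent of the subdifferential of `G² / 2`: its graph, in rotated coordinates,
is the graph of the duality map between `G` and its dual `H`. -/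
theorem exists_reflected_resolvent {G H : (ι → ℝ) → ℝ} (hGc : Continuous G)
    (hG0 : ∀ x, 0 ≤ G x) (hGs : ∀ r x, G (r • x) = |r| * G x)
    (hGa : ∀ x y, G (x + y) ≤ G x + G y) (hH0 : ∀ y, 0 ≤ H y)
    (hH : ∀ y c, 0 < c → (∀ x, ∑ i, x i * y i ≤ c * G x) → H y ≤ c) :
    ∃ T : (ι → ℝ) → (ι → ℝ), T 0 = 0 ∧
      (∀ u v, ∑ i, (T u i - T v i) ^ 2 ≤ ∑ i, (u i - v i) ^ 2) ∧
      ∀ u, G (u + T u) ^ 2 ≤ ∑ i, u i ^ 2 - ∑ i, T u i ^ 2 ∧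
        H (u - T u) ^ 2 ≤ ∑ i, u i ^ 2 - ∑ i, T u i ^ 2 := by
  choose X hX using fun u : ι → ℝ => exists_subgradient_decomposition hGc hG0 hGs hGa ((2 : ℝ) • u)
  have hG00 : G 0 = 0 := by simpa using hGs 0 0
  set Y : (ι → ℝ) → (ι → ℝ) := fun u => (2 : ℝ) • u - X u with hY
  have hX' : ∀ u z, G (X u) ^ 2 / 2 + ∑ i, Y u i * (z i - X u i) ≤ G z ^ 2 / 2 := hX
  have hscale : ∀ u k (l : ℝ), 0 ≤ l →
      G (X u) ^ 2 / 2 + (l * ∑ i, k i * Y u i - ∑ i, X u i * Y u i) ≤ l ^ 2 * G k ^ 2 / 2 := by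
    intro u k l hl
    have := hX' u (l • k)
    rw [hGs, abs_of_nonneg hl, mul_pow] at this
    refine le_trans (le_of_eq ?_) this
    rw [Finset.mul_sum, ← Finset.sum_sub_distrib]
    congr 1
    refine Finset.sum_congr rfl fun i _ => ?_
    simp only [Pi.smul_apply, smul_eq_mul]
    ring
  have hXY : ∀ u, ∑ i, X u i * Y u i = G (X u) ^ 2 := by
    intro u
    set P := ∑ i, X u i * Y u i
    set q := G (X u) ^ 2
    have h1 : ∀ l : ℝ, 0 ≤ l → q / 2 + (l * P - P) ≤ l ^ 2 * q / 2 := fun l hl =>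
      hscale u (X u) l hl
    have hq : 0 ≤ q := sq_nonneg _
    by_contra hne
    have h2 : ∀ e : ℝ, -1 ≤ e → e * (P - q) ≤ e ^ 2 * q / 2 := fun e he => by
      have := h1 (1 + e) (by linarith); nlinarith
    have hd : 0 < |P - q| := abs_pos.2 (sub_ne_zero.2 hne)
    set d := P - q with hdd
    have hm : 0 < 1 + |d| + q := by positivity
    have h3 : d ^ 2 / (1 + |d| + q) ≤ (d / (1 + |d| + q)) ^ 2 * q / 2 := by
      have := h2 (d / (1 + |d| + q)) (by
        rw [le_div_iff₀ hm]; linarith [neg_abs_le d])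
      rwa [div_mul_eq_mul_div, ← sq] at this
    rw [div_pow, div_mul_eq_mul_div, div_div, div_le_div_iff₀ hm (by positivity)] at h3
    have hd2 : 0 < d ^ 2 := by rw [← sq_abs]; positivity
    have h4 : d ^ 2 * (1 + |d| + q) * ((1 + |d| + q) * 2) ≤ d ^ 2 * (1 + |d| + q) * q := by
      nlinarith
    have := le_of_mul_le_mul_left h4 (by positivity)
    nlinarith
  have hdual : ∀ u k, ∑ i, k i * Y u i ≤ G (X u) * G k := by
    intro u k
    have h1 : ∀ l : ℝ, 0 ≤ l → l * ∑ i, k i * Y u i ≤ G (X u) ^ 2 / 2 + l ^ 2 * G k ^ 2 / 2 :=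
      fun l hl => by have := hscale u k l hl; rw [hXY] at this; linarith
    set A := ∑ i, k i * Y u i
    set b := G (X u)
    set c := G k
    have hb : 0 ≤ b := hG0 _
    have hc : 0 ≤ c := hG0 _
    rcases hc.eq_or_lt with hc0 | hc0
    · rw [← hc0] at h1 ⊢
      by_contra hA
      have hA : 0 < A := by simpa using hA
      have := h1 ((b ^ 2 / 2 + 1) / A) (by positivity)
      rw [div_mul_cancel₀ _ hA.ne'] at this
      simp at this
      linarith
    · rcases hb.eq_or_lt with hb0 | hb0
      · rw [← hb0] at h1 ⊢
        by_contra hA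
        have hA : 0 < A := by simpa using hA
        have h2 := h1 (A / c ^ 2) (by positivity)
        have : A / c ^ 2 * A ≤ A / c ^ 2 * (A / 2) := by
          refine h2.trans (le_of_eq ?_); field_simp; ring
        have := le_of_mul_le_mul_left this (by positivity)
        linarith
      · have h2 := h1 (b / c) (by positivity)
        have : b / c * A ≤ b / c * (b * c) := by
          refine h2.trans (le_of_eq ?_); field_simp; ring
        exact le_of_mul_le_mul_left this (by positivity)
  have hHY : ∀ u, H (Y u) ≤ G (X u) := by
    intro u
    refine le_of_forall_pos_le_add fun ε hε => hH _ _ (by linarith [hG0 (X u)]) fun k => ?_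
    refine (hdual u k).trans ?_
    nlinarith [hG0 k]
  refine ⟨fun u => X u - u, ?_, ?_, ?_⟩
  · have h1 := hXY 0
    have h2 : X 0 = 0 := by
      have h3 : ∑ i, X 0 i ^ 2 = 0 := by
        refine le_antisymm ?_ (Finset.sum_nonneg fun i _ => sq_nonneg _)
        have : ∑ i, X 0 i * Y 0 i = - ∑ i, X 0 i ^ 2 := by
          rw [← Finset.sum_neg_distrib]
          refine Finset.sum_congr rfl fun i _ => ?_
          simp [hY]; ring
        rw [this] at h1
        nlinarith [sq_nonneg (G (X 0))]
      ext i
      rw [Finset.sum_eq_zero_iff_of_nonneg fun i _ => sq_nonneg _] at h3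
      simpa using h3 i (Finset.mem_univ i)
    simp [h2]
  · intro u v
    have h1 := hX' u (X v)
    have h2 := hX' v (X u)
    have h3 : 0 ≤ ∑ i, (X u i - X v i) * (Y u i - Y v i) := by
      have : ∑ i, (X u i - X v i) * (Y u i - Y v i) =
          -(∑ i, Y u i * (X v i - X u i) + ∑ i, Y v i * (X u i - X v i)) := by
        rw [← Finset.sum_add_distrib, ← Finset.sum_neg_distrib]
        exact Finset.sum_congr rfl fun i _ => by ring
      rw [this]; linarith
    have h4 : ∑ i, (X u i - X v i) * (Y u i - Y v i) =
        ∑ i, (u i - v i) ^ 2 - ∑ i, ((X u - u) i - (X v - v) i) ^ 2 := by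
      rw [← Finset.sum_sub_distrib]
      refine Finset.sum_congr rfl fun i _ => ?_
      simp only [hY, Pi.sub_apply, Pi.smul_apply, smul_eq_mul]
      ring
    simp only
    linarith
  · intro u
    have h1 : ∑ i, u i ^ 2 - ∑ i, (X u - u) i ^ 2 = G (X u) ^ 2 := by
      rw [← hXY, ← Finset.sum_sub_distrib]
      refine Finset.sum_congr rfl fun i _ => ?_
      simp only [hY, Pi.sub_apply, Pi.smul_apply, smul_eq_mul]
      ring
    have h2 : u + (X u - u) = X u := by abel
    have h3 : u - (X u - u) = Y u := by simp only [hY, two_smul]; abel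
    simp only
    rw [h1, h2, h3]
    exact ⟨le_rfl, pow_le_pow_left₀ (hH0 _) (hHY u) 2⟩

end Proximal

section Twist

open Filter Topology Metric Set

variable {ι : Type*}

/-- The map `(u, v) ↦ (s T v, -s T u)`. -/
def twist (s : ℝ) (T : (ι → ℝ) → (ι → ℝ)) (w : ι ⊕ ι → ℝ) : ι ⊕ ι → ℝ :=
  Sum.elim (s • T (w ∘ Sum.inr)) (-(s • T (w ∘ Sum.inl)))

/-- The map `(u, v) ↦ (u + s T v, v + s T u)`. -/
def shearTwist (s : ℝ) (T : (ι → ℝ) → (ι → ℝ)) (w : ι ⊕ ι → ℝ) : ι ⊕ ι → ℝ :=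
  Sum.elim (w ∘ Sum.inl + s • T (w ∘ Sum.inr)) (w ∘ Sum.inr + s • T (w ∘ Sum.inl))

/-- The reflection `(u, v) ↦ (u, -v)`. -/
noncomputable def reflectRight : (ι ⊕ ι → ℝ) →L[ℝ] (ι ⊕ ι → ℝ) :=
  ContinuousLinearMap.pi fun j =>
    (Sum.elim (fun _ : ι => (1 : ℝ)) (fun _ : ι => (-1 : ℝ)) j) • ContinuousLinearMap.proj j

theorem shearTwist_eq (s : ℝ) (T : (ι → ℝ) → (ι → ℝ)) (w : ι ⊕ ι → ℝ) :
    shearTwist s T w = w + reflectRight (twist s T w) := by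
  funext j
  cases j <;> simp [shearTwist, reflectRight, twist]

variable [Fintype ι]

theorem sum_sq_twist (s : ℝ) (T : (ι → ℝ) → (ι → ℝ)) (w : ι ⊕ ι → ℝ) :
    ∑ j, twist s T w j ^ 2 =
      s ^ 2 * (∑ i, T (w ∘ Sum.inl) i ^ 2 + ∑ i, T (w ∘ Sum.inr) i ^ 2) := by
  simp only [twist, Fintype.sum_sum_type, Sum.elim_inl, Sum.elim_inr, Pi.smul_apply, Pi.neg_apply,
    smul_eq_mul, neg_sq, mul_pow, ← Finset.mul_sum]
  ring

theorem sum_sq_le_card_mul_norm_sq {κ : Type*} [Fintype κ] (x : κ → ℝ) :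
    ∑ i, x i ^ 2 ≤ Fintype.card κ * ‖x‖ ^ 2 := by
  calc ∑ i, x i ^ 2 ≤ ∑ _i : κ, ‖x‖ ^ 2 := by
        refine Finset.sum_le_sum fun i _ => ?_
        rw [← sq_abs]
        exact pow_le_pow_left₀ (abs_nonneg _) (norm_le_pi_norm x i) 2
    _ = _ := by simp

theorem lipschitzWith_of_sum_sq_le {κ : Type*} [Fintype κ] {T : (κ → ℝ) → (κ → ℝ)}
    (hT : ∀ u v, ∑ i, (T u i - T v i) ^ 2 ≤ ∑ i, (u i - v i) ^ 2) :
    LipschitzWith (Real.toNNReal √(Fintype.card κ)) T := by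
  refine LipschitzWith.of_dist_le_mul fun u v => ?_
  rw [dist_eq_norm, dist_eq_norm, Real.coe_toNNReal _ (Real.sqrt_nonneg _)]
  refine abs_le_of_sq_le_sq' ?_ (by positivity) |>.2
  rw [mul_pow, Real.sq_sqrt (Nat.cast_nonneg _)]
  exact (norm_sq_le_sum_sq _).trans ((hT u v).trans (sum_sq_le_card_mul_norm_sq (u - v)))

theorem lipschitzWith_twist {s : ℝ} (hs0 : 0 ≤ s) (hs1 : s < 1) {T : (ι → ℝ) → (ι → ℝ)}
    (hT : ∀ u v, ∑ i, (T u i - T v i) ^ 2 ≤ ∑ i, (u i - v i) ^ 2) :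
    LipschitzWith (Real.toNNReal √(Fintype.card (ι ⊕ ι))) (twist s T) := by
  refine lipschitzWith_of_sum_sq_le fun w w' => ?_
  have h1 := hT (w ∘ Sum.inl) (w' ∘ Sum.inl)
  have h2 := hT (w ∘ Sum.inr) (w' ∘ Sum.inr)
  have e : ∑ j, (twist s T w j - twist s T w' j) ^ 2 =
      s ^ 2 * (∑ i, (T (w ∘ Sum.inl) i - T (w' ∘ Sum.inl) i) ^ 2 +
        ∑ i, (T (w ∘ Sum.inr) i - T (w' ∘ Sum.inr) i) ^ 2) := by
    simp only [twist, Fintype.sum_sum_type, Sum.elim_inl, Sum.elim_inr, Pi.smul_apply,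
      Pi.neg_apply, smul_eq_mul, mul_add, Finset.mul_sum]
    rw [add_comm]
    congr 1 <;> refine Finset.sum_congr rfl fun i _ => by ring
  rw [e, Fintype.sum_sum_type]
  simp only [Function.comp_apply] at h1 h2
  have hs2 : s ^ 2 ≤ 1 := by nlinarith
  have p1 : 0 ≤ ∑ i, (T (w ∘ Sum.inl) i - T (w' ∘ Sum.inl) i) ^ 2 :=
    Finset.sum_nonneg fun i _ => sq_nonneg _
  have p2 : 0 ≤ ∑ i, (T (w ∘ Sum.inr) i - T (w' ∘ Sum.inr) i) ^ 2 :=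
    Finset.sum_nonneg fun i _ => sq_nonneg _
  nlinarith

theorem injective_shearTwist {s : ℝ} (hs0 : 0 ≤ s) (hs1 : s < 1) {T : (ι → ℝ) → (ι → ℝ)}
    (hT : ∀ u v, ∑ i, (T u i - T v i) ^ 2 ≤ ∑ i, (u i - v i) ^ 2) :
    Function.Injective (shearTwist s T) := by
  intro w w' h
  have e1 : ∀ i, w (Sum.inl i) - w' (Sum.inl i) =
      -s * (T (w ∘ Sum.inr) i - T (w' ∘ Sum.inr) i) := fun i => by
    have := congrFun h (Sum.inl i)
    simp only [shearTwist, Sum.elim_inl, Pi.add_apply, Function.comp_apply, Pi.smul_apply,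
      smul_eq_mul] at this
    linarith
  have e2 : ∀ i, w (Sum.inr i) - w' (Sum.inr i) =
      -s * (T (w ∘ Sum.inl) i - T (w' ∘ Sum.inl) i) := fun i => by
    have := congrFun h (Sum.inr i)
    simp only [shearTwist, Sum.elim_inr, Pi.add_apply, Function.comp_apply, Pi.smul_apply,
      smul_eq_mul] at this
    linarith
  have h1 := hT (w ∘ Sum.inl) (w' ∘ Sum.inl)
  have h2 := hT (w ∘ Sum.inr) (w' ∘ Sum.inr)
  simp only [Function.comp_apply, e1, e2, mul_pow, ← Finset.mul_sum] at h1 h2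
  have p1 : 0 ≤ ∑ i, (T (w ∘ Sum.inl) i - T (w' ∘ Sum.inl) i) ^ 2 :=
    Finset.sum_nonneg fun i _ => sq_nonneg _
  have p2 : 0 ≤ ∑ i, (T (w ∘ Sum.inr) i - T (w' ∘ Sum.inr) i) ^ 2 :=
    Finset.sum_nonneg fun i _ => sq_nonneg _
  have hs2 : s ^ 2 < 1 := by nlinarith
  have z1 : ∑ i, (T (w ∘ Sum.inl) i - T (w' ∘ Sum.inl) i) ^ 2 = 0 := by nlinarith
  have z2 : ∑ i, (T (w ∘ Sum.inr) i - T (w' ∘ Sum.inr) i) ^ 2 = 0 := by nlinarith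
  rw [Finset.sum_eq_zero_iff_of_nonneg fun i _ => sq_nonneg _] at z1 z2
  funext j
  cases j with
  | inl i =>
    have := e1 i
    rw [pow_eq_zero_iff two_ne_zero |>.1 (z2 i (Finset.mem_univ i))] at this
    linarith
  | inr i =>
    have := e2 i
    rw [pow_eq_zero_iff two_ne_zero |>.1 (z1 i (Finset.mem_univ i))] at this
    linarith

variable [DecidableEq ι]

theorem jacobianMatrix_twist_inl_inl {s : ℝ} {T : (ι → ℝ) → (ι → ℝ)} {w : ι ⊕ ι → ℝ}
    (h : DifferentiableAt ℝ (twist s T) w) (i j : ι) :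
    jacobianMatrix (twist s T) w (Sum.inl i) (Sum.inl j) = 0 := by
  simp only [jacobianMatrix, LinearMap.toMatrix'_apply]
  have h1 : HasFDerivAt (fun w => twist s T w (Sum.inl i))
      ((ContinuousLinearMap.proj (Sum.inl i)).comp (fderiv ℝ (twist s T) w)) w :=
    (ContinuousLinearMap.proj (R := ℝ) (φ := fun _ : ι ⊕ ι => ℝ)
      (Sum.inl i)).hasFDerivAt.comp w h.hasFDerivAt
  have h2 := (h1.hasLineDerivAt (Pi.single (Sum.inl j) 1))
  have h3 : HasLineDerivAt ℝ (fun w => twist s T w (Sum.inl i)) 0 w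
      (Pi.single (Sum.inl j) 1) := by
    unfold HasLineDerivAt
    have : (fun t : ℝ => twist s T (w + t • Pi.single (Sum.inl j) 1) (Sum.inl i)) =
        fun _ => twist s T w (Sum.inl i) := by
      funext t
      have : (w + t • Pi.single (Sum.inl j) (1 : ℝ)) ∘ Sum.inr = w ∘ Sum.inr := by
        funext k; simp
      simp [twist, this]
    rw [this]
    exact hasDerivAt_const _ _
  exact h2.unique h3

theorem jacobianMatrix_twist_inr_inr {s : ℝ} {T : (ι → ℝ) → (ι → ℝ)} {w : ι ⊕ ι → ℝ}
    (h : DifferentiableAt ℝ (twist s T) w) (i j : ι) :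
    jacobianMatrix (twist s T) w (Sum.inr i) (Sum.inr j) = 0 := by
  simp only [jacobianMatrix, LinearMap.toMatrix'_apply]
  have h1 : HasFDerivAt (fun w => twist s T w (Sum.inr i))
      ((ContinuousLinearMap.proj (Sum.inr i)).comp (fderiv ℝ (twist s T) w)) w :=
    (ContinuousLinearMap.proj (R := ℝ) (φ := fun _ : ι ⊕ ι => ℝ)
      (Sum.inr i)).hasFDerivAt.comp w h.hasFDerivAt
  have h2 := (h1.hasLineDerivAt (Pi.single (Sum.inr j) 1))
  have h3 : HasLineDerivAt ℝ (fun w => twist s T w (Sum.inr i)) 0 w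
      (Pi.single (Sum.inr j) 1) := by
    unfold HasLineDerivAt
    have : (fun t : ℝ => twist s T (w + t • Pi.single (Sum.inr j) 1) (Sum.inr i)) =
        fun _ => twist s T w (Sum.inr i) := by
      funext t
      have : (w + t • Pi.single (Sum.inr j) (1 : ℝ)) ∘ Sum.inl = w ∘ Sum.inl := by
        funext k; simp
      simp [twist, this]
    rw [this]
    exact hasDerivAt_const _ _
  exact h2.unique h3

theorem det_one_add_I_smul_eq {J : Matrix (ι ⊕ ι) (ι ⊕ ι) ℝ} (h₁ : J.toBlocks₁₁ = 0)
    (h₂ : J.toBlocks₂₂ = 0) :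
    (1 + Complex.I • J.map ((↑) : ℝ → ℂ)).det =
      ((1 + LinearMap.toMatrix' (reflectRight : (ι ⊕ ι → ℝ) →L[ℝ] _).toLinearMap * J).det : ℝ) := by
  have hR : LinearMap.toMatrix' (reflectRight : (ι ⊕ ι → ℝ) →L[ℝ] _).toLinearMap =
      Matrix.fromBlocks 1 0 0 (-1) := by
    ext i j
    rw [LinearMap.toMatrix'_apply]
    rcases i with i | i <;> rcases j with j | j <;>
      simp [reflectRight, Matrix.one_apply, Pi.single_apply]
    split_ifs <;> simp
  rw [← J.fromBlocks_toBlocks, h₁, h₂, hR, Matrix.fromBlocks_map, Matrix.fromBlocks_smul,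
    Matrix.fromBlocks_multiply, ← Matrix.fromBlocks_one, ← Matrix.fromBlocks_one,
    Matrix.fromBlocks_add, Matrix.fromBlocks_add]
  set P := J.toBlocks₁₂
  set Q := J.toBlocks₂₁
  have hz : (0 : Matrix ι ι ℝ).map ((↑) : ℝ → ℂ) = 0 := by ext; simp
  simp only [hz, smul_zero, add_zero, zero_add, Matrix.mul_zero, Matrix.one_mul, Matrix.zero_mul,
    Matrix.neg_mul, Matrix.det_fromBlocks_one₁₁]
  rw [show ((((1 : Matrix ι ι ℝ) - -(Q * P)).det : ℝ) : ℂ) =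
    Complex.ofRealHom ((1 : Matrix ι ι ℝ) - -(Q * P)).det from rfl, RingHom.map_det]
  congr 1
  rw [map_sub, map_neg, map_mul]
  simp only [map_one, RingHom.mapMatrix_apply, Matrix.smul_mul, Matrix.mul_smul, smul_smul,
    Complex.I_mul_I, neg_smul, one_smul]
  rfl

theorem pi_pow_le_lintegral_exp_neg_sq {s : ℝ} (hs0 : 0 ≤ s) (hs1 : s < 1)
    {T : (ι → ℝ) → (ι → ℝ)} (hT0 : T 0 = 0)
    (hT : ∀ u v, ∑ i, (T u i - T v i) ^ 2 ≤ ∑ i, (u i - v i) ^ 2) {g : (ι ⊕ ι → ℝ) → ℝ}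
    (hg : ∀ w, g (shearTwist s T w) ^ 2 ≤ ∑ j, w j ^ 2 - ∑ j, twist s T w j ^ 2) :
    ENNReal.ofReal (Real.pi ^ Fintype.card ι) ≤
      ∫⁻ w, ENNReal.ofReal (Real.exp (-g w ^ 2)) := by
  have hLip := lipschitzWith_twist hs0 hs1 hT
  have hn : ∀ u, ∑ i, T u i ^ 2 ≤ ∑ i, u i ^ 2 := fun u => by simpa [hT0] using hT u 0
  have hΘL : ∀ w, ∑ j, twist s T w j ^ 2 ≤ s ^ 2 * ∑ j, w j ^ 2 := fun w => by
    rw [sum_sq_twist, Fintype.sum_sum_type]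
    have h1 := hn (w ∘ Sum.inl)
    have h2 := hn (w ∘ Sum.inr)
    simp only [Function.comp_apply] at h1 h2
    gcongr
  have key := integral_contourIntegrand_I hLip hs0 hs1 hΘL
  have hD : MeasurableSet {w | DifferentiableAt ℝ (twist s T) w} :=
    measurableSet_of_differentiableAt ℝ (twist s T)
  have hae : ∀ᵐ w, w ∈ {w | DifferentiableAt ℝ (twist s T) w} :=
    hLip.ae_differentiableAt
  set R : (ι ⊕ ι → ℝ) →L[ℝ] (ι ⊕ ι → ℝ) := reflectRight with hR
  set Φ' : (ι ⊕ ι → ℝ) → (ι ⊕ ι → ℝ) →L[ℝ] (ι ⊕ ι → ℝ) :=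
    fun w => ContinuousLinearMap.id ℝ _ + R.comp (fderiv ℝ (twist s T) w) with hΦ'
  have hder : ∀ w ∈ {w | DifferentiableAt ℝ (twist s T) w},
      HasFDerivWithinAt (shearTwist s T) (Φ' w) {w | DifferentiableAt ℝ (twist s T) w} w := by
    intro w hw
    have h1 : HasFDerivAt (fun w => w + R (twist s T w)) (Φ' w) w :=
      (hasFDerivAt_id w).add (R.hasFDerivAt.comp w (DifferentiableAt.hasFDerivAt hw))
    rw [show shearTwist s T = fun w => w + R (twist s T w) from
      funext fun w => shearTwist_eq s T w]
    exact h1.hasFDerivWithinAt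
  have hdet : ∀ w ∈ {w | DifferentiableAt ℝ (twist s T) w},
      (1 + Complex.I • (jacobianMatrix (twist s T) w).map ((↑) : ℝ → ℂ)).det =
        ((Φ' w).det : ℝ) := by
    intro w hw
    rw [det_one_add_I_smul_eq]
    · congr 1
      rw [ContinuousLinearMap.det, ← LinearMap.det_toMatrix']
      congr 1
      simp only [hΦ', jacobianMatrix, ContinuousLinearMap.toLinearMap_add,
        ContinuousLinearMap.toLinearMap_comp, map_add, LinearMap.toMatrix'_comp]
      congr 1
      exact LinearMap.toMatrix'_id.symm
    · ext i j; exact jacobianMatrix_twist_inl_inl hw i j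
    · ext i j; exact jacobianMatrix_twist_inr_inr hw i j
  calc ENNReal.ofReal (Real.pi ^ Fintype.card ι)
      = ‖∫ w, contourIntegrand (twist s T) Complex.I w‖ₑ := by
        rw [key, ← ofReal_norm, Complex.norm_real, Real.norm_of_nonneg (by positivity),
          Fintype.card_sum, pow_add, ← mul_pow, Real.mul_self_sqrt Real.pi_pos.le]
    _ ≤ ∫⁻ w, ‖contourIntegrand (twist s T) Complex.I w‖ₑ := enorm_integral_le_lintegral_enorm _
    _ = ∫⁻ w in {w | DifferentiableAt ℝ (twist s T) w},
          ‖contourIntegrand (twist s T) Complex.I w‖ₑ := by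
        rw [Measure.restrict_eq_self_of_ae_mem hae]
    _ ≤ ∫⁻ w in {w | DifferentiableAt ℝ (twist s T) w}, ENNReal.ofReal |(Φ' w).det| *
          ENNReal.ofReal (Real.exp (-g (shearTwist s T w) ^ 2)) := by
        refine setLIntegral_mono' hD fun w hw => ?_
        rw [contourIntegrand, hdet w hw, ← ofReal_norm, norm_mul, Complex.norm_real,
          Real.norm_eq_abs, mul_comm, ENNReal.ofReal_mul (abs_nonneg _)]
        gcongr
        rw [Complex.norm_exp]
        refine Real.exp_le_exp.2 ?_
        rw [Complex.neg_re, neg_le_neg_iff]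
        refine (hg w).trans (le_of_eq ?_)
        rw [Complex.re_sum, ← Finset.sum_sub_distrib]
        refine Finset.sum_congr rfl fun j _ => ?_
        simp [sq]
    _ = ∫⁻ w in shearTwist s T '' {w | DifferentiableAt ℝ (twist s T) w},
          ENNReal.ofReal (Real.exp (-g w ^ 2)) :=
        (lintegral_image_eq_lintegral_abs_det_fderiv_mul volume hD hder
          (injective_shearTwist hs0 hs1 hT).injOn
          (fun w => ENNReal.ofReal (Real.exp (-g w ^ 2)))).symm
    _ ≤ _ := setLIntegral_le_lintegral _ _

end Twist

section NormFunction

open Module Set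

/-- A function having all the properties of a norm. -/
structure IsNormFunction {E : Type*} [AddCommGroup E] [Module ℝ E] [TopologicalSpace E]
    (G : E → ℝ) : Prop where
  continuous : Continuous G
  nonneg : ∀ x, 0 ≤ G x
  map_smul : ∀ (r : ℝ) x, G (r • x) = |r| * G x
  add_le : ∀ x y, G (x + y) ≤ G x + G y
  eq_zero : ∀ {x}, G x = 0 → x = 0

namespace IsNormFunction

section Basic

variable {E : Type*} [AddCommGroup E] [Module ℝ E] [TopologicalSpace E] {G : E → ℝ}

theorem map_zero (hG : IsNormFunction G) : G 0 = 0 := by simpa using hG.map_smul 0 0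

theorem map_neg (hG : IsNormFunction G) (x : E) : G (-x) = G x := by
  simpa using hG.map_smul (-1) x

theorem sub_le (hG : IsNormFunction G) (x y : E) : G (x - y) ≤ G x + G y := by
  simpa [sub_eq_add_neg, hG.map_neg] using hG.add_le x (-y)

end Basic

variable {E : Type*} [NormedAddCommGroup E] [NormedSpace ℝ E] [FiniteDimensional ℝ E]
  [MeasurableSpace E] [BorelSpace E] {G : E → ℝ}

theorem measure_lt_one_eq (hG : IsNormFunction G) (μ : Measure E) [μ.IsAddHaarMeasure] :
    μ {x | G x < 1} = .ofReal ((∫ x, Real.exp (-(G x) ^ 2) ∂μ) /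
      Real.Gamma (finrank ℝ E / 2 + 1)) := by
  have := measure_lt_one_eq_integral_div_gamma μ (g := G) (p := 2) hG.map_zero hG.map_neg
    hG.add_le hG.eq_zero (fun r x => (hG.map_smul r x).le) two_pos
  simpa using this

theorem integral_ne_zero (hG : IsNormFunction G) (μ : Measure E) [μ.IsAddHaarMeasure] :
    ∫ x, Real.exp (-(G x) ^ 2) ∂μ ≠ 0 := by
  intro h
  have hpos : 0 < μ {x | G x < 1} :=
    (isOpen_lt hG.continuous continuous_const).measure_pos μ ⟨0, by simp [hG.map_zero]⟩
  rw [hG.measure_lt_one_eq μ, h] at hpos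
  simp at hpos

theorem integrable (hG : IsNormFunction G) (μ : Measure E) [μ.IsAddHaarMeasure] :
    Integrable (fun x => Real.exp (-(G x) ^ 2)) μ :=
  not_imp_comm.1 integral_undef (hG.integral_ne_zero μ)

theorem toReal_measure_lt_one (hG : IsNormFunction G) (μ : Measure E) [μ.IsAddHaarMeasure] :
    (μ {x | G x < 1}).toReal * Real.Gamma (finrank ℝ E / 2 + 1) =
      ∫ x, Real.exp (-(G x) ^ 2) ∂μ := by
  have hΓ : 0 < Real.Gamma (finrank ℝ E / 2 + 1) := Real.Gamma_pos_of_pos (by positivity)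
  rw [hG.measure_lt_one_eq μ, ENNReal.toReal_ofReal]
  · field_simp
  · exact div_nonneg (integral_nonneg fun _ => (Real.exp_pos _).le) hΓ.le

end IsNormFunction

section Lower

variable {ι : Type*}

/-- The norm `(u, v) ↦ a⁻¹ max (G (u + v)) (H (u - v))`. -/
noncomputable def sumDiffMax (a : ℝ) (G H : (ι → ℝ) → ℝ) (w : ι ⊕ ι → ℝ) : ℝ :=
  a⁻¹ * max (G (w ∘ Sum.inl + w ∘ Sum.inr)) (H (w ∘ Sum.inl - w ∘ Sum.inr))

theorem IsNormFunction.sumDiffMax {a : ℝ} (ha : 0 < a) {G H : (ι → ℝ) → ℝ}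
    (hG : IsNormFunction G) (hH : IsNormFunction H) : IsNormFunction (sumDiffMax a G H) where
  continuous := by
    refine continuous_const.mul ((hG.continuous.comp ?_).max (hH.continuous.comp ?_)) <;>
      simp only [Function.comp_def] <;> fun_prop
  nonneg w := mul_nonneg (inv_nonneg.2 ha.le) (le_max_of_le_left (hG.nonneg _))
  map_smul r w := by
    have e1 : (r • w) ∘ Sum.inl + (r • w) ∘ Sum.inr =
        r • (w ∘ (Sum.inl : ι → ι ⊕ ι) + w ∘ Sum.inr) := by
      funext i; simp [mul_add]
    have e2 : (r • w) ∘ Sum.inl - (r • w) ∘ Sum.inr =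
        r • (w ∘ (Sum.inl : ι → ι ⊕ ι) - w ∘ Sum.inr) := by
      funext i; simp [mul_sub]
    rw [_root_.sumDiffMax, e1, e2, hG.map_smul, hH.map_smul, ← mul_max_of_nonneg _ _ (abs_nonneg r),
      _root_.sumDiffMax]
    ring
  add_le w w' := by
    have e1 : (w + w') ∘ Sum.inl + (w + w') ∘ Sum.inr =
        (w ∘ (Sum.inl : ι → ι ⊕ ι) + w ∘ Sum.inr) + (w' ∘ Sum.inl + w' ∘ Sum.inr) := by
      funext i; simp; ring
    have e2 : (w + w') ∘ Sum.inl - (w + w') ∘ Sum.inr =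
        (w ∘ (Sum.inl : ι → ι ⊕ ι) - w ∘ Sum.inr) + (w' ∘ Sum.inl - w' ∘ Sum.inr) := by
      funext i; simp; ring
    rw [_root_.sumDiffMax, e1, e2, _root_.sumDiffMax, _root_.sumDiffMax, ← mul_add]
    refine mul_le_mul_of_nonneg_left (max_le ?_ ?_) (inv_nonneg.2 ha.le)
    · exact (hG.add_le _ _).trans (add_le_add (le_max_left _ _) (le_max_left _ _))
    · exact (hH.add_le _ _).trans (add_le_add (le_max_right _ _) (le_max_right _ _))
  eq_zero {w} h := by
    have hm : max (G (w ∘ Sum.inl + w ∘ Sum.inr)) (H (w ∘ Sum.inl - w ∘ Sum.inr)) = 0 :=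
      (mul_eq_zero.1 h).resolve_left (inv_ne_zero ha.ne')
    have h1 := hG.eq_zero (le_antisymm ((le_max_left _ _).trans hm.le) (hG.nonneg _))
    have h2 := hH.eq_zero (le_antisymm ((le_max_right _ _).trans hm.le) (hH.nonneg _))
    have f1 : ∀ i, w (Sum.inl i) + w (Sum.inr i) = 0 := fun i => congrFun h1 i
    have f2 : ∀ i, w (Sum.inl i) - w (Sum.inr i) = 0 := fun i => congrFun h2 i
    funext j
    cases j with
    | inl i => simp only [Pi.zero_apply]; linarith [f1 i, f2 i]
    | inr i => simp only [Pi.zero_apply]; linarith [f1 i, f2 i]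

variable [Fintype ι]

theorem volume_sumDiffMax_lt_one [DecidableEq ι] {d : ℝ} (hd : 0 < d) {G H : (ι → ℝ) → ℝ}
    (hG : IsNormFunction G) (hH : IsNormFunction H) :
    volume {w | sumDiffMax (√2 * d) G H w < 1} =
      ENNReal.ofReal ((d ^ 2) ^ Fintype.card ι) *
        (volume {x | G x < 1} * volume {x | H x < 1}) := by
  set a : ℝ := √2 * d with ha
  have ha0 : 0 < a := by positivity
  set M : Matrix (ι ⊕ ι) (ι ⊕ ι) ℝ := a⁻¹ • Matrix.fromBlocks 1 1 1 (-1) with hM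
  have hMdet : M.det = (a⁻¹ ^ 2) ^ Fintype.card ι * (-2) ^ Fintype.card ι := by
    rw [hM, Matrix.det_smul, Matrix.det_fromBlocks_one₁₁, Fintype.card_sum, ← two_mul, pow_mul]
    congr 1
    rw [show (-1 - 1 * 1 : Matrix ι ι ℝ) = (-2 : ℝ) • 1 by
      ext i j; simp [Matrix.one_apply]; split_ifs <;> norm_num,
      Matrix.det_smul, Matrix.det_one, mul_one]
  have hdet : LinearMap.det (Matrix.toLin' M) =
      (a⁻¹ ^ 2) ^ Fintype.card ι * (-2) ^ Fintype.card ι := by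
    rw [LinearMap.det_toLin', hMdet]
  have hdet0 : LinearMap.det (Matrix.toLin' M) ≠ 0 := by
    rw [hdet]; positivity
  have hset : {w | sumDiffMax a G H w < 1} = Matrix.toLin' M ⁻¹'
      (MeasurableEquiv.sumPiEquivProdPi (fun _ : ι ⊕ ι => ℝ) ⁻¹'
        ({x | G x < 1} ×ˢ {x | H x < 1})) := by
    ext w
    have e1 : (MeasurableEquiv.sumPiEquivProdPi (fun _ : ι ⊕ ι => ℝ) (Matrix.toLin' M w)).1 =
        a⁻¹ • (w ∘ Sum.inl + w ∘ Sum.inr) := by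
      funext i
      change (M.mulVec w) (Sum.inl i) = _
      rw [hM, Matrix.smul_mulVec, Matrix.fromBlocks_mulVec]
      simp
    have e2 : (MeasurableEquiv.sumPiEquivProdPi (fun _ : ι ⊕ ι => ℝ) (Matrix.toLin' M w)).2 =
        a⁻¹ • (w ∘ Sum.inl - w ∘ Sum.inr) := by
      funext i
      change (M.mulVec w) (Sum.inr i) = _
      rw [hM, Matrix.smul_mulVec, Matrix.fromBlocks_mulVec]
      simp [Matrix.neg_mulVec, sub_eq_add_neg]
    simp only [mem_preimage, mem_prod, mem_ofPred_eq, e1, e2, hG.map_smul, hH.map_smul,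
      abs_of_pos (inv_pos.2 ha0), sumDiffMax]
    rw [mul_max_of_nonneg _ _ (inv_nonneg.2 ha0.le), max_lt_iff]
  rw [hset, Measure.addHaar_preimage_linearMap _ hdet0,
    (volume_measurePreserving_sumPiEquivProdPi (fun _ : ι ⊕ ι => ℝ)).measure_preimage_equiv,
    Measure.volume_eq_prod, Measure.prod_prod, hdet]
  congr 2
  rw [abs_inv, abs_mul, abs_pow, abs_pow, abs_pow, abs_neg, abs_two, abs_of_pos (by positivity),
    ← mul_pow, ← inv_pow]
  congr 1
  rw [ha, inv_pow, mul_pow, Real.sq_sqrt zero_le_two]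
  field_simp

theorem sq_sumDiffMax_shearTwist_le {G H : (ι → ℝ) → ℝ} (hG : IsNormFunction G)
    (hH : IsNormFunction H) {c : ℝ} (hc : 0 ≤ c) (hGH : ∀ x, G x ≤ c * H x)
    (hHG : ∀ x, H x ≤ c * G x) {T : (ι → ℝ) → (ι → ℝ)}
    (hT : ∀ u, G (u + T u) ^ 2 ≤ ∑ i, u i ^ 2 - ∑ i, T u i ^ 2 ∧
        H (u - T u) ^ 2 ≤ ∑ i, u i ^ 2 - ∑ i, T u i ^ 2) {s : ℝ} (hs0 : 0 ≤ s) (hs1 : s < 1)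
    (w : ι ⊕ ι → ℝ) :
    sumDiffMax (√2 * (1 + (1 - s) * ((1 + c) / 2))) G H (shearTwist s T w) ^ 2 ≤
      ∑ j, w j ^ 2 - ∑ j, twist s T w j ^ 2 := by
  set δ : ℝ := (1 - s) * ((1 + c) / 2) with hδ
  have hδ0 : 0 ≤ δ := mul_nonneg (by linarith) (by linarith)
  set e : (ι → ℝ) → ℝ := fun u => ∑ i, u i ^ 2 - ∑ i, T u i ^ 2 with he
  have he0 : ∀ u, 0 ≤ e u := fun u => (sq_nonneg _).trans (hT u).1
  have b1 : ∀ u, G (u + T u) ≤ √(e u) := fun u => Real.le_sqrt_of_sq_le (hT u).1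
  have b2 : ∀ u, H (u - T u) ≤ √(e u) := fun u => Real.le_sqrt_of_sq_le (hT u).2
  have hTu : ∀ u, T u = (1 / 2 : ℝ) • ((u + T u) - (u - T u)) := fun u => by
    rw [add_sub_sub_cancel, ← two_smul ℝ, smul_smul]; norm_num
  have b3 : ∀ u, G (T u) ≤ (1 + c) / 2 * √(e u) := fun u => by
    rw [hTu u, hG.map_smul, abs_of_pos (by norm_num)]
    have := hG.sub_le (u + T u) (u - T u)
    have := hGH (u - T u)
    have := mul_le_mul_of_nonneg_left (b2 u) hc
    linarith [b1 u]
  have b4 : ∀ u, H (T u) ≤ (1 + c) / 2 * √(e u) := fun u => by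
    rw [hTu u, hH.map_smul, abs_of_pos (by norm_num)]
    have := hH.sub_le (u + T u) (u - T u)
    have := hHG (u + T u)
    have := mul_le_mul_of_nonneg_left (b1 u) hc
    linarith [b2 u]
  set u := w ∘ (Sum.inl : ι → ι ⊕ ι) with hu
  set v := w ∘ (Sum.inr : ι → ι ⊕ ι) with hv
  have hl : shearTwist s T w ∘ Sum.inl = u + s • T v := rfl
  have hr : shearTwist s T w ∘ Sum.inr = v + s • T u := rfl
  have s0 : 0 ≤ 1 - s := by linarith
  have c1 : G ((u + s • T v) + (v + s • T u)) ≤ (1 + δ) * (√(e u) + √(e v)) := by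
    have : (u + s • T v) + (v + s • T u) =
        ((u + T u) + (v + T v)) - ((1 - s) • T u + (1 - s) • T v) := by module
    rw [this]
    have h1 := hG.sub_le ((u + T u) + (v + T v)) ((1 - s) • T u + (1 - s) • T v)
    have h2 := hG.add_le (u + T u) (v + T v)
    have h3 := hG.add_le ((1 - s) • T u) ((1 - s) • T v)
    rw [hG.map_smul, hG.map_smul, abs_of_nonneg s0] at h3
    have h4 := mul_le_mul_of_nonneg_left (b3 u) s0
    have h5 := mul_le_mul_of_nonneg_left (b3 v) s0
    rw [← mul_assoc, ← hδ] at h4 h5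
    linarith [b1 u, b1 v]
  have c2 : H ((u + s • T v) - (v + s • T u)) ≤ (1 + δ) * (√(e u) + √(e v)) := by
    have : (u + s • T v) - (v + s • T u) =
        ((u - T u) - (v - T v)) + ((1 - s) • T u - (1 - s) • T v) := by module
    rw [this]
    have h1 := hH.add_le ((u - T u) - (v - T v)) ((1 - s) • T u - (1 - s) • T v)
    have h2 := hH.sub_le (u - T u) (v - T v)
    have h3 := hH.sub_le ((1 - s) • T u) ((1 - s) • T v)
    rw [hH.map_smul, hH.map_smul, abs_of_nonneg s0] at h3
    have h4 := mul_le_mul_of_nonneg_left (b4 u) s0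
    have h5 := mul_le_mul_of_nonneg_left (b4 v) s0
    rw [← mul_assoc, ← hδ] at h4 h5
    linarith [b2 u, b2 v]
  have hmax := max_le c1 c2
  have hmax0 : 0 ≤ max (G ((u + s • T v) + (v + s • T u))) (H ((u + s • T v) - (v + s • T u))) :=
    le_max_of_le_left (hG.nonneg _)
  calc sumDiffMax (√2 * (1 + δ)) G H (shearTwist s T w) ^ 2
      ≤ ((√2 * (1 + δ))⁻¹ * ((1 + δ) * (√(e u) + √(e v)))) ^ 2 := by
        rw [sumDiffMax, hl, hr]
        gcongr
    _ = (√(e u) + √(e v)) ^ 2 / 2 := by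
        rw [mul_inv, mul_assoc, inv_mul_cancel_left₀ (by positivity), mul_pow, inv_pow,
          Real.sq_sqrt zero_le_two]
        ring
    _ ≤ √(e u) ^ 2 + √(e v) ^ 2 := by nlinarith [sq_nonneg (√(e u) - √(e v))]
    _ = e u + e v := by rw [Real.sq_sqrt (he0 u), Real.sq_sqrt (he0 v)]
    _ ≤ _ := by
        rw [sum_sq_twist, Fintype.sum_sum_type]
        have p1 : 0 ≤ ∑ i, T u i ^ 2 := Finset.sum_nonneg fun i _ => sq_nonneg _
        have p2 : 0 ≤ ∑ i, T v i ^ 2 := Finset.sum_nonneg fun i _ => sq_nonneg _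
        have hs2 : s ^ 2 ≤ 1 := by nlinarith
        simp only [he, hu, hv, Function.comp_apply] at p1 p2 ⊢
        nlinarith

theorem pi_pow_le_factorial_mul {G H : (ι → ℝ) → ℝ} (hG : IsNormFunction G)
    (hH : IsNormFunction H) {c : ℝ} (hc : 0 ≤ c) (hGH : ∀ x, G x ≤ c * H x)
    (hHG : ∀ x, H x ≤ c * G x)
    (hdual : ∀ y c, 0 < c → (∀ x, ∑ i, x i * y i ≤ c * G x) → H y ≤ c) :
    Real.pi ^ Fintype.card ι ≤ (Fintype.card ι).factorial *
      ((volume {x | G x < 1}).toReal * (volume {x | H x < 1}).toReal) := by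
  classical
  obtain ⟨T, hT0, hTc, hT⟩ := exists_reflected_resolvent hG.continuous hG.nonneg hG.map_smul
    hG.add_le hH.nonneg hdual
  have main : ∀ s ∈ Ioo (0 : ℝ) 1, Real.pi ^ Fintype.card ι ≤ (Fintype.card ι).factorial *
      (((1 + (1 - s) * ((1 + c) / 2)) ^ 2) ^ Fintype.card ι *
        ((volume {x | G x < 1}).toReal * (volume {x | H x < 1}).toReal)) := by
    rintro s ⟨hs0, hs1⟩
    set d : ℝ := 1 + (1 - s) * ((1 + c) / 2) with hd
    have hd0 : 0 < d := by
      have : 0 ≤ (1 - s) * ((1 + c) / 2) := mul_nonneg (by linarith) (by linarith)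
      linarith
    have hN : IsNormFunction (sumDiffMax (√2 * d) G H) := hG.sumDiffMax (by positivity) hH
    have h1 := pi_pow_le_lintegral_exp_neg_sq hs0.le hs1 hT0 hTc
      (sq_sumDiffMax_shearTwist_le hG hH hc hGH hHG hT hs0.le hs1)
    rw [← hd, ← ofReal_integral_eq_lintegral_ofReal (hN.integrable volume)
      (Filter.Eventually.of_forall fun _ => (Real.exp_pos _).le),
      ENNReal.ofReal_le_ofReal_iff (integral_nonneg fun _ => (Real.exp_pos _).le),
      ← hN.toReal_measure_lt_one, volume_sumDiffMax_lt_one hd0 hG hH, ENNReal.toReal_mul,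
      ENNReal.toReal_mul, ENNReal.toReal_ofReal (by positivity)] at h1
    have hΓ : Real.Gamma (finrank ℝ (ι ⊕ ι → ℝ) / 2 + 1) = (Fintype.card ι).factorial := by
      rw [← Real.Gamma_nat_eq_factorial, finrank_fintype_fun_eq_card, Fintype.card_sum]
      congr 1
      push_cast
      ring
    rw [hΓ] at h1
    linarith
  have hlim : Filter.Tendsto (fun s : ℝ => ((Fintype.card ι).factorial : ℝ) *
      (((1 + (1 - s) * ((1 + c) / 2)) ^ 2) ^ Fintype.card ι *
        ((volume {x | G x < 1}).toReal * (volume {x | H x < 1}).toReal)))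
      (nhdsWithin 1 (Ioo 0 1)) (nhds (((Fintype.card ι).factorial : ℝ) *
      (((1 + (1 - 1) * ((1 + c) / 2)) ^ 2) ^ Fintype.card ι *
        ((volume {x | G x < 1}).toReal * (volume {x | H x < 1}).toReal)))) :=
    (Continuous.tendsto (by fun_prop) 1).mono_left nhdsWithin_le_nhds
  have : (nhdsWithin (1 : ℝ) (Ioo 0 1)).NeBot := by
    rw [← mem_closure_iff_nhdsWithin_neBot, closure_Ioo (by norm_num)]
    simp
  have := ge_of_tendsto hlim (Filter.mem_of_superset self_mem_nhdsWithin main)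
  simpa using this

end Lower

end NormFunction

section Polar

open Set Metric Topology

theorem isNormFunction_gauge {E : Type*} [NormedAddCommGroup E] [NormedSpace ℝ E] {K : Set E}
    (hc : Convex ℝ K) (h0 : K ∈ 𝓝 0) (hsym : ∀ x ∈ K, -x ∈ K) (hb : Bornology.IsBounded K) :
    IsNormFunction (gauge K) where
  continuous := continuous_gauge hc h0
  nonneg := gauge_nonneg
  map_smul r x := by
    rcases le_total 0 r with hr | hr
    · rw [gauge_smul_of_nonneg hr, abs_of_nonneg hr, smul_eq_mul]
    · rw [← gauge_neg hsym, ← neg_smul, gauge_smul_of_nonneg (neg_nonneg.2 hr), abs_of_nonpos hr,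
        smul_eq_mul]
  add_le := gauge_add_le hc (absorbent_nhds_zero h0)
  eq_zero h := (gauge_eq_zero (absorbent_nhds_zero h0)
    ((NormedSpace.isVonNBounded_iff ℝ).2 hb)).1 h

theorem exists_gauge_le_mul_gauge {E : Type*} [NormedAddCommGroup E] [NormedSpace ℝ E]
    {s t : Set E} (hs : s ∈ 𝓝 0) (ht : t ∈ 𝓝 0) (hb : Bornology.IsBounded t) :
    ∃ c, 0 ≤ c ∧ ∀ x, gauge s x ≤ c * gauge t x := by
  obtain ⟨r, hr, hrs⟩ := Metric.mem_nhds_iff.1 hs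
  obtain ⟨R, hR, hRt⟩ := hb.subset_closedBall_lt 0 0
  refine ⟨R / r, by positivity, fun x => ?_⟩
  have h1 := mul_gauge_le_norm hrs (x := x)
  have h2 := le_gauge_of_subset_closedBall (absorbent_nhds_zero ht) hR.le hRt (x := x)
  rw [div_le_iff₀ hR] at h2
  rw [div_mul_eq_mul_div, le_div_iff₀ hr]
  linarith

theorem volume_eq_volume_gauge_lt_one {E : Type*} [NormedAddCommGroup E] [NormedSpace ℝ E]
    [FiniteDimensional ℝ E] [MeasurableSpace E] [BorelSpace E] (μ : Measure E)
    [μ.IsAddHaarMeasure] {K : Set E} (hc : Convex ℝ K) (h0 : K ∈ 𝓝 0) :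
    μ K = μ {x | gauge K x < 1} := by
  rw [setOfPred_gauge_lt_one_eq_interior hc h0]
  refine le_antisymm ?_ (measure_mono interior_subset)
  calc μ K ≤ μ (interior K ∪ frontier K) := measure_mono <| by
        rw [← closure_eq_interior_union_frontier]; exact subset_closure
    _ ≤ μ (interior K) + μ (frontier K) := measure_union_le _ _
    _ = _ := by rw [hc.addHaar_frontier μ, add_zero]

theorem mem_nhds_zero_of_symmetric {E : Type*} [NormedAddCommGroup E] [NormedSpace ℝ E]
    {K : Set E} (hc : Convex ℝ K) (hsym : K = -K) (hK : (interior K).Nonempty) : K ∈ 𝓝 0 := by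
  obtain ⟨x, hx⟩ := hK
  have hx' : -x ∈ interior K := by
    have h : (Homeomorph.neg E) ⁻¹' interior K = interior K := by
      rw [Homeomorph.preimage_interior]
      exact congrArg interior (hsym.symm)
    rw [← h]
    simpa using hx
  rw [← mem_interior_iff_mem_nhds]
  have := hc.interior hx hx' (a := 1 / 2) (b := 1 / 2) (by norm_num) (by norm_num) (by norm_num)
  simpa using this

variable {n : ℕ} {K : Set (Fin n → ℝ)}

theorem convex_polarBody (K : Set (Fin n → ℝ)) : Convex ℝ (polarBody K) := by
  intro y hy z hz a b ha hb hab x hx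
  have e : ∑ i, x i * (a • y + b • z) i = a * ∑ i, x i * y i + b * ∑ i, x i * z i := by
    rw [Finset.mul_sum, Finset.mul_sum, ← Finset.sum_add_distrib]
    refine Finset.sum_congr rfl fun i _ => ?_
    simp only [Pi.add_apply, Pi.smul_apply, smul_eq_mul]
    ring
  rw [e]
  nlinarith [hy x hx, hz x hx]

theorem neg_mem_polarBody (hsym : ∀ x ∈ K, -x ∈ K) : ∀ y ∈ polarBody K, -y ∈ polarBody K := by
  intro y hy x hx
  simpa using hy (-x) (hsym x hx)

theorem polarBody_mem_nhds_zero (hb : Bornology.IsBounded K) : polarBody K ∈ 𝓝 0 := by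
  obtain ⟨R, hR, hRK⟩ := hb.subset_closedBall_lt 0 0
  have hd : 0 < (n * R + 1 : ℝ) := by positivity
  refine Metric.mem_nhds_iff.2 ⟨(n * R + 1)⁻¹, inv_pos.2 hd, fun y hy x hx => ?_⟩
  rw [mem_ball_zero_iff] at hy
  have hx' := mem_closedBall_zero_iff.1 (hRK hx)
  calc ∑ i, x i * y i ≤ ∑ _i : Fin n, R * (n * R + 1)⁻¹ := by
        refine Finset.sum_le_sum fun i _ => ?_
        refine (le_abs_self _).trans ?_
        rw [abs_mul]
        exact mul_le_mul ((norm_le_pi_norm x i).trans hx') ((norm_le_pi_norm y i).trans hy.le)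
          (abs_nonneg _) hR.le
    _ = n * R * (n * R + 1)⁻¹ := by simp [mul_assoc]
    _ ≤ 1 := by
        rw [← div_eq_mul_inv, div_le_one hd]
        linarith

theorem isBounded_polarBody (h0 : K ∈ 𝓝 0) : Bornology.IsBounded (polarBody K) := by
  obtain ⟨r, hr, hrK⟩ := Metric.nhds_basis_closedBall.mem_iff.1 h0
  refine isBounded_iff_forall_norm_le.2 ⟨r⁻¹, fun y hy => ?_⟩
  refine (pi_norm_le_iff_of_nonneg (inv_nonneg.2 hr.le)).2 fun i => ?_
  have key : ∀ t : ℝ, |t| ≤ r → t * y i ≤ 1 := fun t ht => by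
    have := hy (Pi.single i t) (hrK (by
      rw [mem_closedBall_zero_iff, Pi.norm_single]; exact ht))
    simpa [Pi.single_apply] using this
  have h1 := key r (abs_of_pos hr).le
  have h2 := key (-r) (by rw [abs_neg, abs_of_pos hr])
  rw [Real.norm_eq_abs, ← one_div, le_div_iff₀ hr, mul_comm]
  rcases abs_cases (y i) with ⟨h, _⟩ | ⟨h, _⟩ <;> rw [h] <;> linarith

theorem gauge_polarBody_le {y : Fin n → ℝ} {c : ℝ} (hc : 0 < c)
    (h : ∀ x, ∑ i, x i * y i ≤ c * gauge K x) : gauge (polarBody K) y ≤ c := by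
  refine gauge_le_of_mem hc.le ((mem_smul_set_iff_inv_smul_mem₀ hc.ne' _ _).2 fun x hx => ?_)
  have e : ∑ i, x i * (c⁻¹ • y) i = c⁻¹ * ∑ i, x i * y i := by
    rw [Finset.mul_sum]
    refine Finset.sum_congr rfl fun i _ => ?_
    simp only [Pi.smul_apply, smul_eq_mul]
    ring
  rw [e, inv_mul_le_iff₀ hc]
  exact (h x).trans (mul_le_mul_of_nonneg_left (gauge_le_one_of_mem hx) hc.le)

theorem sum_mul_le_gauge_mul_gauge (h0 : K ∈ 𝓝 0) (hb : Bornology.IsBounded K)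
    (x y : Fin n → ℝ) : ∑ i, x i * y i ≤ gauge K x * gauge (polarBody K) y := by
  have key : ∀ ε > 0, ∑ i, x i * y i ≤ (gauge K x + ε) * (gauge (polarBody K) y + ε) := by
    intro ε hε
    obtain ⟨a, ha0, ha, x', hx', rfl⟩ := exists_lt_of_gauge_lt (absorbent_nhds_zero h0)
      (lt_add_of_pos_right (gauge K x) hε)
    obtain ⟨b, hb0, hb', y', hy', rfl⟩ := exists_lt_of_gauge_lt
      (absorbent_nhds_zero (polarBody_mem_nhds_zero hb))
      (lt_add_of_pos_right (gauge (polarBody K) y) hε)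
    have e : ∑ i, (a • x') i * (b • y') i = a * b * ∑ i, x' i * y' i := by
      rw [Finset.mul_sum]
      refine Finset.sum_congr rfl fun i _ => ?_
      simp only [Pi.smul_apply, smul_eq_mul]
      ring
    rw [e]
    calc a * b * ∑ i, x' i * y' i ≤ a * b * 1 :=
          mul_le_mul_of_nonneg_left (hy' x' hx') (by positivity)
      _ = a * b := mul_one _
      _ ≤ _ := mul_le_mul ha.le hb'.le hb0.le (ha0.le.trans ha.le)
  have hlim : Filter.Tendsto (fun ε : ℝ => (gauge K x + ε) * (gauge (polarBody K) y + ε))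
      (𝓝[>] 0) (𝓝 ((gauge K x + 0) * (gauge (polarBody K) y + 0))) :=
    (Continuous.tendsto (by fun_prop) 0).mono_left nhdsWithin_le_nhds
  simpa using ge_of_tendsto hlim (Filter.mem_of_superset self_mem_nhdsWithin key)

theorem pi_pow_div_factorial_le_volume_mul_volume (hc : Convex ℝ K) (h0 : K ∈ 𝓝 0)
    (hsym : ∀ x ∈ K, -x ∈ K) (hb : Bornology.IsBounded K) :
    Real.pi ^ n / (n.factorial : ℝ) ≤ (volume K).toReal * (volume (polarBody K)).toReal := by
  have hP0 := polarBody_mem_nhds_zero hb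
  have hPb := isBounded_polarBody h0
  obtain ⟨c₁, hc₁, h₁⟩ := exists_gauge_le_mul_gauge h0 hP0 hPb
  obtain ⟨c₂, hc₂, h₂⟩ := exists_gauge_le_mul_gauge hP0 h0 hb
  have := pi_pow_le_factorial_mul (isNormFunction_gauge hc h0 hsym hb)
    (isNormFunction_gauge (convex_polarBody K) hP0 (neg_mem_polarBody hsym) hPb)
    (le_max_of_le_left hc₁ : 0 ≤ max c₁ c₂)
    (fun x => (h₁ x).trans (mul_le_mul_of_nonneg_right (le_max_left _ _) (gauge_nonneg _)))
    (fun x => (h₂ x).trans (mul_le_mul_of_nonneg_right (le_max_right _ _) (gauge_nonneg _)))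
    (fun y c hc h => gauge_polarBody_le hc h)
  rw [← volume_eq_volume_gauge_lt_one volume hc h0,
    ← volume_eq_volume_gauge_lt_one volume (convex_polarBody K) hP0, Fintype.card_fin] at this
  rw [div_le_iff₀ (by positivity)]
  linarith

end Polar

section PrekopaLeindler

open Set

theorem volume_add_volume_le_of_isCompact {A B M : Set ℝ} (hA : IsCompact A) (hB : IsCompact B)
    (hA0 : A.Nonempty) (hB0 : B.Nonempty) (h : ∀ a ∈ A, ∀ b ∈ B, (a + b) / 2 ∈ M) :
    volume A + volume B ≤ 2 * volume M := by
  obtain ⟨a, haA, ha⟩ := hA.exists_isGreatest hA0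
  obtain ⟨b, hbB, hb⟩ := hB.exists_isLeast hB0
  have h1 : volume ((fun x => x + -b) ⁻¹' A) = volume A := measure_preimage_add_right _ _ _
  have h2 : volume ((fun x => x + -a) ⁻¹' B) = volume B := measure_preimage_add_right _ _ _
  have h3 : volume ((fun x => x * (1 / 2)) ⁻¹' M) = 2 * volume M := by
    rw [Real.volume_preimage_mul_right (by norm_num)]
    norm_num
  have hd : AEDisjoint volume ((fun x => x + -b) ⁻¹' A) ((fun x => x + -a) ⁻¹' B) := by
    refine measure_mono_null (fun x hx => ?_) (Real.volume_singleton (a := a + b))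
    have e1 := ha hx.1
    have e2 := hb hx.2
    simp only at e1 e2
    exact le_antisymm (by linarith) (by linarith)
  rw [← h1, ← h2, ← h3, ← measure_union₀ ((hB.measurableSet.preimage
    (measurable_add_const (-a))).nullMeasurableSet) hd]
  refine measure_mono (union_subset (fun x hx => ?_) fun x hx => ?_)
  · have := h _ hx b hbB
    simpa [div_eq_mul_inv] using this
  · have := h a haA _ hx
    simpa [div_eq_mul_inv] using this

theorem volume_add_volume_le {A B M : Set ℝ} (hA : MeasurableSet A) (hB : MeasurableSet B)
    (hA0 : A.Nonempty) (hB0 : B.Nonempty) (h : ∀ a ∈ A, ∀ b ∈ B, (a + b) / 2 ∈ M) :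
    volume A + volume B ≤ 2 * volume M := by
  obtain ⟨a, ha⟩ := hA0
  obtain ⟨b, hb⟩ := hB0
  rw [hA.measure_eq_iSup_isCompact, hB.measure_eq_iSup_isCompact]
  simp only [iSup_and']
  refine ENNReal.biSup_add_biSup_le' ⟨∅, empty_subset _, isCompact_empty⟩
    ⟨∅, empty_subset _, isCompact_empty⟩ fun K hK L hL => ?_
  calc volume K + volume L ≤ volume (insert a K) + volume (insert b L) :=
        add_le_add (measure_mono (subset_insert _ _)) (measure_mono (subset_insert _ _))
    _ ≤ _ := volume_add_volume_le_of_isCompact (hK.2.insert a) (hL.2.insert b)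
        (insert_nonempty _ _) (insert_nonempty _ _) fun x hx y hy =>
        h x (insert_subset ha hK.1 hx) y (insert_subset hb hL.1 hy)

theorem lintegral_add_lintegral_le {f g h : ℝ → ℝ} (hf : Measurable f) (hg : Measurable g)
    (hh : Measurable h) (hf0 : ∀ x, 0 ≤ f x) (hg0 : ∀ x, 0 ≤ g x) (hh0 : ∀ x, 0 ≤ h x)
    (hf1 : ∀ x, f x ≤ 1) (hg1 : ∀ x, g x ≤ 1) (hfs : ∀ t < 1, ∃ x, t < f x)
    (hgs : ∀ t < 1, ∃ x, t < g x) (H : ∀ x y, f x * g y ≤ h ((x + y) / 2) ^ 2) :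
    (∫⁻ x, ENNReal.ofReal (f x)) + ∫⁻ x, ENNReal.ofReal (g x) ≤
      2 * ∫⁻ x, ENNReal.ofReal (h x) := by
  have hm : ∀ φ : ℝ → ℝ, Measurable fun t => volume {a | t < φ a} := fun φ =>
    Antitone.measurable fun s t hst => measure_mono fun a ha => lt_of_le_of_lt hst ha
  rw [lintegral_eq_lintegral_meas_lt _ (.of_forall hf0) hf.aemeasurable,
    lintegral_eq_lintegral_meas_lt _ (.of_forall hg0) hg.aemeasurable,
    lintegral_eq_lintegral_meas_lt _ (.of_forall hh0) hh.aemeasurable,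
    ← lintegral_add_left (hm f), ← lintegral_const_mul _ (hm h)]
  refine setLIntegral_mono' measurableSet_Ioi fun t (ht : 0 < t) => ?_
  rcases lt_or_ge t 1 with h1 | h1
  · refine volume_add_volume_le (measurableSet_lt measurable_const hf)
      (measurableSet_lt measurable_const hg) (hfs t h1) (hgs t h1) fun a ha b hb => ?_
    refine lt_of_pow_lt_pow_left₀ 2 (hh0 _) (lt_of_lt_of_le ?_ (H a b))
    rw [sq]
    exact mul_lt_mul'' ha hb ht.le ht.le
  · have e1 : {a | t < f a} = ∅ := eq_empty_of_forall_notMem fun a ha =>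
      absurd (lt_of_lt_of_le ha (hf1 a)) h1.not_gt
    have e2 : {a | t < g a} = ∅ := eq_empty_of_forall_notMem fun a ha =>
      absurd (lt_of_lt_of_le ha (hg1 a)) h1.not_gt
    simp [e1, e2]

theorem ENNReal.mul_le_sq_of_add_le {X Y Z : ENNReal} (h : X + Y ≤ 2 * Z) : X * Y ≤ Z ^ 2 := by
  rcases eq_or_ne Z ⊤ with rfl | hZ
  · simp
  have hXY : X + Y ≠ ⊤ := ne_top_of_le_ne_top (ENNReal.mul_ne_top (by simp) hZ) h
  lift Z to NNReal using hZ
  lift X to NNReal using (ENNReal.add_ne_top.1 hXY).1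
  lift Y to NNReal using (ENNReal.add_ne_top.1 hXY).2
  norm_cast at h ⊢
  rw [← NNReal.coe_le_coe] at h ⊢
  push_cast at h ⊢
  nlinarith [sq_nonneg ((X : ℝ) - Y), X.2, Y.2, Z.2, add_nonneg X.2 Y.2]

theorem lintegral_mul_lintegral_le_sq {f g h : ℝ → ℝ} (hf : Measurable f) (hg : Measurable g)
    (hh : Measurable h) (hf0 : ∀ x, 0 ≤ f x) (hg0 : ∀ x, 0 ≤ g x) (hh0 : ∀ x, 0 ≤ h x)
    (hfb : BddAbove (range f)) (hgb : BddAbove (range g))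
    (H : ∀ x y, f x * g y ≤ h ((x + y) / 2) ^ 2) :
    (∫⁻ x, ENNReal.ofReal (f x)) * ∫⁻ x, ENNReal.ofReal (g x) ≤
      (∫⁻ x, ENNReal.ofReal (h x)) ^ 2 := by
  by_cases hfz : ∀ x, f x = 0
  · simp [hfz]
  by_cases hgz : ∀ x, g x = 0
  · simp [hgz]
  push Not at hfz hgz
  obtain ⟨x₀, hx₀⟩ := hfz
  obtain ⟨y₀, hy₀⟩ := hgz
  set A := ⨆ x, f x with hA
  set B := ⨆ x, g x with hB
  have hA0 : 0 < A := lt_of_lt_of_le (lt_of_le_of_ne (hf0 x₀) hx₀.symm) (le_ciSup hfb x₀)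
  have hB0 : 0 < B := lt_of_lt_of_le (lt_of_le_of_ne (hg0 y₀) hy₀.symm) (le_ciSup hgb y₀)
  have hscale : ∀ (c : ℝ) (φ : ℝ → ℝ), 0 < c → Measurable φ → ∫⁻ x, ENNReal.ofReal (φ x) =
      ENNReal.ofReal c * ∫⁻ x, ENNReal.ofReal (c⁻¹ * φ x) := fun c φ hc hφ => by
    rw [← lintegral_const_mul _ (by fun_prop)]
    refine lintegral_congr fun x => ?_
    rw [← ENNReal.ofReal_mul hc.le, mul_inv_cancel_left₀ hc.ne']
  have key := lintegral_add_lintegral_le (f := fun x => A⁻¹ * f x) (g := fun x => B⁻¹ * g x)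
    (h := fun x => (√(A * B))⁻¹ * h x) (hf.const_mul _) (hg.const_mul _) (hh.const_mul _)
    (fun x => mul_nonneg (inv_nonneg.2 hA0.le) (hf0 x))
    (fun x => mul_nonneg (inv_nonneg.2 hB0.le) (hg0 x))
    (fun x => mul_nonneg (inv_nonneg.2 (Real.sqrt_nonneg _)) (hh0 x))
    (fun x => by rw [inv_mul_le_iff₀ hA0, mul_one]; exact le_ciSup hfb x)
    (fun x => by rw [inv_mul_le_iff₀ hB0, mul_one]; exact le_ciSup hgb x)
    (fun t ht => by
      obtain ⟨x, hx⟩ := exists_lt_of_lt_ciSup (show A * t < A by nlinarith)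
      exact ⟨x, by rwa [lt_inv_mul_iff₀ hA0]⟩)
    (fun t ht => by
      obtain ⟨x, hx⟩ := exists_lt_of_lt_ciSup (show B * t < B by nlinarith)
      exact ⟨x, by rwa [lt_inv_mul_iff₀ hB0]⟩)
    (fun x y => by
      rw [mul_pow, inv_pow, Real.sq_sqrt (by positivity), mul_mul_mul_comm, ← mul_inv]
      exact mul_le_mul_of_nonneg_left (H x y) (by positivity))
  rw [hscale A f hA0 hf, hscale B g hB0 hg, hscale (√(A * B)) h (by positivity) hh, mul_pow,
    ← ENNReal.ofReal_pow (Real.sqrt_nonneg _), Real.sq_sqrt (by positivity), mul_mul_mul_comm,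
    ← ENNReal.ofReal_mul hA0.le]
  gcongr
  exact ENNReal.mul_le_sq_of_add_le key

theorem setLIntegral_Ioi_eq_lintegral_exp (φ : ℝ → ENNReal) :
    ∫⁻ t in Ioi 0, φ t = ∫⁻ a, ENNReal.ofReal (Real.exp a) * φ (Real.exp a) := by
  have := lintegral_image_eq_lintegral_abs_deriv_mul MeasurableSet.univ
    (fun x _ => (Real.hasDerivAt_exp x).hasDerivWithinAt) Real.exp_injective.injOn φ
  rw [image_univ, Real.range_exp] at this
  simpa using this

theorem setIntegral_mul_setIntegral_le {f g : ℝ → ℝ} (hf : Measurable f) (hg : Measurable g)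
    (hf0 : ∀ x, 0 ≤ f x) (hg0 : ∀ x, 0 ≤ g x) {N : ℝ} (hfN : ∀ s, 0 < s → s * f s ≤ N)
    (hgN : ∀ s, 0 < s → s * g s ≤ N) {C : ℝ} (hC : 0 ≤ C)
    (H : ∀ s t, 0 < s → 0 < t → f s * g t ≤ C * Real.exp (-2 * (s * t))) :
    (∫ s in Ioi 0, f s) * ∫ t in Ioi 0, g t ≤ C * (Real.pi / 4) := by
  have key := lintegral_mul_lintegral_le_sq (f := fun a => Real.exp a * f (Real.exp a))
    (g := fun a => Real.exp a * g (Real.exp a))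
    (h := fun a => √C * (Real.exp a * Real.exp (-1 * Real.exp a ^ 2)))
    (by fun_prop) (by fun_prop) (by fun_prop) (fun a => mul_nonneg (Real.exp_pos a).le (hf0 _))
    (fun a => mul_nonneg (Real.exp_pos a).le (hg0 _)) (fun a => by positivity)
    ⟨N, by rintro _ ⟨a, rfl⟩; exact hfN _ (Real.exp_pos a)⟩
    ⟨N, by rintro _ ⟨a, rfl⟩; exact hgN _ (Real.exp_pos a)⟩ (fun x y => by
      have e1 : Real.exp ((x + y) / 2) ^ 2 = Real.exp (x + y) := by
        rw [← Real.exp_nat_mul]; congr 1; push_cast; ring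
      have e2 : Real.exp (-1 * Real.exp ((x + y) / 2) ^ 2) ^ 2 =
          Real.exp (-2 * (Real.exp x * Real.exp y)) := by
        rw [e1, ← Real.exp_nat_mul, ← Real.exp_add]; congr 1; push_cast; ring
      rw [mul_mul_mul_comm, ← Real.exp_add, mul_pow, mul_pow, Real.sq_sqrt hC, e2, e1,
        mul_left_comm C]
      exact mul_le_mul_of_nonneg_left (H _ _ (Real.exp_pos x) (Real.exp_pos y)) (Real.exp_pos _).le)
  have hl : ∀ φ : ℝ → ℝ, ∫⁻ a, ENNReal.ofReal (Real.exp a * φ (Real.exp a)) =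
      ∫⁻ t in Ioi 0, ENNReal.ofReal (φ t) := fun φ => by
    rw [setLIntegral_Ioi_eq_lintegral_exp]
    exact lintegral_congr fun a => ENNReal.ofReal_mul (Real.exp_pos a).le
  have hG : ∫⁻ a, ENNReal.ofReal (√C * (Real.exp a * Real.exp (-1 * Real.exp a ^ 2))) =
      ENNReal.ofReal (√C * (√Real.pi / 2)) := by
    simp only [ENNReal.ofReal_mul (Real.sqrt_nonneg C)]
    rw [lintegral_const_mul _ (by fun_prop), hl fun t => Real.exp (-1 * t ^ 2),
      ← ofReal_integral_eq_lintegral_ofReal (integrable_exp_neg_mul_sq one_pos).integrableOn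
        (.of_forall fun _ => (Real.exp_pos _).le), integral_gaussian_Ioi, div_one]
  rw [hl, hl, hG, ← ENNReal.ofReal_pow (by positivity)] at key
  have := ENNReal.toReal_mono ENNReal.ofReal_ne_top key
  rw [ENNReal.toReal_mul, ENNReal.toReal_ofReal (by positivity), mul_pow, div_pow, Real.sq_sqrt hC,
    Real.sq_sqrt Real.pi_pos.le, ← integral_eq_lintegral_of_nonneg_ae (.of_forall hf0)
      hf.aestronglyMeasurable, ← integral_eq_lintegral_of_nonneg_ae (.of_forall hg0)
      hg.aestronglyMeasurable] at this
  exact this.trans (le_of_eq (by norm_num))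

end PrekopaLeindler

section Decay

open Set Module

/-- Measurable nonnegative functions decaying faster than every exponential. -/
structure ExpDecay {E : Type*} [NormedAddCommGroup E] [MeasurableSpace E] (f : E → ℝ) : Prop where
  measurable : Measurable f
  nonneg : ∀ x, 0 ≤ f x
  bound : ∀ a : ℝ, ∃ C, ∀ x, f x ≤ C * Real.exp (-a * ‖x‖)

theorem integrable_exp_neg_norm {E : Type*} [NormedAddCommGroup E] [NormedSpace ℝ E]
    [FiniteDimensional ℝ E] [MeasurableSpace E] [BorelSpace E] (μ : Measure E)
    [μ.IsAddHaarMeasure] : Integrable (fun x => Real.exp (-‖x‖)) μ := by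
  refine not_imp_comm.1 integral_undef fun h => ?_
  have key := measure_lt_one_eq_integral_div_gamma μ (g := fun x : E => ‖x‖) (p := 1) norm_zero
    norm_neg norm_add_le norm_eq_zero.1 (fun r x => (norm_smul r x).le) one_pos
  simp only [Real.rpow_one, h, zero_div, ENNReal.ofReal_zero] at key
  exact ((isOpen_lt continuous_norm continuous_const).measure_pos μ
    ⟨(0 : E), by simp⟩).ne' key

namespace ExpDecay

variable {E E' : Type*} [NormedAddCommGroup E] [MeasurableSpace E] [NormedAddCommGroup E']
  [MeasurableSpace E']

theorem exists_bound {f : E → ℝ} (hf : ExpDecay f) (a : ℝ) :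
    ∃ C, 0 ≤ C ∧ ∀ x, f x ≤ C * Real.exp (-a * ‖x‖) := by
  obtain ⟨C, hC⟩ := hf.bound a
  exact ⟨C, nonneg_of_mul_nonneg_left ((hf.nonneg 0).trans (hC 0)) (Real.exp_pos _), hC⟩

theorem comp {f : E' → ℝ} (hf : ExpDecay f) {φ : E → E'} (hφ : Measurable φ) {K K' : ℝ}
    (h : ∀ x, ‖x‖ ≤ K * ‖φ x‖ + K') : ExpDecay fun x => f (φ x) where
  measurable := hf.measurable.comp hφ
  nonneg x := hf.nonneg _
  bound a := by
    obtain ⟨C, hC0, hC⟩ := hf.exists_bound (|a| * K)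
    refine ⟨C * Real.exp (|a| * K'), fun x => (hC _).trans ?_⟩
    rw [mul_assoc, ← Real.exp_add]
    refine mul_le_mul_of_nonneg_left (Real.exp_le_exp.2 ?_) hC0
    have h1 := mul_le_mul_of_nonneg_left (h x) (abs_nonneg a)
    have h2 := mul_le_mul_of_nonneg_right (le_abs_self a) (norm_nonneg x)
    linarith

theorem mul {f : E → ℝ} (hf : ExpDecay f) {p : E → ℝ} (hp : Measurable p) (hp0 : ∀ x, 0 ≤ p x)
    {A b : ℝ} (h : ∀ x, p x ≤ A * Real.exp (b * ‖x‖)) : ExpDecay fun x => p x * f x where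
  measurable := hp.mul hf.measurable
  nonneg x := mul_nonneg (hp0 x) (hf.nonneg x)
  bound a := by
    obtain ⟨C, hC0, hC⟩ := hf.exists_bound (a + b)
    refine ⟨A * C, fun x => ?_⟩
    calc p x * f x ≤ (A * Real.exp (b * ‖x‖)) * (C * Real.exp (-(a + b) * ‖x‖)) :=
          mul_le_mul (h x) (hC x) (hf.nonneg x) ((hp0 x).trans (h x))
      _ = A * C * (Real.exp (b * ‖x‖) * Real.exp (-(a + b) * ‖x‖)) := by ring
      _ = _ := by rw [← Real.exp_add]; congr 2; ring

variable [NormedSpace ℝ E] [FiniteDimensional ℝ E] [BorelSpace E] (μ : Measure E)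
  [μ.IsAddHaarMeasure]

theorem integrable_mul {f : E → ℝ} (hf : ExpDecay f) {p : E → ℝ} (hp : Measurable p)
    {A b : ℝ} (h : ∀ x, |p x| ≤ A * Real.exp (b * ‖x‖)) : Integrable (fun x => p x * f x) μ := by
  obtain ⟨C, hC0, hC⟩ := hf.exists_bound (1 + b)
  refine ((integrable_exp_neg_norm μ).const_mul (A * C)).mono'
    (hp.mul hf.measurable).aestronglyMeasurable (.of_forall fun x => ?_)
  rw [Real.norm_eq_abs, abs_mul, abs_of_nonneg (hf.nonneg x)]
  calc |p x| * f x ≤ (A * Real.exp (b * ‖x‖)) * (C * Real.exp (-(1 + b) * ‖x‖)) :=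
        mul_le_mul (h x) (hC x) (hf.nonneg x) ((abs_nonneg _).trans (h x))
    _ = A * C * (Real.exp (b * ‖x‖) * Real.exp (-(1 + b) * ‖x‖)) := by ring
    _ = _ := by rw [← Real.exp_add]; congr 2; ring

theorem integrable {f : E → ℝ} (hf : ExpDecay f) : Integrable f μ := by
  simpa using hf.integrable_mul μ (p := fun _ => 1) measurable_const (A := 1) (b := 0) (by simp)

theorem integrable_mul_of_le_norm {f : E → ℝ} (hf : ExpDecay f) {p : E → ℝ} (hp : Measurable p)
    {A : ℝ} (h : ∀ x, |p x| ≤ ‖x‖ + A) : Integrable (fun x => p x * f x) μ := by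
  refine hf.integrable_mul μ hp (A := Real.exp A) (b := 1) fun x => (h x).trans ?_
  rw [← Real.exp_add]
  linarith [Real.add_one_le_exp (A + 1 * ‖x‖)]

end ExpDecay

variable {E : Type*} [NormedAddCommGroup E] [MeasurableSpace E]

theorem ExpDecay.setIntegral_fst {f : ℝ × E → ℝ} (hf : ExpDecay f) {S : Set ℝ} :
    ExpDecay fun y => ∫ t in S, f (t, y) where
  measurable := by
    have : StronglyMeasurable fun y => ∫ t in S, f (t, y) :=
      StronglyMeasurable.integral_prod_left hf.measurable.stronglyMeasurable
    exact this.measurable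
  nonneg y := integral_nonneg fun t => hf.nonneg _
  bound a := by
    obtain ⟨C, hC0, hC⟩ := hf.exists_bound (1 + |a|)
    have hi := integrable_exp_neg_norm (volume : Measure ℝ)
    refine ⟨C * ∫ t : ℝ, Real.exp (-‖t‖), fun y => ?_⟩
    have hle : ∀ t, f (t, y) ≤ C * Real.exp (-‖t‖) * Real.exp (-a * ‖y‖) := fun t => by
      refine (hC _).trans ?_
      rw [mul_assoc, ← Real.exp_add]
      refine mul_le_mul_of_nonneg_left (Real.exp_le_exp.2 ?_) hC0
      have h1 : ‖t‖ ≤ ‖(t, y)‖ := le_max_left _ _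
      have h2 : ‖y‖ ≤ ‖(t, y)‖ := le_max_right _ _
      have h3 := mul_le_mul_of_nonneg_left h2 (abs_nonneg a)
      have h4 := mul_le_mul_of_nonneg_right (le_abs_self a) (norm_nonneg y)
      linarith
    have hi' : Integrable fun t : ℝ => C * Real.exp (-‖t‖) * Real.exp (-a * ‖y‖) :=
      (hi.const_mul C).mul_const _
    calc ∫ t in S, f (t, y) ≤ ∫ t in S, C * Real.exp (-‖t‖) * Real.exp (-a * ‖y‖) :=
          integral_mono_of_nonneg (.of_forall fun t => hf.nonneg _) hi'.integrableOn
            (.of_forall hle)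
      _ ≤ ∫ t, C * Real.exp (-‖t‖) * Real.exp (-a * ‖y‖) :=
          setIntegral_le_integral hi' (.of_forall fun t => by positivity)
      _ = _ := by rw [integral_mul_const, integral_const_mul]

theorem ExpDecay.exists_mul_le {f : ℝ × E → ℝ} (hf : ExpDecay f) :
    ∃ N, ∀ s y, 0 < s → s * f (s, y) ≤ N := by
  obtain ⟨C, hC0, hC⟩ := hf.exists_bound 1
  refine ⟨C, fun s y hs => ?_⟩
  have h1 : s ≤ ‖(s, y)‖ := (le_abs_self s).trans (le_max_left _ _)
  calc s * f (s, y) ≤ Real.exp ‖(s, y)‖ * (C * Real.exp (-1 * ‖(s, y)‖)) :=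
        mul_le_mul (by linarith [Real.add_one_le_exp ‖(s, y)‖]) (hC _) (hf.nonneg _)
          (Real.exp_pos _).le
    _ = C * (Real.exp ‖(s, y)‖ * Real.exp (-1 * ‖(s, y)‖)) := by ring
    _ = C := by rw [← Real.exp_add]; simp

end Decay

section Santalo

open Set Module

/-- Lehec's form of the functional Blaschke–Santaló inequality in dimension `n`. -/
def FunctionalSantalo (n : ℕ) : Prop :=
  ∀ f g : (Fin n → ℝ) → ℝ, ExpDecay f → ExpDecay g → ∀ C : ℝ,
    (∀ x y, f x * g y ≤ C * Real.exp (-2 * (x ⬝ᵥ y))) → (∀ i, ∫ x, x i * f x = 0) →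
      (∫ x, f x) * ∫ y, g y ≤ C * Real.pi ^ n

variable {n : ℕ}

instance isAddHaarMeasure_volume_real_prod :
    (volume : Measure (ℝ × (Fin n → ℝ))).IsAddHaarMeasure :=
  inferInstanceAs ((volume : Measure ℝ).prod (volume : Measure (Fin n → ℝ))).IsAddHaarMeasure

theorem halfSpace_santalo (IH : FunctionalSantalo n) {f g : ℝ × (Fin n → ℝ) → ℝ}
    (hf : ExpDecay f) (hg : ExpDecay g) {C : ℝ}
    (H : ∀ x y, f x * g y ≤ C * Real.exp (-2 * (x.1 * y.1 + x.2 ⬝ᵥ y.2)))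
    (hbar : ∀ i, ∫ p in Ioi (0 : ℝ) ×ˢ (univ : Set (Fin n → ℝ)), p.2 i * g p = 0) :
    (∫ p in Ioi (0 : ℝ) ×ˢ univ, f p) * ∫ p in Ioi (0 : ℝ) ×ˢ univ, g p ≤
      C * (Real.pi ^ (n + 1) / 4) := by
  have hC : 0 ≤ C := nonneg_of_mul_nonneg_left
    ((mul_nonneg (hf.nonneg 0) (hg.nonneg 0)).trans (H 0 0)) (Real.exp_pos _)
  have hfub : ∀ φ : ℝ × (Fin n → ℝ) → ℝ, Integrable φ →
      ∫ p in Ioi (0 : ℝ) ×ˢ univ, φ p = ∫ y, ∫ t in Ioi (0 : ℝ), φ (t, y) := fun φ hφ => by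
    rw [Measure.volume_eq_prod, ← Measure.prod_restrict, Measure.restrict_univ]
    refine integral_prod_symm φ ?_
    have := hφ.integrableOn (s := Ioi (0 : ℝ) ×ˢ univ)
    rwa [IntegrableOn, Measure.volume_eq_prod, ← Measure.prod_restrict,
      Measure.restrict_univ] at this
  obtain ⟨N₁, hN₁⟩ := hf.exists_mul_le
  obtain ⟨N₂, hN₂⟩ := hg.exists_mul_le
  have key := IH _ _ (hg.setIntegral_fst (S := Ioi 0)) (hf.setIntegral_fst (S := Ioi 0))
    (C * (Real.pi / 4)) (fun y x => by
      rw [mul_comm]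
      have := setIntegral_mul_setIntegral_le (f := fun t => f (t, x)) (g := fun t => g (t, y))
        (hf.measurable.comp (by fun_prop)) (hg.measurable.comp (by fun_prop))
        (fun _ => hf.nonneg _) (fun _ => hg.nonneg _)
        (fun s hs => (hN₁ s x hs).trans (le_max_left N₁ N₂))
        (fun s hs => (hN₂ s y hs).trans (le_max_right N₁ N₂))
        (C := C * Real.exp (-2 * (y ⬝ᵥ x))) (by positivity) (fun s t _ _ => by
          refine (H _ _).trans (le_of_eq ?_)
          rw [mul_assoc, ← Real.exp_add, dotProduct_comm x y]
          congr 2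
          ring)
      linarith)
    (fun i => by
      refine Eq.trans ?_ (hbar i)
      rw [hfub _ (hg.integrable_mul_of_le_norm volume (p := fun p => p.2 i)
        (by fun_prop) (A := 0) fun p => ?_)]
      · simp only [integral_const_mul]
      · rw [add_zero]
        exact (norm_le_pi_norm p.2 i).trans (le_max_right _ _))
  rw [hfub f (hf.integrable _), hfub g (hg.integrable _)]
  rw [mul_comm]
  refine key.trans (le_of_eq ?_)
  ring

theorem setIntegral_prod_univ (S : Set ℝ) {φ : ℝ × (Fin n → ℝ) → ℝ} (hφ : Integrable φ) :
    ∫ p in S ×ˢ univ, φ p = ∫ t in S, ∫ y, φ (t, y) := by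
  rw [Measure.volume_eq_prod, setIntegral_prod φ hφ.integrableOn]
  simp

theorem santalo_of_balanced_halfSpaces (IH : FunctionalSantalo n) {f g : ℝ × (Fin n → ℝ) → ℝ}
    (hf : ExpDecay f) (hg : ExpDecay g) {C : ℝ}
    (H : ∀ x y, f x * g y ≤ C * Real.exp (-2 * (x.1 * y.1 + x.2 ⬝ᵥ y.2)))
    (hmass : ∫ p in Ioi (0 : ℝ) ×ˢ univ, g p = ∫ p in Iic (0 : ℝ) ×ˢ univ, g p)
    (hbar₁ : ∀ i, ∫ p in Ioi (0 : ℝ) ×ˢ (univ : Set (Fin n → ℝ)), p.2 i * g p = 0)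
    (hbar₂ : ∀ i, ∫ p in Iic (0 : ℝ) ×ˢ (univ : Set (Fin n → ℝ)), p.2 i * g p = 0) :
    (∫ p, f p) * ∫ p, g p ≤ C * Real.pi ^ (n + 1) := by
  set ρ : ℝ × (Fin n → ℝ) → ℝ × (Fin n → ℝ) := fun p => (-p.1, p.2) with hρ
  have hρm : Measurable ρ := by fun_prop
  have hρd : ∀ φ, ExpDecay φ → ExpDecay fun p => φ (ρ p) := fun φ hφ =>
    hφ.comp hρm (K := 1) (K' := 0) fun p => by simp [hρ, Prod.norm_def]
  have hflip : ∀ φ : ℝ × (Fin n → ℝ) → ℝ, Integrable φ → Integrable (fun p => φ (ρ p)) →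
      ∫ p in Ioi (0 : ℝ) ×ˢ univ, φ (ρ p) = ∫ p in Iic (0 : ℝ) ×ˢ univ, φ p := fun φ h1 h2 => by
    rw [setIntegral_prod_univ _ h1, setIntegral_prod_univ _ h2]
    simpa using integral_comp_neg_Ioi (0 : ℝ) (fun t => ∫ y, φ (t, y))
  have hsplit : ∀ φ : ℝ × (Fin n → ℝ) → ℝ, Integrable φ →
      ∫ p, φ p = (∫ p in Iic (0 : ℝ) ×ˢ univ, φ p) + ∫ p in Ioi (0 : ℝ) ×ˢ univ, φ p :=
    fun φ h => by
    have hc : Ioi (0 : ℝ) ×ˢ (univ : Set (Fin n → ℝ)) = (Iic (0 : ℝ) ×ˢ univ)ᶜ := by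
      ext p; simp
    rw [hc, integral_add_compl (measurableSet_Iic.prod MeasurableSet.univ) h]
  have hfi := hf.integrable volume
  have hgi := hg.integrable volume
  have hp : ∀ (i : Fin n) (φ : ℝ × (Fin n → ℝ) → ℝ), ExpDecay φ →
      Integrable fun p : ℝ × (Fin n → ℝ) => p.2 i * φ p := fun i φ hφ =>
    hφ.integrable_mul_of_le_norm volume (by fun_prop) (A := 0) fun p => by
      rw [add_zero]
      exact (norm_le_pi_norm p.2 i).trans (le_max_right _ _)
  have k1 := halfSpace_santalo IH hf hg H hbar₁
  have k2 := halfSpace_santalo IH (hρd f hf) (hρd g hg) (C := C)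
    (fun x y => by simpa [hρ] using H (ρ x) (ρ y))
    (fun i => by
      refine Eq.trans ?_ (hbar₂ i)
      rw [← hflip (fun p => p.2 i * g p) (hp i g hg) (hp i _ (hρd g hg))])
  rw [hflip f hfi ((hρd f hf).integrable _), hflip g hgi ((hρd g hg).integrable _)] at k2
  rw [hsplit f hfi, hsplit g hgi, hmass]
  rw [hmass] at k1
  linarith

end Santalo

section Shear

open Set Module Filter Topology

variable {n : ℕ}

theorem abs_dotProduct_le (x z : Fin n → ℝ) : |x ⬝ᵥ z| ≤ (∑ i, |z i|) * ‖x‖ := by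
  rw [Finset.sum_mul]
  refine (Finset.abs_sum_le_sum_abs _ _).trans (Finset.sum_le_sum fun i _ => ?_)
  rw [abs_mul, mul_comm]
  exact mul_le_mul_of_nonneg_left (norm_le_pi_norm x i) (abs_nonneg _)

theorem measurePreserving_shear (a : ℝ) (z w : Fin n → ℝ) :
    MeasurePreserving fun p : ℝ × (Fin n → ℝ) => (a + p.1, z + p.1 • w + p.2) := by
  simp only [Measure.volume_eq_prod]
  refine MeasurePreserving.skew_product (f := fun t => a + t) (g := fun t y => z + t • w + y)
    (measurePreserving_add_left volume a) (by unfold Function.uncurry; fun_prop)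
    (.of_forall fun t => (measurePreserving_add_left volume _).map_eq)

theorem measurableEmbedding_shear (a : ℝ) (z w : Fin n → ℝ) :
    MeasurableEmbedding fun p : ℝ × (Fin n → ℝ) => (a + p.1, z + p.1 • w + p.2) := by
  refine Measurable.measurableEmbedding (by fun_prop) fun p q h => ?_
  simp only [Prod.mk.injEq, add_right_inj] at h
  obtain ⟨h1, h2⟩ := h
  rw [h1, add_right_inj] at h2
  exact Prod.ext h1 h2

theorem integral_shear {h : ℝ × (Fin n → ℝ) → ℝ} (w : Fin n → ℝ) (hh : Integrable h)
    (hh' : Integrable fun p : ℝ × (Fin n → ℝ) => h (p.1 - w ⬝ᵥ p.2, p.2)) :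
    ∫ p : ℝ × (Fin n → ℝ), h (p.1 - w ⬝ᵥ p.2, p.2) = ∫ p, h p := by
  rw [Measure.volume_eq_prod] at *
  rw [integral_prod_symm _ hh, integral_prod_symm _ hh']
  congr 1 with y
  exact integral_sub_right_eq_self (μ := volume) (fun t => h (t, y)) (w ⬝ᵥ y)

theorem exists_median {m : ℝ → ℝ} (hm : Integrable m) (hpos : 0 < ∫ t, m t) :
    ∃ a, ∫ t in Ioi a, m t = ∫ t in Iic a, m t := by
  have hsplit : ∀ a, (∫ t in Iic a, m t) + ∫ t in Ioi a, m t = ∫ t, m t := fun a => by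
    rw [← compl_Iic, integral_add_compl measurableSet_Iic hm]
  have hbot : Tendsto (fun c => ∫ t in (0 : ℝ)..c, m t) atBot (𝓝 (-∫ t in Iic 0, m t)) := by
    simp_rw [intervalIntegral.integral_symm _ (0 : ℝ)]
    exact (intervalIntegral_tendsto_integral_Iic 0 hm.integrableOn tendsto_id).neg
  have htop : Tendsto (fun c => ∫ t in (0 : ℝ)..c, m t) atTop (𝓝 (∫ t in Ioi 0, m t)) :=
    intervalIntegral_tendsto_integral_Ioi 0 hm.integrableOn tendsto_id
  have h0 := hsplit 0
  have hcont : Continuous fun c => ∫ t in (0 : ℝ)..c, m t :=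
    intervalIntegral.continuous_primitive (fun _ _ => hm.intervalIntegrable) 0
  obtain ⟨b, hb⟩ := (hbot.eventually_le_const
    (show _ < ((∫ t in Ioi 0, m t) - ∫ t in Iic 0, m t) / 2 by linarith)).exists
  obtain ⟨c, hc⟩ := (htop.eventually_const_le
    (show ((∫ t in Ioi 0, m t) - ∫ t in Iic 0, m t) / 2 < _ by linarith)).exists
  obtain ⟨a, ha⟩ := mem_range_of_exists_le_of_exists_ge hcont ⟨b, hb⟩ ⟨c, hc⟩
  refine ⟨a, ?_⟩
  have h1 := intervalIntegral.integral_Iic_sub_Iic (a := 0) (b := a) (f := m) (μ := volume)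
    hm.integrableOn hm.integrableOn
  have h2 := hsplit a
  simp only at ha
  linarith

theorem santalo_prod (IH : FunctionalSantalo n) {f g : ℝ × (Fin n → ℝ) → ℝ}
    (hf : ExpDecay f) (hg : ExpDecay g) {C : ℝ}
    (H : ∀ x y, f x * g y ≤ C * Real.exp (-2 * (x.1 * y.1 + x.2 ⬝ᵥ y.2)))
    (hbar₁ : ∫ p : ℝ × (Fin n → ℝ), p.1 * f p = 0)
    (hbar₂ : ∀ i, ∫ p : ℝ × (Fin n → ℝ), p.2 i * f p = 0) :
    (∫ p, f p) * ∫ p, g p ≤ C * Real.pi ^ (n + 1) := by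
  have hC : 0 ≤ C := nonneg_of_mul_nonneg_left
    ((mul_nonneg (hf.nonneg 0) (hg.nonneg 0)).trans (H 0 0)) (Real.exp_pos _)
  rcases (integral_nonneg (μ := volume) (f := g) fun p => hg.nonneg p).eq_or_lt with hg0 | hg0
  · rw [← hg0, mul_zero]
    positivity
  have hfi := hf.integrable volume
  have hgi := hg.integrable volume
  have hn1 : ∀ p : ℝ × (Fin n → ℝ), |p.1| ≤ ‖p‖ := fun p => le_max_left _ _
  have hn2 : ∀ p : ℝ × (Fin n → ℝ), ‖p.2‖ ≤ ‖p‖ := fun p => le_max_right _ _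
  have hi1 : ∀ φ : ℝ × (Fin n → ℝ) → ℝ, ExpDecay φ → ∀ a : ℝ,
      Integrable fun p : ℝ × (Fin n → ℝ) => (p.1 - a) * φ p := fun φ hφ a =>
    hφ.integrable_mul_of_le_norm volume (by fun_prop) (A := |a|) fun p =>
      (abs_sub _ _).trans (add_le_add_left (hn1 p) _)
  have hi2 : ∀ φ : ℝ × (Fin n → ℝ) → ℝ, ExpDecay φ → ∀ i,
      Integrable fun p : ℝ × (Fin n → ℝ) => p.2 i * φ p := fun φ hφ i =>
    hφ.integrable_mul_of_le_norm volume (by fun_prop) (A := 0) fun p => by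
      rw [add_zero]
      exact (norm_le_pi_norm p.2 i).trans (hn2 p)
  -- the hyperplane `t = a` bisects the mass of `g`
  obtain ⟨a, ha⟩ : ∃ a, ∫ q in Ioi a ×ˢ univ, g q = ∫ q in Iic a ×ˢ univ, g q := by
    have hgi' : Integrable g ((volume : Measure ℝ).prod volume) := hgi
    have := exists_median hgi'.integral_prod_left (by rwa [← integral_prod _ hgi'])
    obtain ⟨a, ha⟩ := this
    exact ⟨a, by rw [setIntegral_prod_univ _ hgi, setIntegral_prod_univ _ hgi, ha]⟩
  set U : Set (ℝ × (Fin n → ℝ)) := Ioi a ×ˢ univ with hU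
  set L : Set (ℝ × (Fin n → ℝ)) := Iic a ×ˢ univ with hL
  have hUm : MeasurableSet U := measurableSet_Ioi.prod .univ
  have hLm : MeasurableSet L := measurableSet_Iic.prod .univ
  set M := ∫ q in U, g q with hM
  have hUL : U = Lᶜ := by
    ext p; simp [U, L]
  have hMpos : 0 < M := by
    have := integral_add_compl hLm hgi
    rw [← hUL, ← ha] at this
    linarith
  set Q₁ := ∫ q in U, (q.1 - a) * g q with hQ₁
  set Q₂ := ∫ q in L, (q.1 - a) * g q with hQ₂
  have hQ₁pos : 0 < Q₁ := by
    have hnn : 0 ≤ᵐ[volume.restrict U] fun q => (q.1 - a) * g q :=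
      (ae_restrict_iff' hUm).2 <| .of_forall fun q hq =>
        mul_nonneg (sub_nonneg.2 hq.1.le) (hg.nonneg q)
    refine (integral_nonneg_of_ae hnn).lt_of_ne fun h0 => hMpos.ne ?_
    have h1 := (integral_eq_zero_iff_of_nonneg_ae hnn (hi1 g hg a).integrableOn).1 h0.symm
    refine (integral_eq_zero_of_ae ?_).symm
    filter_upwards [h1, ae_restrict_mem hUm] with q hq hqU
    exact (mul_eq_zero.1 hq).resolve_left (sub_pos.2 hqU.1).ne'
  have hQ₂np : Q₂ ≤ 0 := setIntegral_nonpos hLm fun q hq =>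
    mul_nonpos_of_nonpos_of_nonneg (sub_nonpos.2 hq.1) (hg.nonneg q)
  set w : Fin n → ℝ := fun i =>
    ((∫ q in U, q.2 i * g q) - ∫ q in L, q.2 i * g q) / (Q₁ - Q₂) with hw
  set z : Fin n → ℝ := fun i => ((∫ q in U, q.2 i * g q) - Q₁ * w i) / M with hz
  set Ψ : ℝ × (Fin n → ℝ) → ℝ × (Fin n → ℝ) := fun p => (a + p.1, z + p.1 • w + p.2) with hΨ
  have hΨp : MeasurePreserving Ψ := measurePreserving_shear a z w
  have hΨe : MeasurableEmbedding Ψ := measurableEmbedding_shear a z w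
  have hpU : Ioi (0 : ℝ) ×ˢ univ = Ψ ⁻¹' U := by ext p; simp [Ψ, U]
  have hpL : Iic (0 : ℝ) ×ˢ univ = Ψ ⁻¹' L := by ext p; simp [Ψ, L]
  set h : ℝ × (Fin n → ℝ) → ℝ := fun p => Real.exp (2 * (p.1 * a + p.2 ⬝ᵥ z)) * f p with hh
  set S : ℝ × (Fin n → ℝ) → ℝ × (Fin n → ℝ) := fun p => (p.1 - w ⬝ᵥ p.2, p.2) with hS
  have hhd : ExpDecay h := by
    refine hf.mul (by unfold dotProduct; fun_prop) (fun _ => (Real.exp_pos _).le)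
      (A := 1) (b := 2 * (|a| + ∑ i, |z i|)) fun p => ?_
    rw [one_mul, Real.exp_le_exp]
    have h1 : p.1 * a ≤ ‖p‖ * |a| := (le_abs_self _).trans <| by
      rw [abs_mul]
      exact mul_le_mul_of_nonneg_right (hn1 p) (abs_nonneg _)
    have h2 : p.2 ⬝ᵥ z ≤ (∑ i, |z i|) * ‖p‖ := (le_abs_self _).trans <|
      (abs_dotProduct_le _ _).trans <|
        mul_le_mul_of_nonneg_left (hn2 p) (Finset.sum_nonneg fun _ _ => abs_nonneg _)
    linarith
  have hfd : ExpDecay fun p => h (S p) := by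
    refine hhd.comp (by simp only [S]; unfold dotProduct; fun_prop) (K := 1 + ∑ i, |w i|)
      (K' := 0) fun p => ?_
    have hw0 : 0 ≤ ∑ i, |w i| := Finset.sum_nonneg fun _ _ => abs_nonneg _
    have h1 := abs_dotProduct_le p.2 w
    have h2 : |p.1 - w ⬝ᵥ p.2| ≤ ‖S p‖ := hn1 (S p)
    have h3 : ‖p.2‖ ≤ ‖S p‖ := hn2 (S p)
    have h4 := mul_le_mul_of_nonneg_left h3 hw0
    have h5 := mul_nonneg hw0 (norm_nonneg (S p))
    rw [add_zero]
    refine max_le ?_ (by linarith)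
    have h6 : |p.1| ≤ |p.1 - w ⬝ᵥ p.2| + |w ⬝ᵥ p.2| := by
      simpa using abs_add_le (p.1 - w ⬝ᵥ p.2) (w ⬝ᵥ p.2)
    rw [dotProduct_comm p.2 w] at h1
    rw [Real.norm_eq_abs]
    linarith
  have hgd : ExpDecay fun p => g (Ψ p) := by
    refine hg.comp hΨe.measurable (K := 1 + ‖w‖) (K' := |a| + ‖z‖ + |a| * ‖w‖) fun p => ?_
    have h1 : |a + p.1| ≤ ‖Ψ p‖ := hn1 (Ψ p)
    have h2 : ‖z + p.1 • w + p.2‖ ≤ ‖Ψ p‖ := hn2 (Ψ p)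
    have h3 : |p.1| ≤ |a + p.1| + |a| := by simpa using abs_sub (a + p.1) a
    have h4 : ‖p.2‖ ≤ ‖z + p.1 • w + p.2‖ + (‖z‖ + |p.1| * ‖w‖) := by
      have e : p.2 = (z + p.1 • w + p.2) - (z + p.1 • w) := by abel
      calc ‖p.2‖ = ‖(z + p.1 • w + p.2) - (z + p.1 • w)‖ := by rw [← e]
        _ ≤ _ := (norm_sub_le _ _).trans (add_le_add_right ((norm_add_le _ _).trans (by
          rw [norm_smul, Real.norm_eq_abs])) _)
    have h5 := mul_le_mul_of_nonneg_right (h3.trans (add_le_add_left h1 _)) (norm_nonneg w)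
    have h6 := mul_nonneg (norm_nonneg (Ψ p)) (norm_nonneg w)
    have h7 := mul_nonneg (abs_nonneg a) (norm_nonneg w)
    have h8 := abs_nonneg a
    refine max_le ?_ (by linarith)
    rw [Real.norm_eq_abs]
    linarith [norm_nonneg z]
  have hΨ2 : ∀ (i : Fin n) p, p.2 i * g (Ψ p) =
      (fun q : ℝ × (Fin n → ℝ) => q.2 i * g q - z i * g q - w i * ((q.1 - a) * g q)) (Ψ p) :=
    fun i p => by
    simp only [Ψ, Pi.add_apply, Pi.smul_apply, smul_eq_mul]
    ring
  have hbal : ∀ (i : Fin n) (T : Set (ℝ × (Fin n → ℝ))),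
      ∫ p in Ψ ⁻¹' T, p.2 i * g (Ψ p) = (∫ q in T, q.2 i * g q) - z i * (∫ q in T, g q) -
        w i * ∫ q in T, (q.1 - a) * g q := fun i T => by
    refine (integral_congr_ae (.of_forall (hΨ2 i))).trans
      ((hΨp.setIntegral_preimage_emb hΨe
        (fun q => q.2 i * g q - z i * g q - w i * ((q.1 - a) * g q)) T).trans ?_)
    rw [integral_sub, integral_sub, integral_const_mul,
      integral_const_mul]
    · exact (hi2 g hg i).integrableOn
    · exact (hgi.const_mul _).integrableOn
    · exact ((hi2 g hg i).sub (hgi.const_mul _)).integrableOn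
    · exact ((hi1 g hg a).const_mul _).integrableOn
  have hQ : Q₁ - Q₂ ≠ 0 := by linarith
  have key := santalo_of_balanced_halfSpaces IH hfd hgd (C := C) (fun x y => ?_) ?_
    (fun i => ?_) (fun i => ?_)
  · rw [integral_shear (h := h) w (hhd.integrable _) (hfd.integrable _),
      hΨp.integral_comp hΨe] at key
    refine le_trans (mul_le_mul_of_nonneg_right ?_ hg0.le) key
    have hi1' : Integrable fun p : ℝ × (Fin n → ℝ) => p.1 * f p := by
      simpa using hi1 f hf 0
    have hi12 : Integrable fun p : ℝ × (Fin n → ℝ) => f p + 2 * a * (p.1 * f p) :=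
      hfi.add (hi1'.const_mul (2 * a))
    have hsum : Integrable fun p : ℝ × (Fin n → ℝ) => ∑ i, (2 * z i) * (p.2 i * f p) :=
      integrable_finsetSum _ fun i _ => (hi2 f hf i).const_mul _
    have e : ∀ p : ℝ × (Fin n → ℝ), (1 + 2 * (p.1 * a + p.2 ⬝ᵥ z)) * f p =
          f p + (2 * a) * (p.1 * f p) + ∑ i, (2 * z i) * (p.2 i * f p) := fun p => by
        rw [dotProduct, add_mul, mul_add, add_mul, Finset.mul_sum, Finset.sum_mul]
        rw [one_mul, add_assoc]
        congr 2
        · ring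
        · exact Finset.sum_congr rfl fun i _ => by ring
    have hlin : ∫ p : ℝ × (Fin n → ℝ), (1 + 2 * (p.1 * a + p.2 ⬝ᵥ z)) * f p = ∫ p, f p := by
      simp_rw [e]
      rw [integral_add hi12 hsum, integral_add hfi (hi1'.const_mul _),
        integral_finsetSum _ fun i _ => (hi2 f hf i).const_mul _]
      simp [integral_const_mul, hbar₁, hbar₂]
    rw [← hlin]
    refine integral_mono ?_ (hhd.integrable _) fun p => ?_
    · simp_rw [e]
      exact hi12.add hsum
    · refine mul_le_mul_of_nonneg_right ?_ (hf.nonneg p)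
      linarith [Real.add_one_le_exp (2 * (p.1 * a + p.2 ⬝ᵥ z))]
  · calc h (S x) * g (Ψ y) = Real.exp (2 * ((S x).1 * a + (S x).2 ⬝ᵥ z)) * (f (S x) * g (Ψ y)) :=
          mul_assoc _ _ _
      _ ≤ Real.exp (2 * ((S x).1 * a + (S x).2 ⬝ᵥ z)) *
          (C * Real.exp (-2 * ((S x).1 * (Ψ y).1 + (S x).2 ⬝ᵥ (Ψ y).2))) :=
        mul_le_mul_of_nonneg_left (H _ _) (Real.exp_pos _).le
      _ = _ := by
        rw [mul_left_comm, ← Real.exp_add]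
        congr 2
        simp only [S, Ψ, dotProduct_add, dotProduct_smul, smul_eq_mul]
        rw [dotProduct_comm w x.2]
        ring
  · rw [hpU, hpL, hΨp.setIntegral_preimage_emb hΨe, hΨp.setIntegral_preimage_emb hΨe]
    exact ha
  · rw [hpU, hbal]
    simp only [z, ← hM, ← hQ₁]
    field_simp
    ring
  · rw [hpL, hbal, ← ha, ← hQ₂]
    have e1 : z i * M = (∫ q in U, q.2 i * g q) - Q₁ * w i := by
      simp only [z]; field_simp
    have e2 : w i * (Q₁ - Q₂) = (∫ q in U, q.2 i * g q) - ∫ q in L, q.2 i * g q := by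
      simp only [w]; field_simp
    linarith

end Shear

section FunctionalSantalo

open Set Module

theorem functionalSantalo_zero : FunctionalSantalo 0 := fun f g _ _ C H _ => by
  have h : ∀ φ : (Fin 0 → ℝ) → ℝ, ∫ x, φ x = φ 0 := fun φ => by
    rw [volume_pi, Measure.pi_of_empty _ 0, integral_dirac]
  rw [h, h]
  simpa using H 0 0

theorem FunctionalSantalo.succ {n : ℕ} (IH : FunctionalSantalo n) : FunctionalSantalo (n + 1) := by
  intro f g hf hg C H hbar
  set e := (MeasurableEquiv.piFinSuccAbove (fun _ : Fin (n + 1) => ℝ) 0).symm with he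
  have hep : MeasurePreserving e :=
    (volume_preserving_piFinSuccAbove (fun _ : Fin (n + 1) => ℝ) 0).symm
  have he0 : ∀ p : ℝ × (Fin n → ℝ), e p 0 = p.1 := fun p => by
    simp [e, MeasurableEquiv.piFinSuccAbove]
  have hes : ∀ (p : ℝ × (Fin n → ℝ)) i, e p (Fin.succ i) = p.2 i := fun p i => by
    simp [e, MeasurableEquiv.piFinSuccAbove]
  have hd : ∀ φ : (Fin (n + 1) → ℝ) → ℝ, ExpDecay φ → ExpDecay fun p => φ (e p) := fun φ hφ =>
    hφ.comp e.measurable (K := 1) (K' := 0) fun p => by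
      rw [one_mul, add_zero]
      refine max_le ?_ ((pi_norm_le_iff_of_nonneg (norm_nonneg _)).2 fun i => ?_)
      · rw [← he0 p]
        exact norm_le_pi_norm _ _
      · rw [← hes p]
        exact norm_le_pi_norm _ _
  have key := santalo_prod IH (hd f hf) (hd g hg) (C := C)
    (fun x y => (H _ _).trans_eq (by
      simp only [dotProduct, Fin.sum_univ_succ, he0, hes]))
    (by
      refine Eq.trans ?_ (hbar 0)
      rw [← hep.integral_comp']
      simp only [he0])
    (fun i => by
      refine Eq.trans ?_ (hbar i.succ)
      rw [← hep.integral_comp']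
      simp only [hes])
  rwa [hep.integral_comp', hep.integral_comp'] at key

/-- The functional Blaschke–Santaló inequality. -/
theorem functionalSantalo (n : ℕ) : FunctionalSantalo n := by
  induction n with
  | zero => exact functionalSantalo_zero
  | succ n ih => exact ih.succ

end FunctionalSantalo

section Conclusion

open Set Module

variable {n : ℕ}

theorem expDecay_exp_neg_sq {G : (Fin n → ℝ) → ℝ} (hG : Continuous G) {c : ℝ} (hc : 0 < c)
    (h : ∀ x, c * ‖x‖ ≤ G x) : ExpDecay fun x => Real.exp (-(G x) ^ 2) where
  measurable := (by fun_prop : Continuous fun x => Real.exp (-(G x) ^ 2)).measurable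
  nonneg x := (Real.exp_pos _).le
  bound a := by
    refine ⟨Real.exp (a ^ 2 / (4 * c ^ 2)), fun x => ?_⟩
    rw [← Real.exp_add, Real.exp_le_exp]
    have h1 : (c * ‖x‖) ^ 2 ≤ G x ^ 2 := pow_le_pow_left₀ (by positivity) (h x) 2
    have h2 : a ^ 2 / (4 * c ^ 2) + -a * ‖x‖ + (c * ‖x‖) ^ 2 = (a / (2 * c) - c * ‖x‖) ^ 2 := by
      field_simp
      ring
    nlinarith [sq_nonneg (a / (2 * c) - c * ‖x‖)]

theorem exists_mul_norm_le_gauge {K : Set (Fin n → ℝ)} (hb : Bornology.IsBounded K)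
    (h0 : K ∈ nhds 0) : ∃ c : ℝ, 0 < c ∧ ∀ x, c * ‖x‖ ≤ gauge K x := by
  obtain ⟨R, hR, hKR⟩ := hb.subset_ball_lt 0 0
  refine ⟨R⁻¹, inv_pos.2 hR, fun x => ?_⟩
  have := gauge_mono (absorbent_nhds_zero h0) hKR x
  rwa [gauge_ball hR.le, div_eq_inv_mul] at this

theorem integral_exp_neg_gauge_mul_le {K : Set (Fin n → ℝ)} (hc : Convex ℝ K)
    (h0 : K ∈ nhds 0) (hsym : ∀ x ∈ K, -x ∈ K) (hb : Bornology.IsBounded K) :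
    (∫ x, Real.exp (-(gauge K x) ^ 2)) * ∫ x, Real.exp (-(gauge (polarBody K) x) ^ 2) ≤
      Real.pi ^ n := by
  obtain ⟨c, hc0, hcK⟩ := exists_mul_norm_le_gauge hb h0
  obtain ⟨c', hc0', hcP⟩ := exists_mul_norm_le_gauge (isBounded_polarBody h0)
    (polarBody_mem_nhds_zero hb)
  have hG := isNormFunction_gauge hc h0 hsym hb
  have hP := isNormFunction_gauge (convex_polarBody K) (polarBody_mem_nhds_zero hb)
    (neg_mem_polarBody hsym) (isBounded_polarBody h0)
  have := functionalSantalo n _ _ (expDecay_exp_neg_sq hG.continuous hc0 hcK)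
    (expDecay_exp_neg_sq hP.continuous hc0' hcP) 1 (fun x y => ?_) (fun i => ?_)
  · rwa [one_mul] at this
  · rw [← Real.exp_add, one_mul, Real.exp_le_exp]
    have h1 := sum_mul_le_gauge_mul_gauge h0 hb x y
    have h2 := two_mul_le_add_sq (gauge K x) (gauge (polarBody K) y)
    rw [dotProduct]
    linarith
  · have h := integral_neg_eq_self (fun x => x i * Real.exp (-(gauge K x) ^ 2)) volume
    simp only [hG.map_neg, Pi.neg_apply, neg_mul, integral_neg] at h
    linarith

theorem integral_exp_neg_sum_sq :
    ∫ x : Fin n → ℝ, Real.exp (-∑ i, x i ^ 2) = √Real.pi ^ n := by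
  have := integral_fintype_prod_volume_eq_pow (ι := Fin n) (fun t : ℝ => Real.exp (-1 * t ^ 2))
  rw [integral_gaussian, Fintype.card_fin, div_one] at this
  simpa [← Real.exp_sum] using this

theorem isNormFunction_sqrt_sum_sq :
    IsNormFunction fun x : Fin n → ℝ => √(∑ i, x i ^ 2) := by
  have e : ∀ x : Fin n → ℝ, √(∑ i, x i ^ 2) = ‖WithLp.toLp 2 x‖ := fun x => by
    simp [EuclideanSpace.norm_eq]
  simp only [e]
  exact {
    continuous := by fun_prop
    nonneg := fun _ => norm_nonneg _
    map_smul := fun r x => by rw [WithLp.toLp_smul, norm_smul, Real.norm_eq_abs]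
    add_le := fun x y => by rw [WithLp.toLp_add]; exact norm_add_le _ _
    eq_zero := fun hx => by simpa using hx }

theorem pi_pow_le_volume_ball_mul_gamma_sq :
    Real.pi ^ n ≤ ((volume {x : Fin n → ℝ | ∑ i, x i ^ 2 ≤ 1}).toReal *
      Real.Gamma ((n : ℝ) / 2 + 1)) ^ 2 := by
  have h := (isNormFunction_sqrt_sum_sq (n := n)).toReal_measure_lt_one volume
  have hs : ∀ x : Fin n → ℝ, √(∑ i, x i ^ 2) ^ 2 = ∑ i, x i ^ 2 := fun x =>
    Real.sq_sqrt (Finset.sum_nonneg fun _ _ => sq_nonneg _)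
  simp only [hs, integral_exp_neg_sum_sq, finrank_fin_fun] at h
  have hΓ : 0 < Real.Gamma ((n : ℝ) / 2 + 1) := Real.Gamma_pos_of_pos (by positivity)
  have hfin : volume {x : Fin n → ℝ | ∑ i, x i ^ 2 ≤ 1} ≠ ⊤ := by
    refine (lt_of_le_of_lt (measure_mono fun x hx => ?_)
      (measure_closedBall_lt_top (x := (0 : Fin n → ℝ)) (r := 1))).ne
    rw [mem_closedBall_zero_iff, pi_norm_le_iff_of_nonneg zero_le_one]
    intro i
    have := (Finset.single_le_sum (f := fun i => x i ^ 2) (fun i _ => sq_nonneg _)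
      (Finset.mem_univ i)).trans hx
    exact (sq_le_one_iff_abs_le_one _).1 this
  have hle : (volume {x : Fin n → ℝ | √(∑ i, x i ^ 2) < 1}).toReal ≤
      (volume {x : Fin n → ℝ | ∑ i, x i ^ 2 ≤ 1}).toReal :=
    ENNReal.toReal_mono hfin (measure_mono fun x hx =>
      Real.sqrt_le_one.1 (le_of_lt hx))
  calc Real.pi ^ n = (√Real.pi ^ n) ^ 2 := by
        rw [← pow_mul, mul_comm, pow_mul, Real.sq_sqrt Real.pi_pos.le]
    _ ≤ _ := by
        rw [← h]
        exact pow_le_pow_left₀ (by positivity) (mul_le_mul_of_nonneg_right hle hΓ.le) 2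

theorem volume_mul_volume_polarBody_le {K : Set (Fin n → ℝ)} (hc : Convex ℝ K)
    (h0 : K ∈ nhds 0) (hsym : ∀ x ∈ K, -x ∈ K) (hb : Bornology.IsBounded K) :
    (volume K).toReal * (volume (polarBody K)).toReal ≤
      (volume {x : Fin n → ℝ | ∑ i, x i ^ 2 ≤ 1}).toReal ^ 2 := by
  have hP0 := polarBody_mem_nhds_zero hb
  have hPc := convex_polarBody K
  have h1 := (isNormFunction_gauge hc h0 hsym hb).toReal_measure_lt_one volume
  have h2 := (isNormFunction_gauge hPc hP0 (neg_mem_polarBody hsym)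
    (isBounded_polarBody h0)).toReal_measure_lt_one volume
  rw [← volume_eq_volume_gauge_lt_one volume hc h0, finrank_fin_fun] at h1
  rw [← volume_eq_volume_gauge_lt_one volume hPc hP0, finrank_fin_fun] at h2
  have hΓ : 0 < Real.Gamma ((n : ℝ) / 2 + 1) := Real.Gamma_pos_of_pos (by positivity)
  have key := (integral_exp_neg_gauge_mul_le hc h0 hsym hb).trans
    (pi_pow_le_volume_ball_mul_gamma_sq (n := n))
  rw [← h1, ← h2, mul_pow] at key
  refine le_of_mul_le_mul_right (le_trans (le_of_eq ?_) key) (pow_pos hΓ 2)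
  ring

end Conclusion

/-- Kuperberg; Blaschke–Santaló: For an `o`-symmetric convex
body `K ⊆ ℝⁿ` with `dim K = n`,
`πⁿ/n! ≤ vol K · vol K* ≤ ωₙ²`, where `ωₙ` is the volume of the Euclidean
unit ball in `ℝⁿ`. -/
theorem stmt_13 (n : ℕ) (K : Set (Fin n → ℝ)) (hKconv : Convex ℝ K)
    (hKcomp : IsCompact K) (hKsym : K = -K) (hKdim : (interior K).Nonempty) :
    Real.pi ^ n / (n.factorial : ℝ) ≤ (volume K).toReal * (volume (polarBody K)).toReal ∧
      (volume K).toReal * (volume (polarBody K)).toReal ≤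
        ((volume {x : Fin n → ℝ | (∑ i, (x i) ^ 2) ≤ 1}).toReal) ^ 2 := by
  have h0 := mem_nhds_zero_of_symmetric hKconv hKsym hKdim
  have hb := hKcomp.isBounded
  have hsym : ∀ x ∈ K, -x ∈ K := fun x hx => by
    rw [hKsym] at hx
    exact hx
  exact ⟨pi_pow_div_factorial_le_volume_mul_volume hKconv h0 hsym hb,
    volume_mul_volume_polarBody_le hKconv h0 hsym hb⟩
end

section
/- Let K ⊂ ℝⁿ be an o-symmetric convex body with dim K = n and let Λ ⊂ ℝⁿ be a full-rank lattice. Then for every 1 ≤ i ≤ n, 1 ≤ λ_i(K,Λ) · λ_{n+1-i}(K*, Λ*) ≤ n!. -/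
open MeasureTheory Pointwise

/-- The lattice `Bℤⁿ ⊆ ℝⁿ` generated by the (invertible) matrix `B`. -/
def latticeOf {n : ℕ} (B : Matrix (Fin n) (Fin n) ℝ) : Set (Fin n → ℝ) :=
  {x | ∃ z : Fin n → ℤ, x = B.mulVec (fun i => (z i : ℝ))}

/-- The `j`-th successive minimum of a set `K ⊆ ℝⁿ` with respect to a set of
lattice points `Λ ⊆ ℝⁿ`: the infimum of all `λ > 0` such that `λ • K` contains
at least `j` linearly independent points of `Λ`. -/
noncomputable def succMin {n : ℕ} (K Λ : Set (Fin n → ℝ)) (j : ℕ) : ℝ :=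
  sInf {lam : ℝ | 0 < lam ∧ ∃ v : Fin j → (Fin n → ℝ),
    LinearIndependent ℝ v ∧ ∀ k, v k ∈ Λ ∧ v k ∈ lam • K}

/-- The polar lattice `Λ* = {y : ⟨x, y⟩ ∈ ℤ for all x ∈ Λ}`. -/
def polarLattice {n : ℕ} (Λ : Set (Fin n → ℝ)) : Set (Fin n → ℝ) :=
  {y | ∀ x ∈ Λ, ∃ k : ℤ, (∑ i, x i * y i) = (k : ℝ)}

/-- A projection along `V` together with the map scaling `V` by `θ` and fixing a complement. -/
theorem exists_projection_scaling {n : ℕ} (V : Submodule ℝ (Fin n → ℝ)) (θ : ℝ) :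
    ∃ P D : (Fin n → ℝ) →ₗ[ℝ] (Fin n → ℝ), (∀ x, x - P x ∈ V) ∧ (∀ x ∈ V, P x = 0) ∧
      (∀ x, D x = θ • x + (1 - θ) • P x) ∧ LinearMap.det D = θ ^ Module.finrank ℝ V := by
  obtain ⟨W, hW⟩ := V.exists_isCompl
  let e := Submodule.prodEquivOfIsCompl V W hW
  let P : (Fin n → ℝ) →ₗ[ℝ] (Fin n → ℝ) :=
    e.toLinearMap ∘ₗ (LinearMap.prodMap 0 LinearMap.id) ∘ₗ e.symm.toLinearMap
  let D : (Fin n → ℝ) →ₗ[ℝ] (Fin n → ℝ) :=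
    e.toLinearMap ∘ₗ (LinearMap.prodMap (θ • LinearMap.id) LinearMap.id) ∘ₗ e.symm.toLinearMap
  have hP : ∀ y, P (e y) = y.2 := fun y => by simp [P, e]
  have hD : ∀ y, D (e y) = θ • (y.1 : Fin n → ℝ) + y.2 := fun y => by simp [D, e]
  have he : ∀ y, e y = (y.1 : Fin n → ℝ) + y.2 := fun y => by simp [e]
  refine ⟨P, D, fun x => ?_, fun x hx => ?_, fun x => ?_, ?_⟩
  · obtain ⟨y, rfl⟩ := e.surjective x
    rw [hP, he]
    simp
  · have := hP (⟨x, hx⟩, 0)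
    rw [he] at this
    simpa using this
  · obtain ⟨y, rfl⟩ := e.surjective x
    rw [hP, hD, he]
    module
  · have := LinearMap.det_conj (LinearMap.prodMap (θ • LinearMap.id) LinearMap.id) e
    simp only [D]
    rw [this, LinearMap.det_prodMap]
    simp

/-- A measurable subset of an open convex set can be contracted by the factor `θ` along the
cosets of a subspace without leaving the convex set. -/
theorem exists_squeeze {n : ℕ} {U A : Set (Fin n → ℝ)} (hUo : IsOpen U) (hUc : Convex ℝ U)
    (hAU : A ⊆ U) (hA : MeasurableSet A) (V : Submodule ℝ (Fin n → ℝ)) {θ : ℝ} (hθ0 : 0 < θ)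
    (hθ1 : θ ≤ 1) :
    ∃ A' ⊆ U, MeasurableSet A' ∧
      volume A' = ENNReal.ofReal (θ ^ Module.finrank ℝ V) * volume A ∧
      ∀ x ∈ A', ∀ y ∈ A', x - y ∈ V → ∃ x' ∈ A, ∃ y' ∈ A, x - y = θ • (x' - y') := by
  obtain ⟨P, D, hPV, hP0, hD, hdet⟩ := exists_projection_scaling V θ
  have hPc : Continuous P := P.continuous_of_finiteDimensional
  have hDc : Continuous D := D.continuous_of_finiteDimensional
  have hPP : ∀ x, P (P x) = P x := fun x => by
    have := hP0 _ (hPV x)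
    rw [map_sub, sub_eq_zero] at this
    exact this.symm
  let q : ℕ → V := TopologicalSpace.denseSeq V
  let O : ℕ → Set (Fin n → ℝ) := fun m => {x | P x + q m ∈ U}
  have hO : ∀ m, MeasurableSet (O m) := fun m =>
    (hUo.preimage (hPc.add continuous_const)).measurableSet
  let S : ℕ → Set (Fin n → ℝ) := disjointed O
  have hS : ∀ m, MeasurableSet (S m) := fun m => MeasurableSet.disjointed hO m
  have hSO : ∀ m, S m ⊆ O m := fun m => disjointed_subset O m
  have hSd : Pairwise (Function.onFun Disjoint S) := disjoint_disjointed O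
  have hSP : ∀ m x y, P x = P y → x ∈ S m → y ∈ S m := by
    intro m x y hxy hx
    simp only [S, disjointed_apply, Set.mem_sdiff, Finset.sup_eq_iSup,
      Set.iSup_eq_iUnion, Set.mem_iUnion, O, Set.mem_ofPred_eq] at hx ⊢
    simpa only [hxy] using hx
  have hcover : ∀ x ∈ U, ∃ m, x ∈ S m := by
    intro x hx
    have hopen : IsOpen {v : V | P x + v ∈ U} :=
      hUo.preimage (continuous_const.add continuous_subtype_val)
    have hne : {v : V | P x + v ∈ U}.Nonempty := ⟨⟨x - P x, hPV x⟩, by simpa using hx⟩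
    obtain ⟨m, hm⟩ := (TopologicalSpace.denseRange_denseSeq V).exists_mem_open hopen hne
    have : x ∈ ⋃ m, S m := by
      rw [iUnion_disjointed]
      exact Set.mem_iUnion.2 ⟨m, hm⟩
    exact Set.mem_iUnion.1 this
  let T : ℕ → (Fin n → ℝ) → (Fin n → ℝ) := fun m x => D x + (1 - θ) • (q m : Fin n → ℝ)
  have hPT : ∀ m x, P (T m x) = P x := fun m x => by
    simp only [T, hD, map_add, map_smul, hPP, hP0 _ (q m).2]
    module
  have hTS : ∀ m x, x ∈ S m → T m x ∈ S m := fun m x hx => hSP m _ _ (hPT m x).symm hx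
  have hDinj : Function.Injective D := by
    have hdet0 : LinearMap.det D ≠ 0 := by rw [hdet]; positivity
    exact (LinearMap.equivOfDetNeZero D hdet0).injective
  have hTinj : ∀ m, Function.Injective (T m) := fun m x y hxy => hDinj (add_right_cancel hxy)
  have hTc : ∀ m, Continuous (T m) := fun m => hDc.add continuous_const
  have hBm : ∀ m, MeasurableSet (T m '' (A ∩ S m)) := fun m =>
    (hA.inter (hS m)).image_of_continuousOn_injOn (hTc m).continuousOn (hTinj m).injOn
  have hBvol : ∀ m, volume (T m '' (A ∩ S m)) =
      ENNReal.ofReal (θ ^ Module.finrank ℝ V) * volume (A ∩ S m) := by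
    intro m
    have : T m '' (A ∩ S m) =
        (fun y => y + (1 - θ) • (q m : Fin n → ℝ)) '' (D '' (A ∩ S m)) := by
      rw [Set.image_image]
    rw [this, Set.image_add_right, measure_preimage_add_right, Measure.addHaar_image_linearMap,
      hdet, abs_of_pos (by positivity)]
  refine ⟨⋃ m, T m '' (A ∩ S m), ?_, MeasurableSet.iUnion hBm, ?_, ?_⟩
  · refine Set.iUnion_subset fun m => ?_
    rintro _ ⟨x, ⟨hxA, hxS⟩, rfl⟩
    have h1 : P x + q m ∈ U := hSO m hxS
    have := hUc (hAU hxA) h1 hθ0.le (sub_nonneg.2 hθ1) (by ring)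
    convert this using 1
    simp only [T, hD]
    module
  · rw [measure_iUnion _ hBm]
    · simp_rw [hBvol]
      rw [ENNReal.tsum_mul_left, ← measure_iUnion _ fun m => hA.inter (hS m), ← Set.inter_iUnion,
        Set.inter_eq_left.2]
      · exact fun x hx => Set.mem_iUnion.2 (hcover x (hAU hx))
      · exact fun i j hij => (hSd hij).mono Set.inter_subset_right Set.inter_subset_right
    · intro i j hij
      refine (hSd hij).mono ?_ ?_ <;>
      · rintro _ ⟨x, hx, rfl⟩
        exact hTS _ x hx.2
  · intro x hx y hy hxy
    obtain ⟨m, a, ⟨haA, haS⟩, rfl⟩ := Set.mem_iUnion.1 hx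
    obtain ⟨l, b, ⟨hbA, hbS⟩, rfl⟩ := Set.mem_iUnion.1 hy
    have hPab : P a = P b := by
      have := hP0 _ hxy
      rwa [map_sub, hPT, hPT, sub_eq_zero] at this
    have hml : m = l := by
      by_contra hne
      exact Set.disjoint_left.1 (hSd hne) (hSP m a b hPab haS) hbS
    subst hml
    refine ⟨a, haA, b, hbA, ?_⟩
    simp only [T, hD, hPab]
    module

/-- Successive squeezing of an open convex set along a flag of subspaces. -/
theorem exists_squeeze_flag {n : ℕ} {U : Set (Fin n → ℝ)} (hUo : IsOpen U) (hUc : Convex ℝ U)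
    {V : ℕ → Submodule ℝ (Fin n → ℝ)} (hV : Monotone V)
    (hVr : ∀ j ≤ n, Module.finrank ℝ (V j) = j) {ℓ : ℕ → ℝ} (hℓ0 : ∀ j < n, 0 < ℓ j)
    (hℓ : ∀ j, j + 1 < n → ℓ j ≤ ℓ (j + 1)) (k : ℕ) (hk : k < n) :
    ∃ A ⊆ U, MeasurableSet A ∧
      ENNReal.ofReal (ℓ k ^ k) * volume A =
        ENNReal.ofReal (∏ j ∈ Finset.range k, ℓ j) * volume U ∧
      ∀ j ≤ k, ∀ x ∈ A, ∀ y ∈ A, x - y ∈ V (j + 1) →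
        ∃ x' ∈ U, ∃ y' ∈ U, ℓ k • (x - y) = ℓ j • (x' - y') := by
  induction k with
  | zero =>
    refine ⟨U, subset_rfl, hUo.measurableSet, by simp, fun j hj x hx y hy _ => ⟨x, hx, y, hy, ?_⟩⟩
    rw [Nat.le_zero.1 hj]
  | succ k ih =>
    obtain ⟨A, hAU, hA, hvol, hdiff⟩ := ih (by omega)
    have h0 := hℓ0 k (by omega)
    have h1 := hℓ0 (k + 1) hk
    obtain ⟨A', hA'U, hA', hvol', hdiff'⟩ := exists_squeeze hUo hUc hAU hA (V (k + 1))
      (div_pos h0 h1) ((div_le_one h1).2 (hℓ k hk))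
    refine ⟨A', hA'U, hA', ?_, fun j hj x hx y hy hxy => ?_⟩
    · rw [hvol', hVr _ hk.le, ← mul_assoc, ← ENNReal.ofReal_mul (by positivity), ← mul_pow,
        mul_div_cancel₀ _ h1.ne', pow_succ, mul_comm _ (ℓ k), ENNReal.ofReal_mul h0.le, mul_assoc,
        hvol, ← mul_assoc, ← ENNReal.ofReal_mul h0.le, Finset.prod_range_succ, mul_comm (ℓ k)]
    · rcases Nat.le_succ_iff.1 hj with hj' | rfl
      · obtain ⟨a, ha, b, hb, hab⟩ := hdiff' x hx y hy (hV (by omega) hxy)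
        have hab' : a - b ∈ V (j + 1) := by
          rw [hab] at hxy
          exact ((V (j + 1)).smul_mem_iff (div_pos h0 h1).ne').1 hxy
        obtain ⟨x', hx', y', hy', h⟩ := hdiff j hj' a ha b hb hab'
        refine ⟨x', hx', y', hy', ?_⟩
        rw [hab, smul_smul, mul_div_cancel₀ _ h1.ne', h]
      · exact ⟨x, hA'U hx, y, hA'U hy, rfl⟩

theorem exists_basis_latticeOf {n : ℕ} {B : Matrix (Fin n) (Fin n) ℝ} (hB : B.det ≠ 0) :
    ∃ b : Module.Basis (Fin n) ℝ (Fin n → ℝ), (∀ i j, b j i = B i j) ∧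
      ∀ x, x ∈ latticeOf B ↔ x ∈ Submodule.span ℤ (Set.range b) := by
  have hli : LinearIndependent ℝ B.col :=
    Matrix.linearIndependent_cols_iff_isUnit.2
      ((Matrix.isUnit_iff_isUnit_det B).2 (isUnit_iff_ne_zero.2 hB))
  let b := Module.Basis.mk hli (hli.span_eq_top_of_card_eq_finrank' (by simp)).ge
  have hb : ∀ i j, b j i = B i j := fun i j => by simp [b]
  refine ⟨b, hb, fun x => ?_⟩
  rw [Submodule.mem_span_range_iff_exists_fun]
  have key : ∀ z : Fin n → ℤ, ∑ i, z i • b i = B.mulVec fun i => (z i : ℝ) := by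
    intro z
    ext i
    simp [Matrix.mulVec, dotProduct, hb, mul_comm]
  simp only [key, latticeOf, Set.mem_ofPred_eq]
  exact exists_congr fun z => eq_comm

/-- Minkowski's second theorem (upper bound): if the lattice points outside the `j`-th member of a
full flag have norm at least `ℓ j`, then `∏ ℓ j` times the volume of the unit ball is at most
`2 ^ n` times the covolume. -/
theorem prod_mul_volume_ball_le {n : ℕ} {B : Matrix (Fin n) (Fin n) ℝ} (hB : B.det ≠ 0)
    (p : Seminorm ℝ (Fin n → ℝ)) (hp : Continuous p)
    {V : ℕ → Submodule ℝ (Fin n → ℝ)} (hV : Monotone V)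
    (hVr : ∀ j ≤ n, Module.finrank ℝ (V j) = j) {ℓ : ℕ → ℝ} (hℓ0 : ∀ j < n, 0 < ℓ j)
    (hℓ : ∀ j, j + 1 < n → ℓ j ≤ ℓ (j + 1))
    (hmin : ∀ j < n, ∀ x ∈ latticeOf B, x ∉ V j → ℓ j ≤ p x) :
    ENNReal.ofReal (∏ j ∈ Finset.range n, ℓ j) * volume (p.ball 0 1) ≤
      ENNReal.ofReal (2 ^ n * |B.det|) := by
  obtain ⟨b, hb, hmem⟩ := exists_basis_latticeOf hB
  have hfund : volume (ZSpan.fundamentalDomain b) = ENNReal.ofReal |B.det| := by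
    rw [ZSpan.volume_fundamentalDomain, ← Matrix.det_transpose]
    congr 3
    ext i j
    exact hb i j
  have hUo : IsOpen (p.ball 0 1) := by
    rw [Seminorm.ball_zero_eq]
    exact isOpen_lt hp continuous_const
  rcases n with _ | k
  · simpa [hfund] using measure_mono (μ := volume) (show p.ball 0 1 ⊆ ZSpan.fundamentalDomain b from
      fun x _ i => i.elim0)
  obtain ⟨A, hAU, hA, hvol, hdiff⟩ := exists_squeeze_flag hUo (p.convex_ball 0 1) hV hVr hℓ0 hℓ k
    (Nat.lt_succ_self k)
  have hk0 := hℓ0 k (Nat.lt_succ_self k)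
  by_contra! hlt
  have hvolS : volume (ZSpan.fundamentalDomain b) < volume ((ℓ k / 2) • A) := by
    rw [Measure.addHaar_smul_of_nonneg _ (by positivity), Module.finrank_fin_fun, hfund]
    rw [Finset.prod_range_succ, mul_comm _ (ℓ k), ENNReal.ofReal_mul hk0.le, mul_assoc, ← hvol,
      ← mul_assoc, ← ENNReal.ofReal_mul hk0.le, ← pow_succ',
      ENNReal.ofReal_mul (by positivity)] at hlt
    rw [div_pow, div_eq_inv_mul, ENNReal.ofReal_mul (by positivity), mul_assoc]
    have h2 : ENNReal.ofReal ((2 ^ (k + 1))⁻¹ : ℝ) * ENNReal.ofReal (2 ^ (k + 1)) = 1 := by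
      rw [← ENNReal.ofReal_mul (by positivity), inv_mul_cancel₀ (by positivity), ENNReal.ofReal_one]
    calc ENNReal.ofReal |B.det|
        = ENNReal.ofReal ((2 ^ (k + 1))⁻¹ : ℝ) *
            (ENNReal.ofReal (2 ^ (k + 1)) * ENNReal.ofReal |B.det|) := by
          rw [← mul_assoc, h2, one_mul]
      _ < _ := by
          refine ENNReal.mul_lt_mul_right ?_ ENNReal.ofReal_ne_top hlt
          rw [Ne, ENNReal.ofReal_eq_zero, not_le]
          positivity
  have : Countable (Submodule.span ℤ (Set.range b)).toAddSubgroup :=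
    inferInstanceAs (Countable (Submodule.span ℤ (Set.range b)))
  obtain ⟨u, v, huv, hnd⟩ := exists_pair_mem_lattice_not_disjoint_vadd
    (ZSpan.isAddFundamentalDomain' b volume)
    (hA.const_smul₀ (ℓ k / 2)).nullMeasurableSet hvolS
  obtain ⟨w, hw1, hw2⟩ := Set.not_disjoint_iff.1 hnd
  obtain ⟨_, ⟨x, hx, rfl⟩, hxw⟩ := hw1
  obtain ⟨_, ⟨y, hy, rfl⟩, hyw⟩ := hw2
  simp only [AddSubgroup.vadd_def, vadd_eq_add] at hxw hyw
  set g : Fin (k + 1) → ℝ := (v : Fin (k + 1) → ℝ) - u with hg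
  have hgΛ : g ∈ latticeOf B := (hmem g).2 (sub_mem v.2 u.2)
  have hg0 : g ≠ 0 := fun h => huv (Subtype.ext (sub_eq_zero.1 h).symm)
  have hgxy : g = (ℓ k / 2) • (x - y) := by
    rw [hg, smul_sub, sub_eq_sub_iff_add_eq_add, hyw, ← hxw,
      add_comm (u : Fin (k + 1) → ℝ)]
  have hVtop : V (k + 1) = ⊤ := Submodule.eq_top_of_finrank_eq (by simp [hVr])
  have hex : ∃ j, g ∈ V j := ⟨k + 1, hVtop ▸ Submodule.mem_top⟩
  classical
  obtain ⟨j, hj⟩ : ∃ j, Nat.find hex = j + 1 := Nat.exists_eq_succ_of_ne_zero fun h0 => by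
    have h1 := Nat.find_spec hex
    rw [h0, Submodule.finrank_eq_zero.1 (hVr 0 (Nat.zero_le _))] at h1
    exact hg0 (by simpa using h1)
  have hjk : j ≤ k := by
    have := Nat.find_min' hex (show g ∈ V (k + 1) from hVtop ▸ Submodule.mem_top)
    omega
  have hgj : g ∈ V (j + 1) := hj ▸ Nat.find_spec hex
  have hgj' : g ∉ V j := Nat.find_min hex (by omega)
  have hxyV : x - y ∈ V (j + 1) := by
    rw [hgxy] at hgj
    exact ((V (j + 1)).smul_mem_iff (by positivity)).1 hgj
  obtain ⟨x', hx', y', hy', h⟩ := hdiff j hjk x hx y hy hxyV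
  have hj0 := hℓ0 j (by omega)
  have hgx : g = (ℓ j / 2) • (x' - y') := by
    rw [hgxy, div_eq_inv_mul, mul_smul, h, smul_smul, div_eq_inv_mul]
  have h1 := hmin j (by omega) g hgΛ hgj'
  rw [Seminorm.mem_ball_zero] at hx' hy'
  have h2 : p (x' - y') < 2 := (map_sub_le_add p x' y').trans_lt (by linarith)
  rw [hgx, map_smul_eq_mul, Real.norm_of_nonneg (by positivity)] at h1
  nlinarith

/-- The volume of the unit ball of a seminorm is at least that of an inscribed cross-polytope. -/
theorem volume_crossPolytope_le {n : ℕ} (p : Seminorm ℝ (Fin n → ℝ))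
    (C : Matrix (Fin n) (Fin n) ℝ) (hC : ∀ j, p (C.col j) ≤ 1) :
    ENNReal.ofReal (|C.det| * (2 ^ n / n.factorial)) ≤ volume (p.ball 0 1) := by
  rcases n with _ | n
  · have : p.ball 0 1 = Set.univ := Set.eq_univ_of_forall fun x => by
      rw [Seminorm.mem_ball_zero, Subsingleton.elim x 0, map_zero]
      exact one_pos
    rw [this, volume_pi]
    simp
  have hvol := volume_sum_rpow_lt_one (Fin (n + 1)) (p := 1) le_rfl
  simp only [Real.rpow_one, div_one, Fintype.card_fin, one_add_one_eq_two, Real.Gamma_two, mul_one,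
    Real.Gamma_nat_eq_factorial] at hvol
  rw [ENNReal.ofReal_mul (abs_nonneg _), ← hvol, ← LinearMap.det_toLin' C,
    ← Measure.addHaar_image_linearMap]
  refine measure_mono ?_
  rintro _ ⟨t, ht, rfl⟩
  rw [Seminorm.mem_ball_zero]
  have : Matrix.toLin' C t = ∑ j, t j • C.col j := by
    ext i
    simp [Matrix.mulVec, dotProduct, mul_comm]
  rw [this]
  calc p (∑ j, t j • C.col j) ≤ ∑ j, p (t j • C.col j) := Finset.le_sum_of_subadditive p (map_zero p).le
        (map_add_le_add p) _ _
    _ ≤ ∑ j, |t j| := Finset.sum_le_sum fun j _ => by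
        rw [map_smul_eq_mul, Real.norm_eq_abs]
        exact mul_le_of_le_one_right (abs_nonneg _) (hC j)
    _ < 1 := ht

/-- Lattice points chosen greedily with respect to a seminorm, with the flag they span. -/
theorem exists_greedy_flag {n : ℕ} {Λ : Set (Fin n → ℝ)} (p : Seminorm ℝ (Fin n → ℝ))
    (hfin : ∀ r, {x ∈ Λ | p x ≤ r}.Finite) (hspan : Submodule.span ℝ Λ = ⊤) :
    ∃ (a : ℕ → Fin n → ℝ) (V : ℕ → Submodule ℝ (Fin n → ℝ)),
      (∀ k, V k = Submodule.span ℝ (a '' Set.Iio k)) ∧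
      (∀ k ≤ n, Module.finrank ℝ (V k) = k) ∧
      ∀ j < n, a j ∈ Λ ∧ a j ∉ V j ∧ ∀ x ∈ Λ, x ∉ V j → p (a j) ≤ p x := by
  have hex : ∀ W : Submodule ℝ (Fin n → ℝ), ∃ v, W ≠ ⊤ →
      v ∈ Λ ∧ v ∉ W ∧ ∀ x ∈ Λ, x ∉ W → p v ≤ p x := by
    intro W
    by_cases hW : W = ⊤
    · exact ⟨0, fun h => (h hW).elim⟩
    obtain ⟨x, hxΛ, hxW⟩ : ∃ x ∈ Λ, x ∉ W := by
      by_contra! h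
      exact hW (top_le_iff.1 (hspan ▸ Submodule.span_le.2 h))
    obtain ⟨v, ⟨⟨hvΛ, hvx⟩, hvW⟩, hv⟩ := Set.exists_min_image ({y ∈ Λ | p y ≤ p x} ∩ {y | y ∉ W}) p
      ((hfin (p x)).inter_of_left _) ⟨x, ⟨hxΛ, le_rfl⟩, hxW⟩
    refine ⟨v, fun _ => ⟨hvΛ, hvW, fun y hyΛ hyW => ?_⟩⟩
    by_cases hyx : p y ≤ p x
    · exact hv y ⟨⟨hyΛ, hyx⟩, hyW⟩
    · exact hvx.trans (le_of_not_ge hyx)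
  choose f hf using hex
  obtain ⟨V, hV0, hVs⟩ : ∃ V : ℕ → Submodule ℝ (Fin n → ℝ), V 0 = ⊥ ∧
      ∀ k, V (k + 1) = V k ⊔ Submodule.span ℝ {f (V k)} :=
    ⟨fun k => Nat.rec ⊥ (fun _ W => W ⊔ Submodule.span ℝ {f W}) k, rfl, fun _ => rfl⟩
  have hne : ∀ k < n, Module.finrank ℝ ↥(V k) = k → V k ≠ ⊤ := fun k hk h1 h2 => by
    rw [h2, finrank_top, Module.finrank_fin_fun] at h1
    omega
  have hrank : ∀ k ≤ n, Module.finrank ℝ ↥(V k) = k := by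
    intro k
    induction k with
    | zero => simp [hV0]
    | succ k ih =>
      intro hk
      have h := ih (by omega)
      rw [hVs, Submodule.finrank_sup_span_singleton (hf _ (hne k hk h)).2.1, h]
  refine ⟨fun k => f (V k), V, fun k => ?_, hrank, fun j hj => hf _ (hne j hj (hrank j hj.le))⟩
  induction k with
  | zero => simp [hV0]
  | succ k ih =>
    rw [hVs, ih, ← Submodule.span_union]
    congr 1
    rw [← ih]
    ext x
    simp only [Set.mem_union, Set.mem_image, Set.mem_Iio, Set.mem_singleton_iff, Nat.lt_succ_iff_lt_or_eq]
    grind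

/-- The norm with a given symmetric convex body as closed unit ball. -/
theorem exists_seminorm_of_convexBody {n : ℕ} {K : Set (Fin n → ℝ)} (hKconv : Convex ℝ K)
    (hKcomp : IsCompact K) (hKsym : K = -K) (hKdim : (interior K).Nonempty) :
    ∃ p : Seminorm ℝ (Fin n → ℝ), Continuous p ∧ (∀ x, x ∈ K ↔ p x ≤ 1) ∧
      ∀ x, x ≠ 0 → 0 < p x := by
  have hneg : ∀ ⦃x⦄, x ∈ K → -x ∈ K := fun x hx => by
    rw [hKsym, Set.mem_neg, neg_neg]
    exact hx
  have h0 : K ∈ nhds 0 := by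
    rw [← mem_interior_iff_mem_nhds]
    obtain ⟨x, hx⟩ := hKdim
    have hx' : -x ∈ interior K := by
      rw [hKsym, ← Set.neg_mem_neg] at hx
      have : interior (-K) = -interior K := ((Homeomorph.neg (Fin n → ℝ)).preimage_interior K).symm
      rwa [this, neg_neg] at hx
    have := hKconv.interior hx hx' (a := 1 / 2) (b := 1 / 2) (by norm_num) (by norm_num)
      (by norm_num)
    simpa using this
  have habs : Absorbent ℝ K := absorbent_nhds_zero h0
  refine ⟨gaugeSeminorm ((balanced_iff_neg_mem hKconv).2 hneg) hKconv habs,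
    continuous_gauge hKconv h0, fun x => ?_, fun x hx => ?_⟩
  · change x ∈ K ↔ gauge K x ≤ 1
    rw [gauge_le_one_iff_mem_closure hKconv h0, hKcomp.isClosed.closure_eq]
  · exact (gauge_pos habs (NormedSpace.isVonNBounded_of_isBounded ℝ hKcomp.isBounded)).2 hx

/-- A determinant bound obtained by comparing Minkowski's second theorem with the volume of an
inscribed cross-polytope. -/
theorem prod_mul_abs_det_le {n : ℕ} {d π : ℝ} (hπ : 0 ≤ π) (hd : 0 ≤ d)
    (p : Seminorm ℝ (Fin n → ℝ))
    (h : ENNReal.ofReal π * volume (p.ball 0 1) ≤ ENNReal.ofReal (2 ^ n * d))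
    (C : Matrix (Fin n) (Fin n) ℝ) (hC : ∀ j, p (C.col j) ≤ 1) :
    π * |C.det| ≤ n.factorial * d := by
  have h1 := (mul_le_mul_right (volume_crossPolytope_le p C hC) (ENNReal.ofReal π)).trans h
  rw [← ENNReal.ofReal_mul hπ, ENNReal.ofReal_le_ofReal_iff (by positivity)] at h1
  have hf : (0 : ℝ) < n.factorial := by exact_mod_cast n.factorial_pos
  have h2 : π * (|C.det| * (2 ^ n / n.factorial)) = 2 ^ n * (π * |C.det| / n.factorial) := by ring
  rw [h2, mul_le_mul_iff_right₀ (by positivity), div_le_iff₀ hf] at h1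
  linarith

/-- If the columns of `M` are lattice points, the rows of `(det B)⁻¹ • adjugate M` lie in the polar
lattice. -/
theorem inv_det_smul_adjugate_mem_polarLattice {n : ℕ} {B M : Matrix (Fin n) (Fin n) ℝ}
    (hB : B.det ≠ 0) (hM : ∀ j, M.col j ∈ latticeOf B) (j : Fin n) :
    (B.det⁻¹ • M.adjugate).row j ∈ polarLattice (latticeOf B) := by
  choose z hz using hM
  rintro x ⟨w, rfl⟩
  let Z : Matrix (Fin n) (Fin n) ℤ := Matrix.of fun i k => z k i
  refine ⟨(Z.updateCol j w).det, ?_⟩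
  have hMZ : M.updateCol j (B.mulVec fun i => (w i : ℝ)) =
      B * (Z.updateCol j w).map (Int.castRingHom ℝ) := by
    ext i k
    rw [Matrix.mul_apply]
    by_cases hk : k = j
    · subst hk
      simp [Matrix.mulVec, dotProduct]
    · have := congrFun (hz k) i
      simpa [hk, Z, Matrix.mulVec, dotProduct] using this
  have hdet := congrArg Matrix.det hMZ
  rw [Matrix.det_mul, ← RingHom.mapMatrix_apply, ← RingHom.map_det, ← Matrix.cramer_apply,
    Matrix.cramer_eq_adjugate_mulVec] at hdet
  have : ∑ i, (B.mulVec fun i => (w i : ℝ)) i * (B.det⁻¹ • M.adjugate).row j i =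
      B.det⁻¹ * (M.adjugate.mulVec (B.mulVec fun i => (w i : ℝ))) j := by
    rw [Matrix.mulVec, dotProduct, Finset.mul_sum]
    refine Finset.sum_congr rfl fun i _ => ?_
    simp only [Matrix.row_apply, Matrix.smul_apply, smul_eq_mul]
    ring
  rw [this, hdet, inv_mul_cancel_left₀ hB]
  rfl

/-- Independent lattice points of increasing norm together with independent points of the polar
lattice of controlled dual norm. -/
theorem exists_dual_systems {n : ℕ} {B : Matrix (Fin n) (Fin n) ℝ} (hB : B.det ≠ 0)
    {K : Set (Fin n → ℝ)} (hKcomp : IsCompact K) {p : Seminorm ℝ (Fin n → ℝ)} (hp : Continuous p)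
    (hpK : ∀ x, x ∈ K ↔ p x ≤ 1) (hpos : ∀ x, x ≠ 0 → 0 < p x) :
    ∃ a b : Fin n → Fin n → ℝ, LinearIndependent ℝ a ∧ LinearIndependent ℝ b ∧
      (∀ j, a j ∈ latticeOf B) ∧ (∀ j, b j ∈ polarLattice (latticeOf B)) ∧
      (∀ j k, j ≤ k → p (a j) ≤ p (a k)) ∧
      ∀ j, ∀ x ∈ K, p (a j) * ∑ i, x i * b j i ≤ n.factorial := by
  obtain ⟨β, hβ, hmem⟩ := exists_basis_latticeOf hB
  have hΛ : latticeOf B = Submodule.span ℤ (Set.range β) := Set.ext hmem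
  have hfin : ∀ r, {x ∈ latticeOf B | p x ≤ r}.Finite := by
    intro r
    have hbdd : Bornology.IsBounded ((max r 1) • K) := hKcomp.isBounded.smul₀ _
    refine (ZSpan.setFinite_inter β hbdd).subset fun x hx => ⟨?_, (hmem x).1 hx.1⟩
    have hr : 0 < max r 1 := lt_max_of_lt_right one_pos
    rw [Set.mem_smul_set_iff_inv_smul_mem₀ hr.ne', hpK, map_smul_eq_mul,
      Real.norm_of_nonneg (by positivity), inv_mul_le_iff₀ hr, mul_one]
    exact hx.2.trans (le_max_left _ _)
  have hspan : Submodule.span ℝ (latticeOf B) = ⊤ := by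
    rw [← top_le_iff, ← β.span_eq, hΛ]
    exact Submodule.span_mono Submodule.subset_span
  obtain ⟨a, V, hV, hVr, ha⟩ := exists_greedy_flag p hfin hspan
  have hmono : Monotone V := fun j k hjk => by
    rw [hV, hV]
    exact Submodule.span_mono (Set.image_mono (Set.Iio_subset_Iio hjk))
  have hℓ0 : ∀ j < n, 0 < p (a j) := fun j hj => hpos _ fun h => (ha j hj).2.1 (by simp [h])
  have hℓ : ∀ j k, j ≤ k → k < n → p (a j) ≤ p (a k) := fun j k hjk hk =>
    (ha j (hjk.trans_lt hk)).2.2 _ (ha k hk).1 fun h => (ha k hk).2.1 (hmono hjk h)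
  have hmink := prod_mul_volume_ball_le hB p hp hmono hVr hℓ0
    (fun j hj => hℓ j (j + 1) (Nat.le_succ j) hj) fun j hj => (ha j hj).2.2
  rw [Finset.prod_range] at hmink
  have hπ : 0 < ∏ j : Fin n, p (a j) := Finset.prod_pos fun j _ => hℓ0 j j.2
  have hdet := prod_mul_abs_det_le hπ.le (abs_nonneg B.det) p hmink
  have hli : LinearIndependent ℝ fun j : Fin n => a j := by
    refine linearIndependent_of_top_le_span_of_card_eq_finrank ?_ (by simp)
    have : Set.range (fun j : Fin n => a j) = a '' Set.Iio n := by
      ext x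
      simp [Fin.exists_iff]
    rw [this, ← hV, Submodule.eq_top_of_finrank_eq (S := V n) (by simp [hVr])]
  let M : Matrix (Fin n) (Fin n) ℝ := Matrix.of fun i j => a j i
  have hMu : IsUnit M := Matrix.linearIndependent_cols_iff_isUnit.1 hli
  have hMdet : IsUnit M.det := (Matrix.isUnit_iff_isUnit_det M).1 hMu
  have hbli : LinearIndependent ℝ (B.det⁻¹ • M.adjugate).row := by
    rw [Matrix.linearIndependent_rows_iff_isUnit, Matrix.isUnit_iff_isUnit_det, Matrix.det_smul,
      Matrix.det_adjugate]
    exact ((isUnit_iff_ne_zero.2 (inv_ne_zero hB)).pow _).mul (hMdet.pow _)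
  refine ⟨fun j => a j, (B.det⁻¹ • M.adjugate).row, hli, hbli, fun j => (ha j j.2).1,
    inv_det_smul_adjugate_mem_polarLattice hB fun j => (ha j j.2).1, fun j k hjk => hℓ j k hjk k.2,
    fun j x hx => ?_⟩
  let C : Matrix (Fin n) (Fin n) ℝ :=
    Matrix.of fun i k => (p (a k))⁻¹ * M.updateCol j (p (a j) • x) i k
  have hC : ∀ k, p (C.col k) ≤ 1 := by
    intro k
    have hk := hℓ0 k k.2
    by_cases hkj : k = j
    · subst hkj
      have : C.col k = x := by
        ext i
        simp [C, hk.ne']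
      rw [this, ← hpK]
      exact hx
    · have : C.col k = (p (a k))⁻¹ • a k := by
        ext i
        simp [C, M, hkj]
      rw [this, map_smul_eq_mul, Real.norm_of_nonneg (by positivity), inv_mul_cancel₀ hk.ne']
  have h := hdet C hC
  rw [Matrix.det_mul_row, Matrix.det_updateCol_smul, Finset.prod_inv_distrib, abs_mul,
    abs_of_pos (inv_pos.2 hπ), mul_inv_cancel_left₀ hπ.ne', ← Matrix.cramer_apply,
    Matrix.cramer_eq_adjugate_mulVec] at h
  have hsum : ∑ i, x i * (B.det⁻¹ • M.adjugate).row j i =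
      B.det⁻¹ * (M.adjugate.mulVec x) j := by
    rw [Matrix.mulVec, dotProduct, Finset.mul_sum]
    refine Finset.sum_congr rfl fun i _ => ?_
    simp only [Matrix.row_apply, Matrix.smul_apply, smul_eq_mul]
    ring
  rw [hsum]
  have hB' : 0 < |B.det| := abs_pos.2 hB
  calc p (a j) * (B.det⁻¹ * (M.adjugate.mulVec x) j)
      ≤ |p (a j) * (B.det⁻¹ * (M.adjugate.mulVec x) j)| := le_abs_self _
    _ = |p (a j) * (M.adjugate.mulVec x) j| / |B.det| := by
        rw [← abs_div]
        congr 1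
        ring
    _ ≤ n.factorial := (div_le_iff₀ hB').2 h

/-- Two independent families with more than `n` vectors in total are not mutually orthogonal. -/
theorem exists_sum_mul_ne_zero {n i m : ℕ} {v : Fin i → Fin n → ℝ} {w : Fin m → Fin n → ℝ}
    (hv : LinearIndependent ℝ v) (hw : LinearIndependent ℝ w) (h : n < i + m) :
    ∃ k l, ∑ j, v k j * w l j ≠ 0 := by
  by_contra! h0
  have hmul : Matrix.of v * (Matrix.of w).transpose = 0 := by
    ext k l
    simpa [Matrix.mul_apply] using h0 k l
  have := Matrix.rank_add_rank_le_card_of_mul_eq_zero hmul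
  rw [Matrix.rank_transpose, LinearIndependent.rank_matrix (M := Matrix.of v) hv,
    LinearIndependent.rank_matrix (M := Matrix.of w) hw] at this
  simp only [Fintype.card_fin] at this
  omega

theorem one_le_mul_of_mem {n : ℕ} {K Λ : Set (Fin n → ℝ)} (hKsym : K = -K) {v w : Fin n → ℝ}
    (hvw : ∑ j, v j * w j ≠ 0) {lam mu : ℝ} (hlam : 0 < lam) (hmu : 0 < mu) (hvΛ : v ∈ Λ)
    (hv : v ∈ lam • K) (hwΛ : w ∈ polarLattice Λ) (hw : w ∈ mu • polarBody K) :
    1 ≤ lam * mu := by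
  obtain ⟨z, hz⟩ := hwΛ v hvΛ
  obtain ⟨x, hx, rfl⟩ := hv
  obtain ⟨y, hy, rfl⟩ := hw
  have hxy : |∑ j, x j * y j| ≤ 1 := by
    have h1 := hy x hx
    have h2 := hy (-x) (by rwa [hKsym, Set.neg_mem_neg])
    simp only [Pi.neg_apply, neg_mul, Finset.sum_neg_distrib] at h2
    exact abs_le.2 ⟨by linarith, h1⟩
  have hsum : ∑ j, (lam • x) j * (mu • y) j = lam * mu * ∑ j, x j * y j := by
    rw [Finset.mul_sum]
    refine Finset.sum_congr rfl fun j _ => ?_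
    simp only [Pi.smul_apply, smul_eq_mul]
    ring
  have hz0 : z ≠ 0 := by
    rintro rfl
    exact hvw (by simpa using hz)
  have hz1 : (1 : ℝ) ≤ |(z : ℝ)| := by exact_mod_cast Int.one_le_abs hz0
  rw [← hz, hsum, abs_mul, abs_of_pos (mul_pos hlam hmu)] at hz1
  exact hz1.trans (mul_le_of_le_one_right (by positivity) hxy)

/-- Mahler's transference bounds: For an `o`-symmetric convex
body `K ⊆ ℝⁿ` with `dim K = n`, a full-rank lattice `Λ = Bℤⁿ`, and `1 ≤ i ≤ n`,
`1 ≤ λ_i(K,Λ) · λ_{n+1-i}(K*,Λ*) ≤ n!`. -/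
theorem stmt_16 (n : ℕ) (B : Matrix (Fin n) (Fin n) ℝ) (hB : B.det ≠ 0)
    (K : Set (Fin n → ℝ)) (hKconv : Convex ℝ K) (hKcomp : IsCompact K)
    (hKsym : K = -K) (hKdim : (interior K).Nonempty)
    (i : ℕ) (hi1 : 1 ≤ i) (hin : i ≤ n) :
    1 ≤ succMin K (latticeOf B) i *
          succMin (polarBody K) (polarLattice (latticeOf B)) (n + 1 - i) ∧
      succMin K (latticeOf B) i *
          succMin (polarBody K) (polarLattice (latticeOf B)) (n + 1 - i) ≤
        (n.factorial : ℝ) := by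
  obtain ⟨p, hp, hpK, hpos⟩ := exists_seminorm_of_convexBody hKconv hKcomp hKsym hKdim
  obtain ⟨a, b, ha, hb, haΛ, hbΛ, hmono, hab⟩ := exists_dual_systems hB hKcomp hp hpK hpos
  have hf : (0 : ℝ) < n.factorial := by exact_mod_cast n.factorial_pos
  set r := p (a ⟨i - 1, by omega⟩) with hr
  have hr0 : 0 < r := hpos _ (ha.ne_zero _)
  set S := {lam : ℝ | 0 < lam ∧ ∃ v : Fin i → (Fin n → ℝ),
    LinearIndependent ℝ v ∧ ∀ k, v k ∈ latticeOf B ∧ v k ∈ lam • K} with hS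
  set S' := {lam : ℝ | 0 < lam ∧ ∃ v : Fin (n + 1 - i) → (Fin n → ℝ),
    LinearIndependent ℝ v ∧
      ∀ k, v k ∈ polarLattice (latticeOf B) ∧ v k ∈ lam • polarBody K} with hS'
  change 1 ≤ sInf S * sInf S' ∧ sInf S * sInf S' ≤ n.factorial
  have hrS : r ∈ S := by
    refine ⟨hr0, fun k => a (Fin.castLE hin k), ha.comp _ (Fin.castLE_injective hin),
      fun k => ⟨haΛ _, ?_⟩⟩
    rw [Set.mem_smul_set_iff_inv_smul_mem₀ hr0.ne', hpK, map_smul_eq_mul,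
      Real.norm_of_nonneg (by positivity), inv_mul_le_iff₀ hr0, mul_one]
    refine hmono _ _ (Fin.le_def.2 ?_)
    have := k.2
    simp only [Fin.val_castLE]
    omega
  have hrS' : n.factorial / r ∈ S' := by
    have hd : 0 < n.factorial / r := div_pos hf hr0
    refine ⟨hd, fun k => b ⟨i - 1 + k, by omega⟩, hb.comp _ fun k l hkl => ?_,
      fun k => ⟨hbΛ _, ?_⟩⟩
    · have := congrArg Fin.val hkl
      simp only at this
      exact Fin.ext (by omega)
    · rw [Set.mem_smul_set_iff_inv_smul_mem₀ hd.ne']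
      intro x hx
      have h1 := hab ⟨i - 1 + k, by omega⟩ x hx
      have h2 : r ≤ p (a ⟨i - 1 + k, by omega⟩) := hmono _ _ (Fin.le_def.2 (Nat.le_add_right _ _))
      simp only [Pi.smul_apply, smul_eq_mul, mul_left_comm (x _), ← Finset.mul_sum]
      rw [inv_mul_le_iff₀ hd, mul_one, le_div_iff₀ hr0]
      rcases le_total 0 (∑ j, x j * b ⟨i - 1 + k, by omega⟩ j) with h3 | h3
      · nlinarith
      · nlinarith
  have hmul : ∀ lam ∈ S, ∀ mu ∈ S', 1 ≤ lam * mu := by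
    rintro lam ⟨hlam, v, hv, hvK⟩ mu ⟨hmu, w, hw, hwK⟩
    obtain ⟨k, l, hkl⟩ := exists_sum_mul_ne_zero hv hw (by omega)
    exact one_le_mul_of_mem hKsym hkl hlam hmu (hvK k).1 (hvK k).2 (hwK l).1 (hwK l).2
  have hS0 : 0 ≤ sInf S := Real.sInf_nonneg fun _ h => h.1.le
  have hS0' : 0 ≤ sInf S' := Real.sInf_nonneg fun _ h => h.1.le
  constructor
  · have h1 : ∀ lam ∈ S, 1 ≤ lam * sInf S' := fun lam hlam => by
      rw [← inv_le_iff_one_le_mul₀' hlam.1]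
      exact le_csInf ⟨_, hrS'⟩ fun mu hmu => (inv_le_iff_one_le_mul₀' hlam.1).2 (hmul lam hlam mu hmu)
    have hpos' : 0 < sInf S' := hS0'.lt_of_ne fun h => by
      have := h1 r hrS
      rw [← h, mul_zero] at this
      linarith
    rw [← inv_le_iff_one_le_mul₀ hpos']
    exact le_csInf ⟨_, hrS⟩ fun lam hlam => (inv_le_iff_one_le_mul₀ hpos').2 (h1 lam hlam)
  · calc sInf S * sInf S' ≤ r * (n.factorial / r) :=
          mul_le_mul (csInf_le ⟨0, fun _ h => h.1.le⟩ hrS) (csInf_le ⟨0, fun _ h => h.1.le⟩ hrS')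
            hS0' hr0.le
      _ = n.factorial := mul_div_cancel₀ _ hr0.ne'
end
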